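/- Let n ≥ 1 and 0 < p, q < (Q+2)/(Q−2), where Q = 2n+2. Then the Lane–Emden system −Δ_ℍ u = v^p, −Δ_ℍ v = u^q on ℍⁿ has no positive cylindrical weak solution (u,v) ∈ (H¹_loc(ℍⁿ) ∩ C⁰(ℍⁿ)) × (H¹_loc(ℍⁿ) ∩ C⁰(ℍⁿ)). -/

import Mathlib

open MeasureTheory Real Filter Set Topology

noncomputable section

namespace Heisenberg

/-- The underlying space of the Heisenberg group `ℍⁿ`, identified with `ℝⁿ × ℝⁿ × ℝ`
(equipped with Lebesgue measure, which is the Haar measure of `ℍⁿ`). -/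
abbrev H (n : ℕ) : Type := (Fin n → ℝ) × (Fin n → ℝ) × ℝ

variable {n : ℕ}

/-- `|x|² + |y|²` for `ξ = (x, y, t)`. -/
def rsq (ξ : H n) : ℝ := ∑ i, (ξ.1 i) ^ 2 + ∑ i, (ξ.2.1 i) ^ 2

/-- The Kaplan gauge `|ξ|_ℍ = ((|x|²+|y|²)² + t²)^{1/4}`. -/
def gaugeH (ξ : H n) : ℝ := ((rsq ξ) ^ 2 + (ξ.2.2) ^ 2) ^ ((4 : ℝ)⁻¹)

/-- The left-invariant vector field `Xᵢ = ∂_{xᵢ} + 2yᵢ∂_t` applied to `φ`. -/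
def Xd (i : Fin n) (φ : H n → ℝ) (ξ : H n) : ℝ :=
  fderiv ℝ φ ξ (Pi.single i 1, 0, 2 * ξ.2.1 i)

/-- The left-invariant vector field `Yᵢ = ∂_{yᵢ} − 2xᵢ∂_t` applied to `φ`. -/
def Yd (i : Fin n) (φ : H n → ℝ) (ξ : H n) : ℝ :=
  fderiv ℝ φ ξ (0, Pi.single i 1, -(2 * ξ.1 i))

/-- The horizontal gradient `∇_ℍ φ = (X₁φ,…,Xₙφ,Y₁φ,…,Yₙφ)` of a differentiable function. -/
def hGrad (φ : H n → ℝ) (ξ : H n) : (Fin n → ℝ) × (Fin n → ℝ) :=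
  (fun i => Xd i φ ξ, fun i => Yd i φ ξ)

/-- Euclidean pairing of two horizontal vectors. -/
def hdot (a b : (Fin n → ℝ) × (Fin n → ℝ)) : ℝ :=
  ∑ i, a.1 i * b.1 i + ∑ i, a.2 i * b.2 i

/-- The (pointwise, classical) sub-Laplacian `Δ_ℍ = ∑ᵢ (Xᵢ² + Yᵢ²)`. -/
def subLap (u : H n → ℝ) (ξ : H n) : ℝ :=
  ∑ i, Xd i (Xd i u) ξ + ∑ i, Yd i (Yd i u) ξ

/-- `φ ∈ C¹_c(Ω)`. -/
structure IsTest (Ω : Set (H n)) (φ : H n → ℝ) : Prop where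
  contDiff : ContDiff ℝ 1 φ
  compactSupport : HasCompactSupport φ
  supportSubset : tsupport φ ⊆ Ω

/-- `G` is a weak horizontal gradient of `u` on `Ω`, with `u` locally integrable on `Ω`
and `G` locally square-integrable on `Ω` (i.e. `u ∈ H¹_loc(Ω)` with horizontal gradient `G`). -/
structure IsWeakHGrad (Ω : Set (H n)) (u : H n → ℝ)
    (G : H n → (Fin n → ℝ) × (Fin n → ℝ)) : Prop where
  locInt : LocallyIntegrableOn u Ω
  locSq : ∀ K : Set (H n), K ⊆ Ω → IsCompact K → IntegrableOn (fun ξ => ‖G ξ‖ ^ 2) K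
  ibpX : ∀ i : Fin n, ∀ φ : H n → ℝ, IsTest Ω φ →
    ∫ ξ, u ξ * Xd i φ ξ = -∫ ξ, (G ξ).1 i * φ ξ
  ibpY : ∀ i : Fin n, ∀ φ : H n → ℝ, IsTest Ω φ →
    ∫ ξ, u ξ * Yd i φ ξ = -∫ ξ, (G ξ).2 i * φ ξ

/-- `u ∈ H¹_loc(Ω)` is a weak solution of `−Δ_ℍ u = F` on `Ω`:
`∫ ∇_ℍu · ∇_ℍφ = ∫ F φ` for all `φ ∈ C¹_c(Ω)`. -/
def IsWeakSol (Ω : Set (H n)) (u F : H n → ℝ) : Prop :=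
  ∃ G : H n → (Fin n → ℝ) × (Fin n → ℝ), IsWeakHGrad Ω u G ∧
    ∀ φ : H n → ℝ, IsTest Ω φ → ∫ ξ, hdot (G ξ) (hGrad φ ξ) = ∫ ξ, F ξ * φ ξ

/-- A function on `ℍⁿ` is cylindrical if it depends only on `r = √(|x|²+|y|²)` and `t`. -/
def IsCylindrical (u : H n → ℝ) : Prop :=
  ∀ ξ ξ' : H n, rsq ξ = rsq ξ' → ξ.2.2 = ξ'.2.2 → u ξ = u ξ'

/-- The CR-inverted point `ξ̃`. -/
def tilde (ξ : H n) : H n :=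
  (fun i => (ξ.1 i * ξ.2.2 + ξ.2.1 i * rsq ξ) / gaugeH ξ ^ 4,
   fun i => (ξ.2.1 i * ξ.2.2 - ξ.1 i * rsq ξ) / gaugeH ξ ^ 4,
   -ξ.2.2 / gaugeH ξ ^ 4)

/-- The CR inversion `ū(ξ) = |ξ|_ℍ^{−(Q−2)} u(ξ̃)`, where `Q − 2 = 2n`. -/
def crInv (u : H n → ℝ) (ξ : H n) : ℝ := u (tilde ξ) / gaugeH ξ ^ (2 * n)

/-- The critical exponent `τ = (Q+2)/(Q−2)` with `Q = 2n+2`. -/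
def tau (n : ℕ) : ℝ := (2 * (n : ℝ) + 4) / (2 * (n : ℝ))

/-- The half space `Σ_λ = {ξ = (x,y,t) : t > λ}`. -/
def Sig (l : ℝ) : Set (H n) := {ξ | l < ξ.2.2}

/-- The H-reflection `ξ_λ = (y, x, 2λ − t)` with respect to the plane `T_λ = {t = λ}`. -/
def hRefl (l : ℝ) (ξ : H n) : H n := (ξ.2.1, ξ.1, 2 * l - ξ.2.2)

/-- The point `0_λ = (0, 0, 2λ)`. -/
def zl (l : ℝ) : H n := (0, 0, 2 * l)

/-- `U_λ = ū − ū_λ`, where `ū` is the CR inversion of `u` and `ū_λ(ξ) = ū(ξ_λ)`. -/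
def Ulam (u : H n → ℝ) (l : ℝ) (ξ : H n) : ℝ := crInv u ξ - crInv u (hRefl l ξ)

/-- `w ∈ L^{τ+1}(Σ_λ) ∩ L^∞(Σ_λ)`. -/
def MemLtau1Linf (l : ℝ) (w : H n → ℝ) : Prop :=
  IntegrableOn (fun ξ => |w ξ| ^ (tau n + 1)) (Sig l) ∧
    ∃ M : ℝ, ∀ ξ ∈ Sig (n := n) l, |w ξ| ≤ M

/-- `w ∈ H¹(Ω)`: square integrable on `Ω`, with a weak horizontal gradient which is
square integrable on `Ω`. -/
def MemH1 (Ω : Set (H n)) (w : H n → ℝ) : Prop :=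
  IntegrableOn (fun ξ => (w ξ) ^ 2) Ω ∧
  ∃ G : H n → (Fin n → ℝ) × (Fin n → ℝ),
    IntegrableOn (fun ξ => ‖G ξ‖ ^ 2) Ω ∧
    (∀ i : Fin n, ∀ φ : H n → ℝ, IsTest Ω φ →
      ∫ ξ, w ξ * Xd i φ ξ = -∫ ξ, (G ξ).1 i * φ ξ) ∧
    (∀ i : Fin n, ∀ φ : H n → ℝ, IsTest Ω φ →
      ∫ ξ, w ξ * Yd i φ ξ = -∫ ξ, (G ξ).2 i * φ ξ)

end Heisenberg

namespace Heisenberg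

variable {n : ℕ}

/-! ### Basic geometry -/

/-- `N = |ξ|^4`. -/
def Nn (ξ : H n) : ℝ := rsq ξ ^ 2 + ξ.2.2 ^ 2

/-- `ρ = |ξ|^2`. -/
def rho (ξ : H n) : ℝ := √(Nn ξ)

/-- Left translations. -/
def Lt (a η : H n) : H n :=
  (a.1 + η.1, a.2.1 + η.2.1,
    a.2.2 + η.2.2 + 2 * ∑ i, (a.2.1 i * η.1 i - a.1 i * η.2.1 i))

/-- Dilations. -/
def dil (μ : ℝ) (η : H n) : H n := (μ • η.1, μ • η.2.1, μ ^ 2 * η.2.2)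

/-- Very weak solutions. -/
def VW (u F : H n → ℝ) : Prop :=
  ∀ φ : H n → ℝ, ContDiff ℝ 2 φ → HasCompactSupport φ →
    ∫ ξ, u ξ * subLap φ ξ = - ∫ ξ, F ξ * φ ξ

lemma rsq_nonneg (ξ : H n) : 0 ≤ rsq ξ := by unfold rsq; positivity

lemma Nn_nonneg (ξ : H n) : 0 ≤ Nn ξ := by unfold Nn; positivity

lemma rho_nonneg (ξ : H n) : 0 ≤ rho ξ := Real.sqrt_nonneg _

lemma rho_sq (ξ : H n) : rho ξ ^ 2 = Nn ξ := Real.sq_sqrt (Nn_nonneg ξ)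

lemma rsq_contDiff {k : WithTop ℕ∞} : ContDiff ℝ k (rsq : H n → ℝ) := by
  unfold rsq; fun_prop

lemma Nn_contDiff {k : WithTop ℕ∞} : ContDiff ℝ k (Nn : H n → ℝ) := by
  have := rsq_contDiff (n := n) (k := k)
  unfold Nn; fun_prop

lemma rsq_cont : Continuous (rsq : H n → ℝ) := rsq_contDiff (k := 0).continuous
lemma Nn_cont : Continuous (Nn : H n → ℝ) := Nn_contDiff (k := 0).continuous
lemma rho_cont : Continuous (rho : H n → ℝ) := Nn_cont.sqrt

lemma Lt_contDiff (a : H n) {k : WithTop ℕ∞} : ContDiff ℝ k (Lt a) := by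
  unfold Lt; fun_prop

lemma Lt_cont (a : H n) : Continuous (Lt a) := (Lt_contDiff a (k := 0)).continuous

lemma Lt_cont2 : Continuous (fun p : H n × H n => Lt p.1 p.2) := by
  unfold Lt; fun_prop

lemma dil_cont2 : Continuous (fun p : ℝ × H n => dil p.1 p.2) := by
  unfold dil; fun_prop

lemma dil_cont (μ : ℝ) : Continuous (dil μ : H n → H n) := by
  unfold dil; fun_prop

lemma Lt_neg_cancel (a η : H n) : Lt (-a) (Lt a η) = η := by
  have : ∑ i, ((-a).2.1 i * (Lt a η).1 i - (-a).1 i * (Lt a η).2.1 i)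
      = - ∑ i, (a.2.1 i * η.1 i - a.1 i * η.2.1 i) := by
    rw [← Finset.sum_neg_distrib]
    refine Finset.sum_congr rfl fun i _ => ?_
    simp [Lt]; ring
  refine Prod.ext ?_ (Prod.ext ?_ ?_)
  · simp [Lt]
  · simp [Lt]
  · change (-a).2.2 + (Lt a η).2.2 + 2 * _ = _
    rw [this]; simp [Lt]; ring

lemma Lt_cancel_neg (a η : H n) : Lt a (Lt (-a) η) = η := by
  simpa using Lt_neg_cancel (-a) η

lemma dil_dil (μ ν : ℝ) (η : H n) : dil μ (dil ν η) = dil (μ * ν) η := by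
  simp [dil, smul_smul]
  ring

lemma dil_one (η : H n) : dil 1 η = η := by simp [dil]

lemma dil_zero (η : H n) : dil 0 η = 0 := by simp [dil]

lemma rsq_dil (μ : ℝ) (η : H n) : rsq (dil μ η) = μ ^ 2 * rsq η := by
  simp [rsq, dil, mul_pow, Finset.mul_sum, mul_add]

lemma Nn_dil (μ : ℝ) (η : H n) : Nn (dil μ η) = μ ^ 4 * Nn η := by
  simp only [Nn, rsq_dil]; simp [dil]; ring

lemma rho_dil (μ : ℝ) (η : H n) : rho (dil μ η) = μ ^ 2 * rho η := by
  rw [rho, Nn_dil, show μ ^ 4 * Nn η = (μ ^ 2) ^ 2 * Nn η by ring,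
    Real.sqrt_mul (by positivity), Real.sqrt_sq (by positivity), rho]

lemma Nn_eq_zero {η : H n} (h : Nn η = 0) : η = 0 := by
  have h1 : rsq η ^ 2 = 0 := by
    have := sq_nonneg (rsq η); have := sq_nonneg (η.2.2); unfold Nn at h; linarith
  have h2 : η.2.2 ^ 2 = 0 := by
    have := sq_nonneg (rsq η); have := sq_nonneg (η.2.2); unfold Nn at h; linarith
  have h3 : rsq η = 0 := by simpa using h1
  have h4 : η.2.2 = 0 := by simpa using h2
  unfold rsq at h3
  have h5 : ∑ i, (η.1 i) ^ 2 = 0 := by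
    have a1 : 0 ≤ ∑ i, (η.1 i) ^ 2 := by positivity
    have a2 : 0 ≤ ∑ i, (η.2.1 i) ^ 2 := by positivity
    linarith
  have h6 : ∑ i, (η.2.1 i) ^ 2 = 0 := by linarith
  rw [Finset.sum_eq_zero_iff_of_nonneg (fun i _ => sq_nonneg _)] at h5 h6
  refine Prod.ext ?_ (Prod.ext ?_ h4)
  · funext i; simpa using h5 i (Finset.mem_univ i)
  · funext i; simpa using h6 i (Finset.mem_univ i)

lemma Nn_zero : Nn (0 : H n) = 0 := by simp [Nn, rsq]

lemma rho_pos {η : H n} (h : η ≠ 0) : 0 < rho η := by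
  apply Real.sqrt_pos.2
  rcases (Nn_nonneg η).lt_or_eq with h1 | h1
  · exact h1
  · exact absurd (Nn_eq_zero h1.symm) h

lemma rsq_le_rho (η : H n) : rsq η ≤ rho η := by
  apply Real.le_sqrt_of_sq_le
  unfold Nn; nlinarith [sq_nonneg η.2.2]

lemma abs_t_le_rho (η : H n) : |η.2.2| ≤ rho η := by
  apply Real.abs_le_sqrt
  unfold Nn; nlinarith [sq_nonneg (rsq η)]

lemma isCompact_Nn (c : ℝ) : IsCompact {η : H n | Nn η ≤ c} := by
  apply Metric.isCompact_of_isClosed_isBounded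
  · exact isClosed_le Nn_cont continuous_const
  · rw [isBounded_iff_forall_norm_le]
    refine ⟨1 + √c, fun η hη => ?_⟩
    have hr : rho η ≤ √c := Real.sqrt_le_sqrt hη
    have hs : rsq η ≤ √c := (rsq_le_rho η).trans hr
    have ht : |η.2.2| ≤ √c := (abs_t_le_rho η).trans hr
    have hc : 0 ≤ √c := Real.sqrt_nonneg _
    have key : ∀ y : ℝ, y ^ 2 ≤ √c → |y| ≤ 1 + √c := by
      intro y hy
      rw [abs_le]; constructor <;> nlinarith
    have hx : ∀ i, (η.1 i) ^ 2 ≤ √c := fun i => by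
      refine le_trans ?_ hs
      have := Finset.single_le_sum (f := fun i => (η.1 i) ^ 2) (fun i _ => sq_nonneg _)
        (Finset.mem_univ i)
      have a2 : 0 ≤ ∑ i, (η.2.1 i) ^ 2 := by positivity
      unfold rsq; linarith
    have hy : ∀ i, (η.2.1 i) ^ 2 ≤ √c := fun i => by
      refine le_trans ?_ hs
      have := Finset.single_le_sum (f := fun i => (η.2.1 i) ^ 2) (fun i _ => sq_nonneg _)
        (Finset.mem_univ i)
      have a2 : 0 ≤ ∑ i, (η.1 i) ^ 2 := by positivity
      unfold rsq; linarith
    rw [norm_prod_le_iff, norm_prod_le_iff]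
    refine ⟨?_, ?_, ?_⟩
    · exact (pi_norm_le_iff_of_nonneg (by positivity)).2 fun i => key _ (hx i)
    · exact (pi_norm_le_iff_of_nonneg (by positivity)).2 fun i => key _ (hy i)
    · rw [Real.norm_eq_abs]; linarith

lemma rho_le_iff {η : H n} {c : ℝ} (hc : 0 ≤ c) : rho η ≤ c ↔ Nn η ≤ c ^ 2 := by
  unfold rho; exact Real.sqrt_le_left hc

lemma isCompact_rho (c : ℝ) : IsCompact {η : H n | rho η ≤ c} := by
  rcases le_or_gt 0 c with hc | hc
  · simp only [rho_le_iff hc]; exact isCompact_Nn _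
  · convert isCompact_empty
    ext η; simp; exact hc.trans_le (rho_nonneg η)

/-! ### Directional derivatives -/

lemma Xd_of_hasDerivAt {i : Fin n} {φ : H n → ℝ} {ξ : H n} {d : ℝ}
    (hφ : DifferentiableAt ℝ φ ξ)
    (h : HasDerivAt (fun τ : ℝ => φ (ξ + τ • ((Pi.single i 1, 0, 2 * ξ.2.1 i) : H n))) d 0) :
    Xd i φ ξ = d := by
  have := hφ.hasFDerivAt.hasLineDerivAt ((Pi.single i 1, 0, 2 * ξ.2.1 i) : H n)
  exact this.unique h

lemma Yd_of_hasDerivAt {i : Fin n} {φ : H n → ℝ} {ξ : H n} {d : ℝ}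
    (hφ : DifferentiableAt ℝ φ ξ)
    (h : HasDerivAt (fun τ : ℝ => φ (ξ + τ • ((0, Pi.single i 1, -(2 * ξ.1 i)) : H n))) d 0) :
    Yd i φ ξ = d := by
  have := hφ.hasFDerivAt.hasLineDerivAt ((0, Pi.single i 1, -(2 * ξ.1 i)) : H n)
  exact this.unique h

lemma sum_sq_add_single (x : Fin n → ℝ) (i : Fin n) (τ : ℝ) :
    ∑ j, (x j + τ * (Pi.single i 1 : Fin n → ℝ) j) ^ 2 = ∑ j, x j ^ 2 + 2 * τ * x i + τ ^ 2 := by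
  have : ∀ j, (x j + τ * (Pi.single i 1 : Fin n → ℝ) j) ^ 2
      = x j ^ 2 + (if j = i then 2 * τ * x i + τ ^ 2 else 0) := by
    intro j
    by_cases h : j = i
    · subst h; simp; ring
    · simp [h]
  simp only [this, Finset.sum_add_distrib]
  simp; ring

lemma rsq_lineX (ξ : H n) (i : Fin n) (τ c : ℝ) :
    rsq (ξ + τ • ((Pi.single i 1, 0, c) : H n)) = rsq ξ + 2 * τ * ξ.1 i + τ ^ 2 := by
  have := sum_sq_add_single ξ.1 i τ
  simp only [rsq, Prod.fst_add, Prod.smul_fst, Pi.add_apply, Pi.smul_apply, smul_eq_mul,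
    Prod.snd_add, Prod.smul_snd, Pi.zero_apply, smul_zero, add_zero, Pi.zero_apply, this]
  ring

lemma rsq_lineY (ξ : H n) (i : Fin n) (τ c : ℝ) :
    rsq (ξ + τ • ((0, Pi.single i 1, c) : H n)) = rsq ξ + 2 * τ * ξ.2.1 i + τ ^ 2 := by
  have := sum_sq_add_single ξ.2.1 i τ
  simp only [rsq, Prod.fst_add, Prod.smul_fst, Pi.add_apply, Pi.smul_apply, smul_eq_mul,
    Prod.snd_add, Prod.smul_snd, Pi.zero_apply, smul_zero, add_zero, Pi.zero_apply, this]
  ring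

lemma Xd_contDiff {i : Fin n} {φ : H n → ℝ} (hφ : ContDiff ℝ 2 φ) : ContDiff ℝ 1 (Xd i φ) := by
  unfold Xd
  have h1 : ContDiff ℝ 1 (fderiv ℝ φ) := hφ.fderiv_right (by norm_num)
  exact h1.clm_apply (by fun_prop)

lemma Yd_contDiff {i : Fin n} {φ : H n → ℝ} (hφ : ContDiff ℝ 2 φ) : ContDiff ℝ 1 (Yd i φ) := by
  unfold Yd
  have h1 : ContDiff ℝ 1 (fderiv ℝ φ) := hφ.fderiv_right (by norm_num)
  exact h1.clm_apply (by fun_prop)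

lemma Xd_cont {i : Fin n} {φ : H n → ℝ} (hφ : ContDiff ℝ 1 φ) : Continuous (Xd i φ) := by
  unfold Xd
  have h1 : Continuous (fderiv ℝ φ) := hφ.continuous_fderiv (by norm_num)
  exact h1.clm_apply (by fun_prop)

lemma Yd_cont {i : Fin n} {φ : H n → ℝ} (hφ : ContDiff ℝ 1 φ) : Continuous (Yd i φ) := by
  unfold Yd
  have h1 : Continuous (fderiv ℝ φ) := hφ.continuous_fderiv (by norm_num)
  exact h1.clm_apply (by fun_prop)

lemma Xd_tsupport (i : Fin n) (φ : H n → ℝ) : tsupport (Xd i φ) ⊆ tsupport φ := by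
  refine (closure_minimal ?_ (isClosed_tsupport _))
  intro ξ hξ
  by_contra h
  apply hξ
  have : fderiv ℝ φ ξ = 0 := by
    by_contra h2
    exact h (support_fderiv_subset ℝ h2)
  simp [Xd, this]

lemma Yd_tsupport (i : Fin n) (φ : H n → ℝ) : tsupport (Yd i φ) ⊆ tsupport φ := by
  refine (closure_minimal ?_ (isClosed_tsupport _))
  intro ξ hξ
  by_contra h
  apply hξ
  have : fderiv ℝ φ ξ = 0 := by
    by_contra h2
    exact h (support_fderiv_subset ℝ h2)
  simp [Yd, this]

lemma Xd_compact {i : Fin n} {φ : H n → ℝ} (h : HasCompactSupport φ) :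
    HasCompactSupport (Xd i φ) := h.of_isClosed_subset (isClosed_tsupport _) (Xd_tsupport i φ)

lemma Yd_compact {i : Fin n} {φ : H n → ℝ} (h : HasCompactSupport φ) :
    HasCompactSupport (Yd i φ) := h.of_isClosed_subset (isClosed_tsupport _) (Yd_tsupport i φ)

/-! ### The sub-Laplacian of functions of the gauge -/

section gaugefun
variable {h h1 h2 : ℝ → ℝ}

lemma Xd_gauge (hh : ∀ x, HasDerivAt h (h1 x) x) (i : Fin n) :
    Xd i (fun ξ : H n => h (Nn ξ)) =
      fun ξ => h1 (Nn ξ) * (4 * rsq ξ * ξ.1 i + 4 * ξ.2.2 * ξ.2.1 i) := by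
  funext ξ
  apply Xd_of_hasDerivAt
  · exact (hh _).differentiableAt.comp ξ (Nn_contDiff (k := 1).differentiable (by norm_num) ξ)
  · have e : (fun τ : ℝ => h (Nn (ξ + τ • ((Pi.single i 1, 0, 2 * ξ.2.1 i) : H n)))) =
        fun τ => h ((rsq ξ + 2 * τ * ξ.1 i + τ ^ 2) ^ 2 + (ξ.2.2 + τ * (2 * ξ.2.1 i)) ^ 2) := by
      funext τ; rw [Nn, rsq_lineX]; simp
    rw [e]
    have d : HasDerivAt (fun τ : ℝ => (rsq ξ + 2 * τ * ξ.1 i + τ ^ 2) ^ 2 +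
        (ξ.2.2 + τ * (2 * ξ.2.1 i)) ^ 2) (4 * rsq ξ * ξ.1 i + 4 * ξ.2.2 * ξ.2.1 i) 0 := by
      have a1 := (((((hasDerivAt_id (0:ℝ)).const_mul 2).mul_const (ξ.1 i)).const_add (rsq ξ)).add
        ((hasDerivAt_id (0:ℝ)).pow 2)).pow 2
      have a2 := (((hasDerivAt_id (0:ℝ)).mul_const (2 * ξ.2.1 i)).const_add (ξ.2.2)).pow 2
      refine HasDerivAt.congr_deriv (a1.add a2) ?_
      simp; ring
    have := (hh ((rsq ξ + 2 * 0 * ξ.1 i + 0 ^ 2) ^ 2 + (ξ.2.2 + 0 * (2 * ξ.2.1 i)) ^ 2)).comp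
      (0:ℝ) d
    refine HasDerivAt.congr_deriv (this) ?_
    simp [Nn]

lemma Yd_gauge (hh : ∀ x, HasDerivAt h (h1 x) x) (i : Fin n) :
    Yd i (fun ξ : H n => h (Nn ξ)) =
      fun ξ => h1 (Nn ξ) * (4 * rsq ξ * ξ.2.1 i - 4 * ξ.2.2 * ξ.1 i) := by
  funext ξ
  apply Yd_of_hasDerivAt
  · exact (hh _).differentiableAt.comp ξ (Nn_contDiff (k := 1).differentiable (by norm_num) ξ)
  · have e : (fun τ : ℝ => h (Nn (ξ + τ • ((0, Pi.single i 1, -(2 * ξ.1 i)) : H n)))) =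
        fun τ => h ((rsq ξ + 2 * τ * ξ.2.1 i + τ ^ 2) ^ 2 + (ξ.2.2 + τ * (-(2 * ξ.1 i))) ^ 2) := by
      funext τ; rw [Nn, rsq_lineY]; simp
    rw [e]
    have d : HasDerivAt (fun τ : ℝ => (rsq ξ + 2 * τ * ξ.2.1 i + τ ^ 2) ^ 2 +
        (ξ.2.2 + τ * (-(2 * ξ.1 i))) ^ 2) (4 * rsq ξ * ξ.2.1 i - 4 * ξ.2.2 * ξ.1 i) 0 := by
      have a1 := (((((hasDerivAt_id (0:ℝ)).const_mul 2).mul_const (ξ.2.1 i)).const_add (rsq ξ)).add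
        ((hasDerivAt_id (0:ℝ)).pow 2)).pow 2
      have a2 := (((hasDerivAt_id (0:ℝ)).mul_const (-(2 * ξ.1 i))).const_add (ξ.2.2)).pow 2
      refine HasDerivAt.congr_deriv (a1.add a2) ?_
      simp; ring
    have := (hh ((rsq ξ + 2 * 0 * ξ.2.1 i + 0 ^ 2) ^ 2 + (ξ.2.2 + 0 * (-(2 * ξ.1 i))) ^ 2)).comp
      (0:ℝ) d
    refine HasDerivAt.congr_deriv (this) ?_
    simp [Nn]

lemma XXd_gauge (hh : ∀ x, HasDerivAt h (h1 x) x) (hh1 : ∀ x, HasDerivAt h1 (h2 x) x)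
    (i : Fin n) (ξ : H n) :
    Xd i (Xd i (fun ξ : H n => h (Nn ξ))) ξ =
      h2 (Nn ξ) * (4 * rsq ξ * ξ.1 i + 4 * ξ.2.2 * ξ.2.1 i) ^ 2
      + h1 (Nn ξ) * (4 * rsq ξ + 8 * ξ.1 i ^ 2 + 8 * ξ.2.1 i ^ 2) := by
  rw [Xd_gauge hh]
  apply Xd_of_hasDerivAt
  · apply DifferentiableAt.mul
    · exact (hh1 _).differentiableAt.comp ξ (Nn_contDiff (k := 1).differentiable (by norm_num) ξ)
    · have := (rsq_contDiff (n := n) (k := 1)).differentiable (by norm_num) ξ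
      fun_prop
  · have e : (fun τ : ℝ => (fun ξ : H n => h1 (Nn ξ) *
          (4 * rsq ξ * ξ.1 i + 4 * ξ.2.2 * ξ.2.1 i))
          (ξ + τ • ((Pi.single i 1, 0, 2 * ξ.2.1 i) : H n))) =
        fun τ => h1 ((rsq ξ + 2 * τ * ξ.1 i + τ ^ 2) ^ 2 + (ξ.2.2 + τ * (2 * ξ.2.1 i)) ^ 2) *
          (4 * (rsq ξ + 2 * τ * ξ.1 i + τ ^ 2) * (ξ.1 i + τ) +
            4 * (ξ.2.2 + τ * (2 * ξ.2.1 i)) * ξ.2.1 i) := by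
      funext τ; simp only [Nn, rsq_lineX]; simp
    rw [e]
    have d0 := (((((hasDerivAt_id (0:ℝ)).const_mul 2).mul_const (ξ.1 i)).const_add (rsq ξ)).add
        ((hasDerivAt_id (0:ℝ)).pow 2))
    have d1 := (((hasDerivAt_id (0:ℝ)).mul_const (2 * ξ.2.1 i)).const_add (ξ.2.2))
    have d : HasDerivAt (fun τ : ℝ => (rsq ξ + 2 * τ * ξ.1 i + τ ^ 2) ^ 2 +
        (ξ.2.2 + τ * (2 * ξ.2.1 i)) ^ 2) (4 * rsq ξ * ξ.1 i + 4 * ξ.2.2 * ξ.2.1 i) 0 := by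
      refine HasDerivAt.congr_deriv ((d0.pow 2).add (d1.pow 2)) ?_
      simp; ring
    have d2 : HasDerivAt (fun τ : ℝ => (4 * (rsq ξ + 2 * τ * ξ.1 i + τ ^ 2) * (ξ.1 i + τ) +
            4 * (ξ.2.2 + τ * (2 * ξ.2.1 i)) * ξ.2.1 i))
            (4 * rsq ξ + 8 * ξ.1 i ^ 2 + 8 * ξ.2.1 i ^ 2) 0 := by
      refine HasDerivAt.congr_deriv (((d0.const_mul 4).mul ((hasDerivAt_id (0:ℝ)).const_add (ξ.1 i))).add
        ((d1.const_mul 4).mul_const (ξ.2.1 i))) ?_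
      simp; ring
    have := ((hh1 ((rsq ξ + 2 * 0 * ξ.1 i + 0 ^ 2) ^ 2 + (ξ.2.2 + 0 * (2 * ξ.2.1 i)) ^ 2)).comp
      (0:ℝ) d).mul d2
    refine HasDerivAt.congr_deriv (this) ?_
    simp [Nn]; ring

lemma YYd_gauge (hh : ∀ x, HasDerivAt h (h1 x) x) (hh1 : ∀ x, HasDerivAt h1 (h2 x) x)
    (i : Fin n) (ξ : H n) :
    Yd i (Yd i (fun ξ : H n => h (Nn ξ))) ξ =
      h2 (Nn ξ) * (4 * rsq ξ * ξ.2.1 i - 4 * ξ.2.2 * ξ.1 i) ^ 2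
      + h1 (Nn ξ) * (4 * rsq ξ + 8 * ξ.1 i ^ 2 + 8 * ξ.2.1 i ^ 2) := by
  rw [Yd_gauge hh]
  apply Yd_of_hasDerivAt
  · apply DifferentiableAt.mul
    · exact (hh1 _).differentiableAt.comp ξ (Nn_contDiff (k := 1).differentiable (by norm_num) ξ)
    · have := (rsq_contDiff (n := n) (k := 1)).differentiable (by norm_num) ξ
      fun_prop
  · have e : (fun τ : ℝ => (fun ξ : H n => h1 (Nn ξ) *
          (4 * rsq ξ * ξ.2.1 i - 4 * ξ.2.2 * ξ.1 i))
          (ξ + τ • ((0, Pi.single i 1, -(2 * ξ.1 i)) : H n))) =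
        fun τ => h1 ((rsq ξ + 2 * τ * ξ.2.1 i + τ ^ 2) ^ 2 + (ξ.2.2 + τ * (-(2 * ξ.1 i))) ^ 2) *
          (4 * (rsq ξ + 2 * τ * ξ.2.1 i + τ ^ 2) * (ξ.2.1 i + τ) -
            4 * (ξ.2.2 + τ * (-(2 * ξ.1 i))) * ξ.1 i) := by
      funext τ; simp only [Nn, rsq_lineY]; simp
    rw [e]
    have d0 := (((((hasDerivAt_id (0:ℝ)).const_mul 2).mul_const (ξ.2.1 i)).const_add (rsq ξ)).add
        ((hasDerivAt_id (0:ℝ)).pow 2))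
    have d1 := (((hasDerivAt_id (0:ℝ)).mul_const (-(2 * ξ.1 i))).const_add (ξ.2.2))
    have d : HasDerivAt (fun τ : ℝ => (rsq ξ + 2 * τ * ξ.2.1 i + τ ^ 2) ^ 2 +
        (ξ.2.2 + τ * (-(2 * ξ.1 i))) ^ 2) (4 * rsq ξ * ξ.2.1 i - 4 * ξ.2.2 * ξ.1 i) 0 := by
      refine HasDerivAt.congr_deriv ((d0.pow 2).add (d1.pow 2)) ?_
      simp; ring
    have d2 : HasDerivAt (fun τ : ℝ => (4 * (rsq ξ + 2 * τ * ξ.2.1 i + τ ^ 2) * (ξ.2.1 i + τ) -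
            4 * (ξ.2.2 + τ * (-(2 * ξ.1 i))) * ξ.1 i))
            (4 * rsq ξ + 8 * ξ.1 i ^ 2 + 8 * ξ.2.1 i ^ 2) 0 := by
      refine HasDerivAt.congr_deriv (((d0.const_mul 4).mul ((hasDerivAt_id (0:ℝ)).const_add (ξ.2.1 i))).sub
        ((d1.const_mul 4).mul_const (ξ.1 i))) ?_
      simp; ring
    have := ((hh1 ((rsq ξ + 2 * 0 * ξ.2.1 i + 0 ^ 2) ^ 2 + (ξ.2.2 + 0 * (-(2 * ξ.1 i))) ^ 2)).comp
      (0:ℝ) d).mul d2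
    refine HasDerivAt.congr_deriv (this) ?_
    simp [Nn]; ring

lemma subLap_gauge (hh : ∀ x, HasDerivAt h (h1 x) x) (hh1 : ∀ x, HasDerivAt h1 (h2 x) x)
    (ξ : H n) :
    subLap (fun ξ : H n => h (Nn ξ)) ξ =
      rsq ξ * (16 * Nn ξ * h2 (Nn ξ) + (8 * n + 16) * h1 (Nn ξ)) := by
  simp only [subLap, XXd_gauge hh hh1, YYd_gauge hh hh1]
  rw [← Finset.sum_add_distrib]
  have : ∀ i : Fin n, (h2 (Nn ξ) * (4 * rsq ξ * ξ.1 i + 4 * ξ.2.2 * ξ.2.1 i) ^ 2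
      + h1 (Nn ξ) * (4 * rsq ξ + 8 * ξ.1 i ^ 2 + 8 * ξ.2.1 i ^ 2)) +
      (h2 (Nn ξ) * (4 * rsq ξ * ξ.2.1 i - 4 * ξ.2.2 * ξ.1 i) ^ 2
      + h1 (Nn ξ) * (4 * rsq ξ + 8 * ξ.1 i ^ 2 + 8 * ξ.2.1 i ^ 2)) =
      (16 * h2 (Nn ξ) * Nn ξ + 16 * h1 (Nn ξ)) * (ξ.1 i ^ 2 + ξ.2.1 i ^ 2)
        + 8 * h1 (Nn ξ) * rsq ξ := by
    intro i; generalize h2 (Nn ξ) = A; generalize h1 (Nn ξ) = B; rw [Nn]; ring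
  simp only [this]
  rw [Finset.sum_add_distrib, ← Finset.mul_sum, Finset.sum_add_distrib]
  simp only [Finset.sum_const, Finset.card_univ, Fintype.card_fin, nsmul_eq_mul]
  rw [← rsq]; ring

end gaugefun

/-! ### Left invariance -/

lemma Lt_line (a ξ v : H n) (τ : ℝ) :
    Lt a (ξ + τ • v) = Lt a ξ + τ • ((v.1, v.2.1,
      v.2.2 + 2 * ∑ i, (a.2.1 i * v.1 i - a.1 i * v.2.1 i)) : H n) := by
  have : ∑ i, (a.2.1 i * (ξ + τ • v).1 i - a.1 i * (ξ + τ • v).2.1 i) =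
      ∑ i, (a.2.1 i * ξ.1 i - a.1 i * ξ.2.1 i) + τ * ∑ i, (a.2.1 i * v.1 i - a.1 i * v.2.1 i) := by
    rw [Finset.mul_sum, ← Finset.sum_add_distrib]
    refine Finset.sum_congr rfl fun i _ => ?_
    simp; ring
  simp only [Lt, this]
  refine Prod.ext ?_ (Prod.ext ?_ ?_)
  · simp [add_assoc]
  · simp [add_assoc]
  · simp; ring

lemma Xd_Lt {φ : H n → ℝ} (hφ : Differentiable ℝ φ) (a : H n) (i : Fin n) :
    Xd i (fun ξ => φ (Lt a ξ)) = fun ξ => Xd i φ (Lt a ξ) := by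
  funext ξ
  apply Xd_of_hasDerivAt
  · exact (hφ _).comp ξ ((Lt_contDiff a (k := 1)).differentiable (by norm_num) ξ)
  · have := (hφ (Lt a ξ)).hasFDerivAt.hasLineDerivAt
      ((Pi.single i 1, 0, 2 * (Lt a ξ).2.1 i) : H n)
    have e : (fun τ : ℝ => φ (Lt a (ξ + τ • ((Pi.single i 1, 0, 2 * ξ.2.1 i) : H n)))) =
        fun τ => φ (Lt a ξ + τ • ((Pi.single i 1, 0, 2 * (Lt a ξ).2.1 i) : H n)) := by
      funext τ
      rw [Lt_line]
      congr 5
      simp [Lt, Pi.single_apply]; ring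
    rw [e]; exact this

lemma Yd_Lt {φ : H n → ℝ} (hφ : Differentiable ℝ φ) (a : H n) (i : Fin n) :
    Yd i (fun ξ => φ (Lt a ξ)) = fun ξ => Yd i φ (Lt a ξ) := by
  funext ξ
  apply Yd_of_hasDerivAt
  · exact (hφ _).comp ξ ((Lt_contDiff a (k := 1)).differentiable (by norm_num) ξ)
  · have := (hφ (Lt a ξ)).hasFDerivAt.hasLineDerivAt
      ((0, Pi.single i 1, -(2 * (Lt a ξ).1 i)) : H n)
    have e : (fun τ : ℝ => φ (Lt a (ξ + τ • ((0, Pi.single i 1, -(2 * ξ.1 i)) : H n)))) =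
        fun τ => φ (Lt a ξ + τ • ((0, Pi.single i 1, -(2 * (Lt a ξ).1 i)) : H n)) := by
      funext τ
      rw [Lt_line]
      congr 5
      simp [Lt, Pi.single_apply]; ring
    rw [e]; exact this

lemma subLap_Lt {φ : H n → ℝ} (hφ : ContDiff ℝ 2 φ) (a ξ : H n) :
    subLap (fun ξ => φ (Lt a ξ)) ξ = subLap φ (Lt a ξ) := by
  have h0 := hφ.differentiable (by norm_num)
  simp only [subLap, Xd_Lt h0, Yd_Lt h0]
  congr 1
  · refine Finset.sum_congr rfl fun i _ => ?_
    rw [Xd_Lt ((Xd_contDiff hφ).differentiable (by norm_num))]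
  · refine Finset.sum_congr rfl fun i _ => ?_
    rw [Yd_Lt ((Yd_contDiff hφ).differentiable (by norm_num))]

end Heisenberg

namespace Heisenberg

variable {n : ℕ}

/-! ### Measure facts -/

lemma Lt_mp (a : H n) : MeasurePreserving (Lt a) := by
  have h3 : ∀ (x y : Fin n → ℝ), MeasurePreserving
      (fun t : ℝ => a.2.2 + t + 2 * ∑ i, (a.2.1 i * x i - a.1 i * y i)) := by
    intro x y
    have := measurePreserving_add_left (volume : Measure ℝ)
      (a.2.2 + 2 * ∑ i, (a.2.1 i * x i - a.1 i * y i))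
    have e : (fun t : ℝ => a.2.2 + t + 2 * ∑ i, (a.2.1 i * x i - a.1 i * y i)) =
        fun t => (a.2.2 + 2 * ∑ i, (a.2.1 i * x i - a.1 i * y i)) + t := by
      funext t; ring
    rw [e]; exact this
  have h2 : ∀ x : Fin n → ℝ, MeasurePreserving (fun q : (Fin n → ℝ) × ℝ =>
      (a.2.1 + q.1, a.2.2 + q.2 + 2 * ∑ i, (a.2.1 i * x i - a.1 i * q.1 i))) := by
    intro x
    exact MeasurePreserving.skew_product
      (g := fun (y : Fin n → ℝ) (t : ℝ) => a.2.2 + t + 2 * ∑ i, (a.2.1 i * x i - a.1 i * y i))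
      (measurePreserving_add_left _ a.2.1)
      (by apply Continuous.measurable; unfold Function.uncurry; fun_prop)
      (Eventually.of_forall fun y => (h3 x y).map_eq)
  exact MeasurePreserving.skew_product
      (g := fun (x : Fin n → ℝ) (q : (Fin n → ℝ) × ℝ) =>
      (a.2.1 + q.1, a.2.2 + q.2 + 2 * ∑ i, (a.2.1 i * x i - a.1 i * q.1 i)))
      (measurePreserving_add_left _ a.1)
      (by apply Continuous.measurable; unfold Function.uncurry; fun_prop)
      (Eventually.of_forall fun x => (h2 x).map_eq)

lemma Lt_embed (a : H n) : MeasurableEmbedding (Lt a) := by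
  refine MeasurableEquiv.measurableEmbedding
    (⟨⟨Lt a, Lt (-a), Lt_neg_cancel a, Lt_cancel_neg a⟩, (Lt_cont _).measurable,
      (Lt_cont _).measurable⟩ : H n ≃ᵐ H n)

lemma lint_Lt (a : H n) (g : H n → ENNReal) : ∫⁻ η, g (Lt a η) = ∫⁻ η, g η :=
  (Lt_mp a).lintegral_comp_emb (Lt_embed a) g

lemma int_Lt (a : H n) (g : H n → ℝ) : ∫ η, g (Lt a η) = ∫ η, g η :=
  (Lt_mp a).integral_comp (Lt_embed a) g

/-- Rotations, as linear maps. -/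
def rotL (c s : ℝ) : H n →ₗ[ℝ] H n where
  toFun η := (c • η.1 - s • η.2.1, s • η.1 + c • η.2.1, η.2.2)
  map_add' a b := by
    refine Prod.ext ?_ (Prod.ext ?_ ?_)
    · simp; abel
    · simp; abel
    · simp
  map_smul' r a := by
    refine Prod.ext ?_ (Prod.ext ?_ ?_)
    · simp [smul_sub, smul_smul, mul_comm]
    · simp [smul_add, smul_smul, mul_comm]
    · simp

/-- Rotations. -/
def rot (θ : ℝ) (η : H n) : H n := rotL (cos θ) (sin θ) η

lemma rot_def (θ : ℝ) (η : H n) : rot θ η =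
  (cos θ • η.1 - sin θ • η.2.1, sin θ • η.1 + cos θ • η.2.1, η.2.2) := rfl

lemma rot_t (θ : ℝ) (η : H n) : (rot θ η).2.2 = η.2.2 := rfl

lemma rsq_rot (θ : ℝ) (η : H n) : rsq (rot θ η) = rsq η := by
  simp only [rsq, rot_def, ← Finset.sum_add_distrib]
  refine Finset.sum_congr rfl fun i _ => ?_
  simp
  linear_combination ((η.1 i)^2 + (η.2.1 i)^2) * sin_sq_add_cos_sq θ

lemma Nn_rot (θ : ℝ) (η : H n) : Nn (rot θ η) = Nn η := by
  simp [Nn, rsq_rot, rot_t]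

lemma rho_rot (θ : ℝ) (η : H n) : rho (rot θ η) = rho η := by
  simp [rho, Nn_rot]

lemma rot_neg_cancel (θ : ℝ) (η : H n) : rot (-θ) (rot θ η) = η := by
  simp only [rot_def]
  refine Prod.ext ?_ (Prod.ext ?_ ?_)
  · funext i
    simp
    linear_combination (η.1 i) * sin_sq_add_cos_sq θ
  · funext i
    simp
    linear_combination (η.2.1 i) * sin_sq_add_cos_sq θ
  · simp

lemma rot_cancel_neg (θ : ℝ) (η : H n) : rot θ (rot (-θ) η) = η := by
  simpa using rot_neg_cancel (-θ) η

lemma rot_cont2 : Continuous (fun p : ℝ × H n => rot p.1 p.2) := by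
  simp only [rot_def]; fun_prop

lemma rot_cont (θ : ℝ) : Continuous (rot θ : H n → H n) := by
  simp only [funext (rot_def θ)]; fun_prop

lemma vol_ball_pos {r : ℝ} (hr : 0 < r) : 0 < volume {η : H n | rho η < r} := by
  apply IsOpen.measure_pos
  · exact isOpen_lt rho_cont continuous_const
  · exact ⟨0, by simp [rho, Nn_zero, hr]⟩

lemma vol_ball_fin (r : ℝ) : volume {η : H n | rho η < r} < ⊤ :=
  lt_of_le_of_lt (measure_mono (t := {η : H n | rho η ≤ r}) fun η (h : rho η < r) => le_of_lt h)
    (isCompact_rho r).measure_lt_top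

instance haarH : (volume : Measure (H n)).IsAddHaarMeasure := by
  have h1 : (volume : Measure ((Fin n → ℝ) × ℝ)).IsAddHaarMeasure := by
    rw [Measure.volume_eq_prod]; exact Measure.prod.instIsAddHaarMeasure _ _
  rw [Measure.volume_eq_prod]; exact Measure.prod.instIsAddHaarMeasure _ _

lemma rot_mp (θ : ℝ) : MeasurePreserving (rot θ : H n → H n) := by
  refine ⟨(rot_cont θ).measurable, ?_⟩
  have hdet : LinearMap.det (rotL (cos θ) (sin θ) : H n →ₗ[ℝ] H n) ≠ 0 := by
    have hc : (rotL (cos (-θ)) (sin (-θ)) : H n →ₗ[ℝ] H n) ∘ₗ rotL (cos θ) (sin θ)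
        = LinearMap.id := by
      ext1
      all_goals exact LinearMap.ext fun x => rot_neg_cancel θ _
    have := congrArg LinearMap.det hc
    rw [LinearMap.det_comp, LinearMap.det_id] at this
    intro h; rw [h, mul_zero] at this; exact zero_ne_one this
  have h := Measure.map_linearMap_addHaar_eq_smul_addHaar (volume : Measure (H n)) hdet
  change Measure.map (rot θ) volume = _ at h
  rw [h]
  set c := ENNReal.ofReal |(LinearMap.det (rotL (cos θ) (sin θ) : H n →ₗ[ℝ] H n))⁻¹| with hcdef
  have e := congrArg (fun m : Measure (H n) => m {η | rho η < 1}) h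
  change Measure.map (rot θ) volume _ = _ at e
  rw [Measure.map_apply (rot_cont θ).measurable
    (measurableSet_lt rho_cont.measurable measurable_const)] at e
  simp only [preimage_ofPred_eq, rho_rot, Measure.smul_apply, smul_eq_mul] at e
  have hp := vol_ball_pos (n := n) one_pos
  have hf := vol_ball_fin (n := n) 1
  have : c = 1 := by
    have := (ENNReal.mul_left_inj hp.ne' hf.ne (a := 1) (b := c)).1 (by rw [one_mul]; exact e)
    exact this.symm
  rw [this, one_smul]

lemma rot_embed (θ : ℝ) : MeasurableEmbedding (rot θ : H n → H n) :=
  MeasurableEquiv.measurableEmbedding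
    (⟨⟨rot θ, rot (-θ), rot_neg_cancel θ, rot_cancel_neg θ⟩, (rot_cont _).measurable,
      (rot_cont _).measurable⟩ : H n ≃ᵐ H n)

lemma lint_rot (θ : ℝ) (g : H n → ENNReal) : ∫⁻ η, g (rot θ η) = ∫⁻ η, g η :=
  (rot_mp θ).lintegral_comp_emb (rot_embed θ) g

lemma dil_map {μ : ℝ} (hμ : 0 < μ) : Measure.map (dil μ : H n → H n) volume =
    ENNReal.ofReal (μ ^ (2 * n + 2))⁻¹ • (volume : Measure (H n)) := by
  have e1 : Measure.map (fun x : Fin n → ℝ => μ • x) volume =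
      ENNReal.ofReal (μ ^ n)⁻¹ • (volume : Measure (Fin n → ℝ)) := by
    have := Measure.map_addHaar_smul (volume : Measure (Fin n → ℝ)) hμ.ne'
    rw [this, abs_of_pos (by positivity)]; simp
  have e2 : Measure.map (fun x : ℝ => μ ^ 2 * x) volume =
      ENNReal.ofReal (μ ^ 2)⁻¹ • (volume : Measure ℝ) := by
    have := Measure.map_addHaar_smul (volume : Measure ℝ) (r := μ ^ 2) (by positivity)
    rw [abs_of_pos (by positivity)] at this; simpa using this
  have e3 : (dil μ : H n → H n) =
    Prod.map (fun x : Fin n → ℝ => μ • x) (Prod.map (fun x : Fin n → ℝ => μ • x)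
      (fun x : ℝ => μ ^ 2 * x)) := by funext η; rfl
  rw [e3]
  rw [Measure.volume_eq_prod, ← Measure.map_prod_map _ _ (by fun_prop) (by fun_prop),
    Measure.volume_eq_prod, ← Measure.map_prod_map _ _ (by fun_prop) (by fun_prop), e1, e2]
  rw [Measure.prod_smul_right, Measure.prod_smul_left, Measure.prod_smul_left,
    Measure.prod_smul_right, Measure.prod_smul_right, smul_smul, smul_smul]
  congr 1
  rw [← ENNReal.ofReal_mul (by positivity), ← ENNReal.ofReal_mul (by positivity)]
  congr 1
  rw [← mul_inv, ← mul_inv]; congr 1; ring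

lemma dil_embed {μ : ℝ} (hμ : 0 < μ) : MeasurableEmbedding (dil μ : H n → H n) :=
  MeasurableEquiv.measurableEmbedding
    (⟨⟨dil μ, dil μ⁻¹, fun η => by rw [dil_dil, inv_mul_cancel₀ hμ.ne', dil_one],
      fun η => by rw [dil_dil, mul_inv_cancel₀ hμ.ne', dil_one]⟩, (dil_cont _).measurable,
      (dil_cont _).measurable⟩ : H n ≃ᵐ H n)

lemma lint_dil {μ : ℝ} (hμ : 0 < μ) (g : H n → ENNReal) :
    ∫⁻ η, g (dil μ η) = ENNReal.ofReal (μ ^ (2 * n + 2))⁻¹ * ∫⁻ η, g η := by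
  rw [← (dil_embed hμ).lintegral_map, dil_map hμ, lintegral_smul_measure, smul_eq_mul]

lemma int_dil {μ : ℝ} (hμ : 0 < μ) (g : H n → ℝ) :
    ∫ η, g (dil μ η) = (μ ^ (2 * n + 2))⁻¹ * ∫ η, g η := by
  rw [← (dil_embed hμ).integral_map, dil_map hμ, integral_smul_measure, smul_eq_mul,
    ENNReal.toReal_ofReal (by positivity)]

lemma t_null (t : ℝ) : volume {η : H n | η.2.2 = t} = 0 := by
  have q1 : Measure.QuasiMeasurePreserving (fun η : H n => η.2.2) :=
    (Measure.quasiMeasurePreserving_snd).comp (Measure.quasiMeasurePreserving_snd)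
  have := q1.preimage_null (s := {t}) (by simp)
  exact this

/-! ### Polar coordinates -/

lemma wset_meas (r : ℝ) : MeasurableSet {μ : ℝ | μ ^ 2 ≤ r ∧ r < 4 * μ ^ 2} := by
  have h1 : MeasurableSet {μ : ℝ | μ ^ 2 ≤ r} := measurableSet_le (by fun_prop) (by fun_prop)
  have h2 : MeasurableSet {μ : ℝ | r < 4 * μ ^ 2} := measurableSet_lt (by fun_prop) (by fun_prop)
  exact h1.inter h2

lemma weight_int {r : ℝ} (hr : 0 < r) :
    ∫⁻ μ in Ioi (0:ℝ), ({μ : ℝ | μ ^ 2 ≤ r ∧ r < 4 * μ ^ 2}).indicator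
      (fun μ => ENNReal.ofReal μ⁻¹) μ = ENNReal.ofReal (log 2) := by
  have hs : 0 < √r := Real.sqrt_pos.2 hr
  have hsq := Real.sq_sqrt hr.le
  have hm : MeasurableSet {μ : ℝ | μ ^ 2 ≤ r ∧ r < 4 * μ ^ 2} := wset_meas r
  rw [setLIntegral_indicator hm]
  have : {μ : ℝ | μ ^ 2 ≤ r ∧ r < 4 * μ ^ 2} ∩ Ioi 0 = Ioc (√r / 2) (√r) := by
    ext μ
    simp only [mem_inter_iff, mem_ofPred_eq, mem_Ioi, mem_Ioc]
    constructor
    · rintro ⟨⟨h1, h2⟩, h3⟩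
      constructor
      · nlinarith
      · exact Real.le_sqrt_of_sq_le h1
    · rintro ⟨h1, h2⟩
      have h3 : 0 < μ := by linarith
      refine ⟨⟨by nlinarith, by nlinarith⟩, h3⟩
  rw [this, ← ofReal_integral_eq_lintegral_ofReal, ← intervalIntegral.integral_of_le (by linarith),
    integral_inv_of_pos (by linarith) hs]
  · congr 2; field_simp
  · have : IntervalIntegrable (fun μ : ℝ => μ⁻¹) volume (√r / 2) √r := by
      apply intervalIntegral.intervalIntegrable_inv
      · intro x hx; rw [uIcc_of_le (by linarith)] at hx; linarith [hx.1]
      · fun_prop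
    exact (intervalIntegrable_iff_integrableOn_Ioc_of_le (by linarith)).1 this
  · refine (ae_restrict_iff' measurableSet_Ioc).2 (Eventually.of_forall fun x hx => ?_)
    have : 0 < x := by linarith [hx.1]
    simp; exact this.le

lemma zero_null [NeZero n] : volume ({0} : Set (H n)) = 0 := by
  refine measure_mono_null (t := {η : H n | η.2.2 = 0}) ?_ (t_null 0)
  rintro η rfl; simp

lemma ae_ne_zero : ∀ᵐ η : H n, η ≠ 0 := by
  rw [ae_iff]
  refine measure_mono_null (t := {η : H n | η.2.2 = 0}) ?_ (t_null 0)
  intro η h; simp at h; simp [h]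

/-- The reference annulus. -/
def ann : Set (H n) := {ζ | 1 ≤ rho ζ ∧ rho ζ < 4}

lemma ann_meas : MeasurableSet (ann : Set (H n)) :=
  (measurableSet_le measurable_const rho_cont.measurable).inter
    (measurableSet_lt rho_cont.measurable measurable_const)

lemma polar {g : H n → ENNReal} (hg : Measurable g) :
    ENNReal.ofReal (log 2) * ∫⁻ η, g η =
      ∫⁻ ζ in ann, ∫⁻ μ in Ioi (0:ℝ), g (dil μ ζ) * ENNReal.ofReal (μ ^ (2 * n + 1)) := by
  have hmeas : Measurable (fun p : H n × ℝ =>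
      g (dil p.2 p.1) * ENNReal.ofReal (p.2 ^ (2 * n + 1))) := by
    apply Measurable.mul
    · exact hg.comp (dil_cont2.measurable.comp measurable_swap)
    · fun_prop
  rw [lintegral_lintegral_swap hmeas.aemeasurable]
  have inner : ∀ μ ∈ Ioi (0:ℝ), ∫⁻ ζ in ann, g (dil μ ζ) * ENNReal.ofReal (μ ^ (2 * n + 1)) =
      ∫⁻ η : H n, ({μ : ℝ | μ ^ 2 ≤ rho η ∧ rho η < 4 * μ ^ 2}).indicator
        (fun μ => ENNReal.ofReal μ⁻¹) μ * g η := by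
    intro μ hμ
    have hμ' : 0 < μ := hμ
    rw [lintegral_mul_const _ (show Measurable (fun ζ => g (dil μ ζ)) from
      hg.comp (dil_cont μ).measurable), ← lintegral_indicator ann_meas]
    have e : ∀ ζ : H n, ann.indicator (fun ζ => g (dil μ ζ)) ζ =
        (fun η : H n => ({η | μ ^ 2 ≤ rho η ∧ rho η < 4 * μ ^ 2} : Set (H n)).indicator g η)
          (dil μ ζ) := by
      intro ζ
      have : ζ ∈ ann ↔ dil μ ζ ∈ ({η | μ ^ 2 ≤ rho η ∧ rho η < 4 * μ ^ 2} : Set (H n)) := by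
        simp only [ann, mem_ofPred_eq, rho_dil]
        have : 0 < μ ^ 2 := by positivity
        constructor
        · rintro ⟨h1, h2⟩; constructor <;> nlinarith
        · rintro ⟨h1, h2⟩; constructor <;> nlinarith
      by_cases h : ζ ∈ ann
      · simp only [indicator_of_mem h, indicator_of_mem (this.1 h)]
      · simp only [indicator_of_notMem h, indicator_of_notMem (fun h' => h (this.2 h'))]
    simp only [e]
    rw [lint_dil hμ', mul_right_comm, ← ENNReal.ofReal_mul (by positivity),
      show (μ ^ (2 * n + 2))⁻¹ * μ ^ (2 * n + 1) = μ⁻¹ by field_simp; ring, ← lintegral_const_mul]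
    · refine lintegral_congr fun η => ?_
      by_cases h : μ ^ 2 ≤ rho η ∧ rho η < 4 * μ ^ 2
      · rw [indicator_of_mem (by exact h), indicator_of_mem (by exact h)]
      · rw [indicator_of_notMem (by exact h), indicator_of_notMem (by exact h)]; simp
    · apply hg.indicator
      exact (measurableSet_le measurable_const rho_cont.measurable).inter
        (measurableSet_lt rho_cont.measurable measurable_const)
  rw [setLIntegral_congr_fun measurableSet_Ioi inner]
  have hms : MeasurableSet {p : ℝ × H n | p.1 ^ 2 ≤ rho p.2 ∧ rho p.2 < 4 * p.1 ^ 2} := by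
    have h1 : Continuous (fun p : ℝ × H n => rho p.2) := rho_cont.comp continuous_snd
    exact (measurableSet_le (by fun_prop) h1.measurable).inter
      (measurableSet_lt h1.measurable (by fun_prop))
  rw [lintegral_lintegral_swap]
  · rw [← lintegral_const_mul _ hg]
    refine lintegral_congr_ae ?_
    filter_upwards [ae_ne_zero (n := n)] with η hη
    rw [lintegral_mul_const, weight_int (rho_pos hη)]
    exact Measurable.indicator (by fun_prop) (wset_meas _)
  · apply Measurable.aemeasurable
    apply Measurable.mul
    · have : Measurable ({p : ℝ × H n | p.1 ^ 2 ≤ rho p.2 ∧ rho p.2 < 4 * p.1 ^ 2}.indicator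
        (fun p => ENNReal.ofReal p.1⁻¹)) := Measurable.indicator (by fun_prop) hms
      exact this
    · exact hg.comp measurable_snd

lemma log2_ne : ENNReal.ofReal (log 2) ≠ 0 := by
  simp [Real.log_pos]

lemma sphere_null (l : ℝ) : volume {η : H n | rho η = l} = 0 := by
  have hm : MeasurableSet {η : H n | rho η = l} := (measurableSet_eq_fun rho_cont.measurable measurable_const)
  have := polar (n := n) (g := {η : H n | rho η = l}.indicator 1) (measurable_one.indicator hm)
  rw [lintegral_indicator_one hm] at this
  have z : ∫⁻ ζ in (ann : Set (H n)), ∫⁻ μ in Ioi (0:ℝ),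
      {η : H n | rho η = l}.indicator 1 (dil μ ζ) * ENNReal.ofReal (μ ^ (2 * n + 1)) = 0 := by
    apply setLIntegral_eq_zero ann_meas
    intro ζ hζ
    have h1 : 0 < rho ζ := by linarith [hζ.1]
    have : ∀ᵐ μ ∂(volume.restrict (Ioi (0:ℝ))), μ ≠ √(l / rho ζ) := by
      apply ae_restrict_of_ae
      exact Measure.ae_ne volume _
    have hlim : ∀ᵐ μ ∂(volume.restrict (Ioi (0:ℝ))), μ ∈ Ioi (0:ℝ) :=
      ae_restrict_mem measurableSet_Ioi
    simp only [Pi.zero_apply]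
    rw [lintegral_eq_zero_iff']
    · filter_upwards [this, hlim] with μ h2 h3
      rw [indicator_of_notMem]
      · simp
      · simp only [mem_ofPred_eq, rho_dil]
        intro h4
        apply h2
        rw [← h4, mul_div_assoc, div_self h1.ne', mul_one, Real.sqrt_sq (le_of_lt h3)]
    · apply Measurable.aemeasurable
      apply Measurable.mul
      · exact (measurable_one.indicator hm).comp
          (dil_cont2.measurable.comp (measurable_id.prodMk measurable_const))
      · fun_prop
  rw [z] at this
  exact (mul_eq_zero.1 this).resolve_left log2_ne

/-- The inversion. -/
def J (l : ℝ) (η : H n) : H n := dil (l / rho η) η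

lemma rho_J {l : ℝ} {η : H n} (h : 0 < rho η) : rho (J l η) = l ^ 2 / rho η := by
  rw [J, rho_dil]; field_simp

lemma J_J {l : ℝ} (hl : 0 < l) {η : H n} (h : 0 < rho η) : J l (J l η) = η := by
  have := rho_J (l := l) h
  rw [J, this, J, dil_dil]
  rw [show l / (l ^ 2 / rho η) * (l / rho η) = 1 by field_simp, dil_one]

lemma J_meas (l : ℝ) : Measurable (J l : H n → H n) := by
  unfold J
  exact dil_cont2.measurable.comp ((measurable_const.div rho_cont.measurable).prodMk measurable_id)

lemma lint_J {l : ℝ} (hl : 0 < l) {g : H n → ENNReal} (hg : Measurable g) :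
    ∫⁻ η in {η | rho η < l}, g η =
      ∫⁻ η in {η | l < rho η}, g (J l η) * ENNReal.ofReal ((l / rho η) ^ (2 * n + 2)) := by
  have m1 : MeasurableSet {η : H n | rho η < l} := measurableSet_lt rho_cont.measurable measurable_const
  have m2 : MeasurableSet {η : H n | l < rho η} := measurableSet_lt measurable_const rho_cont.measurable
  have hg2 : Measurable (fun η : H n => g (J l η) * ENNReal.ofReal ((l / rho η) ^ (2 * n + 2))) := by
    apply (hg.comp (J_meas l)).mul
    exact ((measurable_const.div rho_cont.measurable).pow_const _).ennreal_ofReal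
  have key : ENNReal.ofReal (log 2) * ∫⁻ η in {η | rho η < l}, g η = ENNReal.ofReal (log 2) *
      ∫⁻ η in {η | l < rho η}, g (J l η) * ENNReal.ofReal ((l / rho η) ^ (2 * n + 2)) := by
    rw [← lintegral_indicator m1, ← lintegral_indicator m2, polar (hg.indicator m1),
      polar (hg2.indicator m2)]
    refine setLIntegral_congr_fun ann_meas fun ζ hζ => ?_
    have hr : 0 < rho ζ := by linarith [hζ.1]
    set r := rho ζ with hrdef
    have him : (fun ν : ℝ => l / (ν * r)) '' Ioi 0 = Ioi 0 := by
      ext μ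
      simp only [mem_image, mem_Ioi]
      constructor
      · rintro ⟨ν, h1, rfl⟩; positivity
      · intro h; exact ⟨l / (μ * r), by positivity, by field_simp⟩
    have hd : ∀ ν ∈ Ioi (0:ℝ), HasDerivWithinAt (fun ν : ℝ => l / (ν * r))
        (-(l / (ν ^ 2 * r))) (Ioi 0) ν := by
      intro ν hν
      have hν' : 0 < ν := hν
      have := ((hasDerivAt_const ν l).div ((hasDerivAt_id ν).mul_const r)
        (by simp; exact ⟨hν'.ne', hr.ne'⟩)).hasDerivWithinAt (s := Ioi 0)
      refine this.congr_deriv ?_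
      simp; field_simp
    have hinj : InjOn (fun ν : ℝ => l / (ν * r)) (Ioi 0) := by
      intro a ha b hb hab
      have ha' : 0 < a := ha
      have hb' : 0 < b := hb
      simp only at hab
      field_simp at hab
      linarith
    have := lintegral_image_eq_lintegral_abs_deriv_mul measurableSet_Ioi hd hinj
      (fun μ => {η : H n | rho η < l}.indicator g (dil μ ζ) * ENNReal.ofReal (μ ^ (2 * n + 1)))
    rw [him] at this
    rw [this]
    refine setLIntegral_congr_fun measurableSet_Ioi fun ν hν => ?_
    have hν' : 0 < ν := hν
    have hiff : dil (l / (ν * r)) ζ ∈ {η : H n | rho η < l} ↔ dil ν ζ ∈ {η : H n | l < rho η} := by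
      simp only [mem_ofPred_eq, rho_dil, ← hrdef]
      have e : (l / (ν * r)) ^ 2 * r = l * (l / (ν ^ 2 * r)) := by field_simp
      rw [e]
      constructor
      · intro h
        have : l / (ν ^ 2 * r) < 1 := by
          by_contra h'; push Not at h'; nlinarith
        rwa [div_lt_one (by positivity)] at this
      · intro h
        have : l / (ν ^ 2 * r) < 1 := by rwa [div_lt_one (by positivity)]
        nlinarith
    by_cases h : dil ν ζ ∈ {η : H n | l < rho η}
    · rw [indicator_of_mem h, indicator_of_mem (hiff.2 h)]
      have e1 : J l (dil ν ζ) = dil (l / (ν * r)) ζ := by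
        rw [J, rho_dil, dil_dil, ← hrdef]; congr 1; field_simp
      rw [e1, mul_left_comm, mul_assoc]
      congr 1
      rw [rho_dil, ← hrdef]
      rw [← ENNReal.ofReal_mul (by positivity), ← ENNReal.ofReal_mul (by positivity)]
      congr 1
      rw [abs_neg, abs_of_pos (by positivity)]
      have e2 : l / (ν * r) = (l / (ν ^ 2 * r)) * ν := by field_simp
      rw [e2, mul_pow]; ring
    · rw [indicator_of_notMem h, indicator_of_notMem (fun h' => h (hiff.1 h'))]; simp
  exact (ENNReal.mul_right_inj log2_ne ENNReal.ofReal_ne_top).1 key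

end Heisenberg

namespace Heisenberg

variable {n : ℕ}

/-! ### Weak solutions are very weak solutions -/

lemma weak_coord_meas {F : H n → ℝ} (hF : Continuous F) (hFp : ∀ ξ, 0 < F ξ)
    {G : H n → (Fin n → ℝ) × (Fin n → ℝ)}
    (hw : ∀ φ : H n → ℝ, IsTest univ φ → ∫ ξ, hdot (G ξ) (hGrad φ ξ) = ∫ ξ, F ξ * φ ξ)
    (L : H n →L[ℝ] ℝ) (g : H n → ℝ)
    (hL : ∀ c : ℝ, ∀ φ : H n → ℝ, ∀ ξ, φ =ᶠ[𝓝 ξ] (fun ζ => L ζ + c) →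
      hdot (G ξ) (hGrad φ ξ) = g ξ) : AEMeasurable g := by
  have hball : ∀ k : ℕ, AEMeasurable g (volume.restrict (Metric.ball (0 : H n) (k + 1))) := by
    intro k
    let χ : ContDiffBump (0 : H n) := ⟨k + 1, k + 2, by positivity, by linarith⟩
    have hχs : HasCompactSupport χ := χ.hasCompactSupport
    have hχc : ContDiff ℝ 1 χ := χ.contDiff
    have htest : ∀ c : ℝ, IsTest univ (fun ξ => (L ξ + c) * χ ξ) := by
      intro c
      refine ⟨?_, ?_, subset_univ _⟩
      · exact (L.contDiff.add contDiff_const).mul hχc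
      · exact hχs.mul_left
    have hintg : ∀ c : ℝ, Integrable (fun ξ => F ξ * ((L ξ + c) * χ ξ)) := by
      intro c
      apply Continuous.integrable_of_hasCompactSupport
      · exact hF.mul ((htest c).contDiff.continuous)
      · exact (htest c).compactSupport.mul_left
    have hpos : 0 < ∫ ξ, F ξ * χ ξ := by
      have hc : Continuous (fun ξ => F ξ * χ ξ) := hF.mul hχc.continuous
      apply hc.integral_pos_of_hasCompactSupport_nonneg_nonzero (hχs.mul_left)
        (fun ξ => mul_nonneg (hFp ξ).le χ.nonneg) (x := 0)
      have : χ 0 = 1 := χ.one_of_mem_closedBall (by simp [χ]; positivity)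
      rw [this]; simp [(hFp 0).ne']
    have hex : ∃ c : ℝ, ∫ ξ, F ξ * ((L ξ + c) * χ ξ) ≠ 0 := by
      by_contra hcon
      push Not at hcon
      have e := integral_sub (hintg 1) (hintg 0)
      rw [hcon 1, hcon 0] at e
      have : (fun ξ => F ξ * ((L ξ + 1) * χ ξ) - F ξ * ((L ξ + 0) * χ ξ)) =
        fun ξ => F ξ * χ ξ := by funext ξ; ring
      rw [this] at e; linarith
    obtain ⟨c, hc⟩ := hex
    rw [← hw _ (htest c)] at hc
    have hi : Integrable (fun ξ => hdot (G ξ) (hGrad (fun ξ => (L ξ + c) * χ ξ) ξ)) := by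
      by_contra h
      exact hc (integral_undef h)
    have hm := hi.aestronglyMeasurable.aemeasurable.restrict (s := Metric.ball (0 : H n) (k + 1))
    refine hm.congr ?_
    refine (ae_restrict_iff' Metric.isOpen_ball.measurableSet).2 (Eventually.of_forall ?_)
    intro ξ hξ
    apply hL c
    filter_upwards [Metric.isOpen_ball.mem_nhds hξ] with ζ hζ
    rw [χ.one_of_mem_closedBall (Metric.ball_subset_closedBall hζ), mul_one]
  have := aemeasurable_iUnion_iff.2 hball
  have hu : (⋃ k : ℕ, Metric.ball (0 : H n) (k + 1)) = univ := by
    apply eq_univ_of_forall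
    intro ξ
    obtain ⟨k, hk⟩ := exists_nat_gt ‖ξ‖
    exact mem_iUnion.2 ⟨k, by simp; linarith⟩
  rwa [hu, Measure.restrict_univ] at this

lemma hGrad_lin_X (i : Fin n) (c : ℝ) (G : H n → (Fin n → ℝ) × (Fin n → ℝ)) (φ : H n → ℝ) (ξ : H n)
    (h : φ =ᶠ[𝓝 ξ] fun ζ => ((ContinuousLinearMap.proj i).comp
      (ContinuousLinearMap.fst ℝ (Fin n → ℝ) ((Fin n → ℝ) × ℝ))) ζ + c) :
    hdot (G ξ) (hGrad φ ξ) = (G ξ).1 i := by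
  have hd : fderiv ℝ φ ξ = (ContinuousLinearMap.proj i).comp
      (ContinuousLinearMap.fst ℝ (Fin n → ℝ) ((Fin n → ℝ) × ℝ)) := by
    rw [h.fderiv_eq, fderiv_add_const]
    exact ContinuousLinearMap.fderiv _
  simp only [hdot, hGrad, Xd, Yd, hd]
  simp [Pi.single_apply]

lemma hGrad_lin_Y (i : Fin n) (c : ℝ) (G : H n → (Fin n → ℝ) × (Fin n → ℝ)) (φ : H n → ℝ) (ξ : H n)
    (h : φ =ᶠ[𝓝 ξ] fun ζ => ((ContinuousLinearMap.proj i).comp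
      ((ContinuousLinearMap.fst ℝ (Fin n → ℝ) ℝ).comp
        (ContinuousLinearMap.snd ℝ (Fin n → ℝ) ((Fin n → ℝ) × ℝ)))) ζ + c) :
    hdot (G ξ) (hGrad φ ξ) = (G ξ).2 i := by
  have hd : fderiv ℝ φ ξ = (ContinuousLinearMap.proj i).comp
      ((ContinuousLinearMap.fst ℝ (Fin n → ℝ) ℝ).comp
        (ContinuousLinearMap.snd ℝ (Fin n → ℝ) ((Fin n → ℝ) × ℝ))) := by
    rw [h.fderiv_eq, fderiv_add_const]
    exact ContinuousLinearMap.fderiv _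
  simp only [hdot, hGrad, Xd, Yd, hd]
  simp [Pi.single_apply]

lemma weak_mul_int {G : H n → (Fin n → ℝ) × (Fin n → ℝ)} {g f : H n → ℝ}
    (hsq : ∀ K : Set (H n), K ⊆ univ → IsCompact K → IntegrableOn (fun ξ => ‖G ξ‖ ^ 2) K)
    (hg : AEMeasurable g) (hgG : ∀ ξ, |g ξ| ≤ ‖G ξ‖) (hf : Continuous f)
    (hfs : HasCompactSupport f) : Integrable (fun ξ => g ξ * f ξ) := by
  obtain ⟨C, hC⟩ := hfs.exists_bound_of_continuous hf
  have h1 : IntegrableOn (fun ξ => C * (1 + ‖G ξ‖ ^ 2)) (tsupport f) := by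
    apply Integrable.const_mul
    apply Integrable.add
    · exact integrableOn_const hfs.measure_lt_top.ne
    · exact hsq _ (subset_univ _) hfs
  have h2 : Integrable ((tsupport f).indicator (fun ξ => C * (1 + ‖G ξ‖ ^ 2))) :=
    (integrable_indicator_iff (isClosed_tsupport f).measurableSet).2 h1
  refine h2.mono' (hg.mul hf.measurable.aemeasurable).aestronglyMeasurable
    (Eventually.of_forall fun ξ => ?_)
  by_cases h : ξ ∈ tsupport f
  · rw [indicator_of_mem h, norm_mul, Real.norm_eq_abs (g ξ), mul_comm]
    have a1 := hC ξ
    have a2 := hgG ξ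
    have a3 : |g ξ| ≤ 1 + ‖G ξ‖ ^ 2 := by nlinarith [norm_nonneg (G ξ), sq_nonneg (‖G ξ‖ - 1)]
    exact mul_le_mul a1 a3 (abs_nonneg _) ((norm_nonneg _).trans a1)
  · rw [indicator_of_notMem h, image_eq_zero_of_notMem_tsupport h]; simp

lemma VW_of_weak {u F : H n → ℝ} (hu : Continuous u) (hF : Continuous F) (hFp : ∀ ξ, 0 < F ξ)
    (h : IsWeakSol univ u F) : VW u F := by
  obtain ⟨G, hG, hw⟩ := h
  have mX : ∀ i, AEMeasurable (fun ξ => (G ξ).1 i) := fun i =>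
    weak_coord_meas hF hFp hw _ _ (fun c φ ξ h => hGrad_lin_X i c G φ ξ h)
  have mY : ∀ i, AEMeasurable (fun ξ => (G ξ).2 i) := fun i =>
    weak_coord_meas hF hFp hw _ _ (fun c φ ξ h => hGrad_lin_Y i c G φ ξ h)
  intro φ hφ hs
  have h1 : ContDiff ℝ 1 φ := hφ.of_le (by norm_num)
  have iX : ∀ i, Integrable (fun ξ => (G ξ).1 i * Xd i φ ξ) := fun i =>
    weak_mul_int hG.locSq (mX i) (fun ξ => (norm_le_pi_norm (G ξ).1 i).trans (norm_fst_le _))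
      (Xd_cont h1) (Xd_compact hs)
  have iY : ∀ i, Integrable (fun ξ => (G ξ).2 i * Yd i φ ξ) := fun i =>
    weak_mul_int hG.locSq (mY i) (fun ξ => (norm_le_pi_norm (G ξ).2 i).trans (norm_snd_le _))
      (Yd_cont h1) (Yd_compact hs)
  have jX : ∀ i, Integrable (fun ξ => u ξ * Xd i (Xd i φ) ξ) := fun i =>
    (hu.mul (Xd_cont (Xd_contDiff hφ))).integrable_of_hasCompactSupport
      (Xd_compact (Xd_compact hs)).mul_left
  have jY : ∀ i, Integrable (fun ξ => u ξ * Yd i (Yd i φ) ξ) := fun i =>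
    (hu.mul (Yd_cont (Yd_contDiff hφ))).integrable_of_hasCompactSupport
      (Yd_compact (Yd_compact hs)).mul_left
  have e := hw φ ⟨h1, hs, subset_univ _⟩
  simp only [hdot, hGrad] at e
  rw [integral_add (integrable_finsetSum _ fun i _ => iX i)
    (integrable_finsetSum _ fun i _ => iY i), integral_finsetSum _ fun i _ => iX i,
    integral_finsetSum _ fun i _ => iY i] at e
  simp only [subLap, mul_add, Finset.mul_sum]
  rw [integral_add (integrable_finsetSum _ fun i _ => jX i)
    (integrable_finsetSum _ fun i _ => jY i), integral_finsetSum _ fun i _ => jX i,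
    integral_finsetSum _ fun i _ => jY i, ← e, neg_add, ← Finset.sum_neg_distrib,
    ← Finset.sum_neg_distrib]
  congr 1
  · exact Finset.sum_congr rfl fun i _ =>
      hG.ibpX i _ ⟨Xd_contDiff hφ, Xd_compact hs, subset_univ _⟩
  · exact Finset.sum_congr rfl fun i _ =>
      hG.ibpY i _ ⟨Yd_contDiff hφ, Yd_compact hs, subset_univ _⟩

end Heisenberg

namespace Heisenberg

variable {n : ℕ}

/-! ### The truncated fundamental solution -/

lemma glue_deriv {f g f' g' : ℝ → ℝ} (hf : ∀ x, HasDerivAt f (f' x) x)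
    (hg : ∀ x, 1 ≤ x → HasDerivAt g (g' x) x) (h0 : f 1 = g 1) (h1 : f' 1 = g' 1) (x : ℝ) :
    HasDerivAt (fun x => if x ≤ 1 then f x else g x) (if x ≤ 1 then f' x else g' x) x := by
  rcases lt_trichotomy x 1 with h | h | h
  · rw [if_pos h.le]
    refine (hf x).congr_of_eventuallyEq ?_
    filter_upwards [Iio_mem_nhds h] with y hy
    rw [if_pos (le_of_lt hy)]
  · subst h
    rw [if_pos le_rfl]
    have a1 : HasDerivWithinAt (fun x => if x ≤ 1 then f x else g x) (f' 1) (Iic 1) 1 :=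
      (hf 1).hasDerivWithinAt.congr (fun y hy => if_pos hy) (if_pos le_rfl)
    have a2 : HasDerivWithinAt (fun x => if x ≤ 1 then f x else g x) (f' 1) (Ici 1) 1 := by
      rw [h1]
      refine (hg 1 le_rfl).hasDerivWithinAt.congr (fun y hy => ?_) ?_
      · rcases (show (1:ℝ) ≤ y from hy).eq_or_lt with h | h
        · subst h; simp [h0]
        · rw [if_neg (not_le.2 h)]
      · simp [h0]
    have := a1.union a2
    rw [Iic_union_Ici, hasDerivWithinAt_univ] at this
    exact this
  · rw [if_neg (not_le.2 h)]
    refine (hg x h.le).congr_of_eventuallyEq ?_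
    filter_upwards [Ioi_mem_nhds h] with y hy
    rw [if_neg (not_le.2 hy)]

/-- The profile. -/
def hf0 (a M : ℝ) : ℝ := if M ≤ 1 then 1 + a * (1 - M) + a * (a + 1) / 2 * (1 - M) ^ 2
  else M ^ (-a)
/-- First derivative of the profile. -/
def hf1 (a M : ℝ) : ℝ := if M ≤ 1 then -a - a * (a + 1) * (1 - M) else -a * M ^ (-a - 1)
/-- Second derivative of the profile. -/
def hf2 (a M : ℝ) : ℝ := if M ≤ 1 then a * (a + 1) else a * (a + 1) * M ^ (-a - 2)

lemma hf0_deriv (a x : ℝ) : HasDerivAt (hf0 a) (hf1 a x) x := by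
  apply glue_deriv (f := fun M => 1 + a * (1 - M) + a * (a + 1) / 2 * (1 - M) ^ 2)
    (g := fun M => M ^ (-a)) (f' := fun M => -a - a * (a + 1) * (1 - M))
    (g' := fun M => -a * M ^ (-a - 1))
  · intro x
    have d := (hasDerivAt_id x).const_sub 1
    refine (((d.const_mul a).const_add 1).add ((d.pow 2).const_mul (a * (a + 1) / 2))).congr_deriv ?_
    simp; ring
  · intro x hx
    exact Real.hasDerivAt_rpow_const (Or.inl (by linarith))
  · simp
  · simp

lemma hf1_deriv (a x : ℝ) : HasDerivAt (hf1 a) (hf2 a x) x := by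
  apply glue_deriv (f := fun M => -a - a * (a + 1) * (1 - M))
    (g := fun M => -a * M ^ (-a - 1)) (f' := fun _ => a * (a + 1))
    (g' := fun M => a * (a + 1) * M ^ (-a - 2))
  · intro x
    have d := (hasDerivAt_id x).const_sub 1
    refine ((d.const_mul (a * (a + 1))).const_sub (-a)).congr_deriv ?_
    simp
  · intro x hx
    refine ((Real.hasDerivAt_rpow_const (p := -a - 1) (Or.inl (by linarith))).const_mul
      (-a)).congr_deriv ?_
    rw [show -a - 1 - 1 = -a - 2 by ring]; ring
  · simp
  · simp

lemma hf2_cont (a : ℝ) : Continuous (hf2 a) := by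
  unfold hf2
  apply continuous_if_le (by fun_prop) (by fun_prop)
  · fun_prop
  · apply ContinuousOn.mul continuousOn_const
    refine ContinuousOn.rpow_const continuousOn_id fun x hx => Or.inl ?_
    have : (1:ℝ) ≤ x := hx
    simp; linarith
  · rintro x rfl; simp

lemma hf0_contDiff (a : ℝ) : ContDiff ℝ 2 (hf0 a) := by
  have d0 : deriv (hf0 a) = hf1 a := funext fun x => (hf0_deriv a x).deriv
  have d1 : deriv (hf1 a) = hf2 a := funext fun x => (hf1_deriv a x).deriv
  have h1 : ContDiff ℝ 1 (hf1 a) := by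
    rw [contDiff_one_iff_deriv, d1]
    exact ⟨fun x => (hf1_deriv a x).differentiableAt, hf2_cont a⟩
  rw [show (2 : WithTop ℕ∞) = 1 + 1 from rfl, contDiff_succ_iff_deriv, d0]
  exact ⟨fun x => (hf0_deriv a x).differentiableAt, by simp, h1⟩

/-- The source profile. -/
def psi (a M : ℝ) : ℝ := 16 * a * (a + 1) * (a + 2) * max (1 - M) 0

lemma psi_eq (a M : ℝ) :
    -(16 * M * hf2 a M + 16 * (a + 1) * hf1 a M) = psi a M := by
  unfold hf1 hf2 psi
  by_cases h : M ≤ 1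
  · rw [if_pos h, if_pos h, max_eq_left (by linarith)]; ring
  · push Not at h
    rw [if_neg (not_le.2 h), if_neg (not_le.2 h), max_eq_right (by linarith)]
    have : M ^ (-a - 1) = M * M ^ (-a - 2) := by
      rw [show -a - 1 = (-a - 2) + 1 by ring, Real.rpow_add_one (by linarith)]; ring
    rw [this]; ring

lemma hf0_pos {a : ℝ} (ha : 0 ≤ a) {M : ℝ} : 0 < hf0 a M := by
  unfold hf0
  split_ifs with h
  · have : 0 ≤ 1 - M := by linarith
    positivity
  · exact Real.rpow_pos_of_pos (by linarith) _

lemma hf0_le {a : ℝ} (ha : 0 ≤ a) {M : ℝ} (hM : 0 ≤ M) : hf0 a M ≤ hf0 a 0 := by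
  unfold hf0
  rw [if_pos zero_le_one]
  split_ifs with h
  · have h1 : (1 - M) ^ 2 ≤ (1 - 0) ^ 2 := by nlinarith
    have h2 : 0 ≤ a * (a + 1) / 2 := by positivity
    nlinarith [mul_nonneg ha hM]
  · have : M ^ (-a) ≤ 1 := Real.rpow_le_one_of_one_le_of_nonpos (by linarith) (by linarith)
    have h2 : 0 ≤ a * (a + 1) / 2 := by positivity
    nlinarith

lemma hf0_key {a : ℝ} (ha : 0 ≤ a) {x : ℝ} (hx : 0 ≤ x) : 0 ≤ a * hf0 a x + x * hf1 a x := by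
  unfold hf0 hf1
  split_ifs with h
  · have : a * (1 + a * (1 - x) + a * (a + 1) / 2 * (1 - x) ^ 2) +
      x * (-a - a * (a + 1) * (1 - x)) = a * (a + 1) * (1 - x) ^ 2 * (a / 2 + 1) := by ring
    rw [this]; positivity
  · push Not at h
    have : x ^ (-a) = x * x ^ (-a - 1) := by
      rw [show -a = (-a - 1) + 1 by ring, Real.rpow_add_one (by linarith)]
      rw [show -a - 1 + 1 - 1 = -a - 1 by ring]; ring
    rw [this]
    apply le_of_eq; ring

/-- Rescaled profile. -/
def hm (n : ℕ) (μ M : ℝ) : ℝ := (μ ^ (2 * n))⁻¹ * hf0 (n / 2) (M / μ ^ 4)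

lemma ahalf (n : ℕ) : (0:ℝ) ≤ n / 2 := by positivity

lemma hm_pos {μ M : ℝ} (hμ : 0 < μ) : 0 < hm n μ M := by
  have := hf0_pos (ahalf n) (M := M / μ ^ 4)
  unfold hm; positivity

lemma hm_le {μ M : ℝ} (hμ : 0 < μ) (hM : 0 ≤ M) : hm n μ M ≤ (μ ^ (2 * n))⁻¹ * hf0 (n / 2) 0 := by
  unfold hm
  gcongr
  exact hf0_le (ahalf n) (by positivity)

lemma hm_of_ge {μ M : ℝ} (hμ : 0 < μ) (h : μ ^ 4 ≤ M) : hm n μ M = M ^ (-((n:ℝ) / 2)) := by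
  have hM : 0 < M := lt_of_lt_of_le (by positivity) h
  have e : hf0 (n / 2) (M / μ ^ 4) = (M / μ ^ 4) ^ (-((n:ℝ) / 2)) := by
    unfold hf0
    split_ifs with h1
    · have : M / μ ^ 4 = 1 := le_antisymm h1 ((one_le_div (by positivity)).2 h)
      rw [this]; simp
    · rfl
  have e2 : (μ ^ 4) ^ (-((n:ℝ) / 2)) = (μ ^ (2 * n))⁻¹ := by
    rw [Real.rpow_neg (by positivity), ← Real.rpow_natCast μ 4, ← Real.rpow_mul hμ.le,
      ← Real.rpow_natCast μ (2 * n)]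
    congr 2; push_cast; ring
  rw [hm, e, Real.div_rpow hM.le (by positivity), e2]
  field_simp

lemma hm_scale {T μ x : ℝ} (hT : 0 < T) :
    hm n (T * μ) (T ^ 4 * x) = (T ^ (2 * n))⁻¹ * hm n μ x := by
  unfold hm
  rw [mul_pow, mul_pow, mul_inv, mul_assoc, mul_div_mul_left _ _ (by positivity)]

lemma hm_anti {ε R M : ℝ} (hε : 0 < ε) (h : ε ≤ R) (hM : 0 ≤ M) : hm n R M ≤ hm n ε M := by
  have hd : ∀ μ : ℝ, 0 < μ → HasDerivAt (fun μ => hm n μ M)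
      (-(4 * (μ ^ (2 * n + 1))⁻¹ * ((n:ℝ)/2 * hf0 (n/2) (M / μ ^ 4) +
        (M / μ ^ 4) * hf1 (n / 2) (M / μ ^ 4)))) μ := by
    intro μ hμ
    have d1 := ((hasDerivAt_id μ).pow (2 * n)).inv (by simp; intro h; exact absurd h hμ.ne')
    have d2 := (hasDerivAt_const μ M).div ((hasDerivAt_id μ).pow 4) (by simp; exact hμ.ne')
    have d3 := (hf0_deriv (n/2) (M / μ ^ 4)).comp μ d2
    refine (d1.mul d3).congr_deriv ?_
    simp only [id, Pi.pow_apply, Pi.inv_apply, Function.comp, Pi.div_apply]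
    generalize hf0 (n/2) (M / μ ^ 4) = A
    have hh : (↑(2 * n) * μ ^ (2 * n - 1) : ℝ) * μ = 2 * n * μ ^ (2 * n) := by
      rcases Nat.eq_zero_or_pos n with h0 | h0
      · subst h0; simp
      · rw [mul_assoc, ← pow_succ, show 2 * n - 1 + 1 = 2 * n by omega]; push_cast; ring
    have hh2 : (↑(2 * n) * μ ^ (2 * n - 1) : ℝ) = 2 * n * μ ^ (2 * n) / μ := by
      rw [← hh]; field_simp
    rw [hh2]
    generalize hf1 (n/2) (M / μ ^ 4) = B
    field_simp
    push_cast
    ring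
  have : AntitoneOn (fun μ => hm n μ M) (Ioi 0) := by
    apply antitoneOn_of_deriv_nonpos (convex_Ioi 0)
    · intro μ hμ; exact (hd μ hμ).continuousAt.continuousWithinAt
    · rw [interior_Ioi]; intro μ hμ; exact (hd μ hμ).differentiableAt.differentiableWithinAt
    · rw [interior_Ioi]; intro μ hμ
      have hμ' : 0 < μ := hμ
      rw [(hd μ hμ).deriv]
      have := hf0_key (ahalf n) (x := M / μ ^ 4) (by positivity)
      have : 0 ≤ 4 * (μ ^ (2 * n + 1))⁻¹ * ((n:ℝ)/2 * hf0 (n/2) (M / μ ^ 4) +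
        (M / μ ^ 4) * hf1 (n / 2) (M / μ ^ 4)) := by positivity
      linarith
  exact this hε (hε.trans_le h) h

lemma hm_contDiff (μ : ℝ) : ContDiff ℝ 2 (hm n μ) := by
  unfold hm
  exact contDiff_const.mul ((hf0_contDiff _).comp (contDiff_id.div_const _))

/-- The mean value density. -/
def m1 (ζ : H n) : ℝ := rsq ζ * psi (n / 2) (Nn ζ)

/-- Rescaled mean value density. -/
def mm (μ : ℝ) (ζ : H n) : ℝ := (μ ^ (2 * n + 2))⁻¹ * m1 (dil μ⁻¹ ζ)

lemma psi_nonneg (n : ℕ) (M : ℝ) : 0 ≤ psi (n / 2) M := by unfold psi; positivity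

lemma m1_nonneg (ζ : H n) : 0 ≤ m1 ζ := mul_nonneg (rsq_nonneg _) (psi_nonneg _ _)

lemma mm_nonneg {μ : ℝ} (hμ : 0 < μ) (ζ : H n) : 0 ≤ mm μ ζ :=
  mul_nonneg (by positivity) (m1_nonneg _)

lemma psi_cont (a : ℝ) : Continuous (psi a) := by unfold psi; fun_prop

lemma m1_cont : Continuous (m1 : H n → ℝ) :=
  rsq_cont.mul ((psi_cont _).comp Nn_cont)

lemma m1_support {ζ : H n} (h : 1 ≤ Nn ζ) : m1 ζ = 0 := by
  unfold m1 psi; rw [max_eq_right (by linarith)]; simp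

lemma m1_compact : HasCompactSupport (m1 : H n → ℝ) := by
  refine HasCompactSupport.intro (isCompact_Nn 1) fun ζ hζ => m1_support ?_
  by_contra h
  exact hζ (by show Nn ζ ≤ 1; linarith)

/-- The mean value constant. -/
def cm (n : ℕ) : ℝ := ∫ ζ : H n, m1 ζ

lemma cm_pos (hn : 1 ≤ n) : 0 < cm n := by
  let ζ : H n := (fun i => if i = ⟨0, hn⟩ then 1 / 2 else 0, 0, 0)
  have hs : rsq ζ = 1 / 4 := by
    simp only [rsq, ζ]
    simp [Finset.sum_ite_eq']
    norm_num
  have hN : Nn ζ = 1 / 16 := by simp only [Nn, hs, ζ]; norm_num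
  apply m1_cont.integral_pos_of_hasCompactSupport_nonneg_nonzero m1_compact
    (fun ζ => m1_nonneg ζ) (x := ζ)
  rw [m1, hs, hN, psi, max_eq_left (by norm_num)]
  have : (0:ℝ) < n := by exact_mod_cast hn
  positivity

lemma mm_eq {μ : ℝ} (hμ : 0 < μ) (ζ : H n) :
    mm μ ζ = rsq ζ * ((μ ^ (2 * n + 4))⁻¹ * psi (n / 2) (Nn ζ / μ ^ 4)) := by
  rw [mm, m1, rsq_dil, Nn_dil]
  rw [show (μ⁻¹) ^ 4 * Nn ζ = Nn ζ / μ ^ 4 by field_simp]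
  generalize psi (n/2) (Nn ζ / μ ^ 4) = A
  field_simp; ring

lemma mm_cont (μ : ℝ) : Continuous (mm μ : H n → ℝ) :=
  continuous_const.mul (m1_cont.comp (dil_cont _))

lemma mm_zero {μ : ℝ} (hμ : 0 < μ) {ζ : H n} (h : μ ^ 4 ≤ Nn ζ) : mm μ ζ = 0 := by
  rw [mm, m1_support, mul_zero]
  rw [Nn_dil, inv_pow, inv_mul_eq_div, le_div_iff₀ (by positivity)]; simpa using h

lemma subLap_hm {ε R : ℝ} (hε : 0 < ε) (hR : 0 < R) (ζ : H n) :
    subLap (fun ζ : H n => hm n ε (Nn ζ) - hm n R (Nn ζ)) ζ = mm R ζ - mm ε ζ := by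
  have d : ∀ μ : ℝ, ∀ x, HasDerivAt (hm n μ) ((μ ^ (2 * n))⁻¹ * (hf1 (n/2) (x / μ ^ 4) * (1 / μ ^ 4))) x := by
    intro μ x
    exact ((hf0_deriv (n/2) (x / μ ^ 4)).comp x ((hasDerivAt_id x).div_const _)).const_mul _
  have d1 : ∀ μ : ℝ, ∀ x, HasDerivAt
      (fun x => (μ ^ (2 * n))⁻¹ * (hf1 (n/2) (x / μ ^ 4) * (1 / μ ^ 4)))
      ((μ ^ (2 * n))⁻¹ * (hf2 (n/2) (x / μ ^ 4) * (1 / μ ^ 4) * (1 / μ ^ 4))) x := by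
    intro μ x
    exact (((hf1_deriv (n/2) (x / μ ^ 4)).comp x
      ((hasDerivAt_id x).div_const _)).mul_const _).const_mul _
  have := subLap_gauge (n := n) (h := fun x => hm n ε x - hm n R x)
    (fun x => (d ε x).sub (d R x)) (fun x => (d1 ε x).sub (d1 R x)) ζ
  rw [this, mm_eq hε, mm_eq hR, ← psi_eq, ← psi_eq]
  generalize hf2 (n/2) (Nn ζ / ε ^ 4) = A
  generalize hf2 (n/2) (Nn ζ / R ^ 4) = B
  generalize hf1 (n/2) (Nn ζ / ε ^ 4) = C
  generalize hf1 (n/2) (Nn ζ / R ^ 4) = D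
  have e1 : (ε ^ (2 * n + 4))⁻¹ = (ε ^ (2 * n))⁻¹ * (1 / ε ^ 4) := by rw [pow_add]; field_simp
  have e2 : (R ^ (2 * n + 4))⁻¹ = (R ^ (2 * n))⁻¹ * (1 / R ^ 4) := by rw [pow_add]; field_simp
  rw [e1, e2]
  generalize (ε ^ (2 * n))⁻¹ = E
  generalize (R ^ (2 * n))⁻¹ = F
  field_simp
  ring

/-- The mean value operator. -/
def Im (u : H n → ℝ) (μ : ℝ) (ξ : H n) : ℝ := ∫ η, u (Lt ξ (dil μ η)) * m1 η

lemma Im_eq (u : H n → ℝ) {μ : ℝ} (hμ : 0 < μ) (ξ : H n) :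
    ∫ η, u η * mm μ (Lt (-ξ) η) = Im u μ ξ := by
  rw [← int_Lt ξ (fun η => u η * mm μ (Lt (-ξ) η))]
  simp only [Lt_neg_cancel]
  have := int_dil (n := n) hμ (fun η => u (Lt ξ η) * mm μ η)
  have e : ∀ η : H n, u (Lt ξ (dil μ η)) * mm μ (dil μ η) =
      (μ ^ (2 * n + 2))⁻¹ * (u (Lt ξ (dil μ η)) * m1 η) := by
    intro η; rw [mm, dil_dil, inv_mul_cancel₀ hμ.ne', dil_one]; ring
  simp only [e] at this
  rw [integral_const_mul] at this
  have h0 : (μ ^ (2 * n + 2))⁻¹ ≠ 0 := by positivity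
  exact (mul_left_cancel₀ h0 this).symm

lemma Im_tendsto {u : H n → ℝ} (hu : Continuous u) (ξ : H n) :
    Tendsto (fun k : ℕ => Im u (1 / ((k:ℝ) + 1)) ξ) atTop (𝓝 (cm n * u ξ)) := by
  have hc : Continuous (fun μ : ℝ => ∫ η in {η : H n | Nn η ≤ 1}, u (Lt ξ (dil μ η)) * m1 η) := by
    apply continuous_parametric_integral_of_continuous _ (isCompact_Nn 1)
    have h1 : Continuous (fun p : ℝ × H n => Lt ξ (dil p.1 p.2)) := (Lt_cont ξ).comp dil_cont2
    exact (hu.comp h1).mul (m1_cont.comp continuous_snd)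
  have e : ∀ μ, ∫ η in {η : H n | Nn η ≤ 1}, u (Lt ξ (dil μ η)) * m1 η = Im u μ ξ := by
    intro μ
    apply setIntegral_eq_integral_of_forall_compl_eq_zero
    intro η hη
    rw [m1_support, mul_zero]
    by_contra h
    exact hη (by show Nn η ≤ 1; linarith)
  simp only [e] at hc
  have h0 : Im u 0 ξ = cm n * u ξ := by
    simp only [Im, dil_zero]
    rw [integral_const_mul, cm, mul_comm]
    congr 2
    simp [Lt]
  rw [← h0]
  exact (hc.tendsto 0).comp tendsto_one_div_add_atTop_nhds_zero_nat

lemma Lt_proper (ξ : H n) {f : H n → ℝ} (hf : HasCompactSupport f) :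
    HasCompactSupport (fun η => f (Lt ξ η)) := by
  let e : H n ≃ₜ H n := ⟨⟨Lt ξ, Lt (-ξ), Lt_neg_cancel ξ, Lt_cancel_neg ξ⟩, Lt_cont _, Lt_cont _⟩
  exact hf.comp_homeomorph e

lemma D_compact {ε R : ℝ} (hε : 0 < ε) (h : ε ≤ R) :
    HasCompactSupport (fun ζ : H n => hm n ε (Nn ζ) - hm n R (Nn ζ)) := by
  refine HasCompactSupport.intro (isCompact_Nn (R ^ 4)) fun ζ hζ => ?_
  have h2 : R ^ 4 ≤ Nn ζ := by
    by_contra h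
    exact hζ (by show Nn ζ ≤ _; linarith)
  rw [hm_of_ge (hε.trans_le h) h2, hm_of_ge hε ((pow_le_pow_left₀ hε.le h 4).trans h2), sub_self]

lemma D_contDiff (ε R : ℝ) :
    ContDiff ℝ 2 (fun ζ : H n => hm n ε (Nn ζ) - hm n R (Nn ζ)) :=
  ((hm_contDiff ε).comp Nn_contDiff).sub ((hm_contDiff R).comp Nn_contDiff)

lemma mm_compact {μ : ℝ} (hμ : 0 < μ) : HasCompactSupport (mm μ : H n → ℝ) := by
  refine HasCompactSupport.intro (isCompact_Nn (μ ^ 4)) fun ζ hζ => mm_zero hμ ?_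
  by_contra h
  exact hζ (by show Nn ζ ≤ _; linarith)

lemma mm_int {u : H n → ℝ} (hu : Continuous u) {μ : ℝ} (hμ : 0 < μ) (ξ : H n) :
    Integrable (fun η => u η * mm μ (Lt ξ η)) :=
  (hu.mul ((mm_cont μ).comp (Lt_cont ξ))).integrable_of_hasCompactSupport
    (Lt_proper ξ (mm_compact hμ)).mul_left

lemma D_int {F : H n → ℝ} (hF : Continuous F) {ε R : ℝ} (hε : 0 < ε) (h : ε ≤ R) (ξ : H n) :
    Integrable (fun η => F η * (hm n ε (Nn (Lt ξ η)) - hm n R (Nn (Lt ξ η)))) :=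
  (hF.mul ((D_contDiff ε R).continuous.comp (Lt_cont ξ))).integrable_of_hasCompactSupport
    (Lt_proper ξ (D_compact hε h)).mul_left

lemma mean_formula {u F : H n → ℝ} (hu : Continuous u) (h : VW u F) {ε R : ℝ} (hε : 0 < ε)
    (hR : ε ≤ R) (ξ : H n) :
    Im u ε ξ - Im u R ξ =
      ∫ η, F η * (hm n ε (Nn (Lt (-ξ) η)) - hm n R (Nn (Lt (-ξ) η))) := by
  have hR' : 0 < R := hε.trans_le hR
  have := h (fun η => hm n ε (Nn (Lt (-ξ) η)) - hm n R (Nn (Lt (-ξ) η)))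
    ((D_contDiff ε R).comp (Lt_contDiff (-ξ))) (Lt_proper (-ξ) (D_compact hε hR))
  have e : ∀ η, subLap (fun η : H n => hm n ε (Nn (Lt (-ξ) η)) - hm n R (Nn (Lt (-ξ) η))) η =
      mm R (Lt (-ξ) η) - mm ε (Lt (-ξ) η) := by
    intro η
    rw [subLap_Lt (φ := fun ζ : H n => hm n ε (Nn ζ) - hm n R (Nn ζ)) (D_contDiff ε R),
      subLap_hm hε hR']
  simp only [e, mul_sub (u _)] at this
  rw [integral_sub (mm_int hu hR' _) (mm_int hu hε _), Im_eq u hε, Im_eq u hR'] at this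
  linarith

section sol
variable {u F : H n → ℝ}

lemma Im_nonneg (hu0 : ∀ ξ, 0 ≤ u ξ) (μ : ℝ) (ξ : H n) : 0 ≤ Im u μ ξ :=
  integral_nonneg fun η => mul_nonneg (hu0 _) (m1_nonneg _)

lemma D_nonneg {ε R : ℝ} (hε : 0 < ε) (hR : ε ≤ R) (ζ : H n) :
    0 ≤ hm n ε (Nn ζ) - hm n R (Nn ζ) := sub_nonneg.2 (hm_anti hε hR (Nn_nonneg _))

lemma Im_anti (hu : Continuous u) (hF0 : ∀ ξ, 0 ≤ F ξ) (h : VW u F) {ε R : ℝ}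
    (hε : 0 < ε) (hR : ε ≤ R) (ξ : H n) : Im u R ξ ≤ Im u ε ξ := by
  have := mean_formula hu h hε hR ξ
  have h2 : 0 ≤ ∫ η, F η * (hm n ε (Nn (Lt (-ξ) η)) - hm n R (Nn (Lt (-ξ) η))) :=
    integral_nonneg fun η => mul_nonneg (hF0 _) (D_nonneg hε hR _)
  linarith

lemma Im_le (hu : Continuous u) (hF0 : ∀ ξ, 0 ≤ F ξ) (h : VW u F) {R : ℝ}
    (hR : 0 < R) (ξ : H n) : Im u R ξ ≤ cm n * u ξ := by
  refine ge_of_tendsto (Im_tendsto hu ξ) ?_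
  have := (tendsto_one_div_add_atTop_nhds_zero_nat (𝕜 := ℝ)).eventually (Iio_mem_nhds hR)
  filter_upwards [this] with k hk
  exact Im_anti hu hF0 h (by positivity) (le_of_lt hk) ξ

lemma int_D_le (hu : Continuous u) (hu0 : ∀ ξ, 0 ≤ u ξ) (hF0 : ∀ ξ, 0 ≤ F ξ)
    (h : VW u F) {ε R : ℝ} (hε : 0 < ε) (hR : ε ≤ R) (ξ : H n) :
    ∫ η, F η * (hm n ε (Nn (Lt (-ξ) η)) - hm n R (Nn (Lt (-ξ) η))) ≤ cm n * u ξ := by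
  rw [← mean_formula hu h hε hR]
  have := Im_nonneg hu0 R ξ
  have := Im_le hu hF0 h hε ξ
  linarith

end sol

end Heisenberg

namespace Heisenberg

variable {n : ℕ}

/-! ### Blow-up, vanishing means, representation -/

lemma Lt_zero_left (η : H n) : Lt (-0) η = η := by
  simp [Lt]

lemma blowup (hn : 1 ≤ n) {u F : H n → ℝ} (hu : Continuous u) (hu0 : ∀ ξ, 0 ≤ u ξ)
    (hF : Continuous F) (hF0 : ∀ ξ, 0 ≤ F ξ) (h : VW u F) {s0 c : ℝ} (hc : 0 < c)
    (hb : ∀ η, s0 ≤ rsq η → c ≤ F η) : False := by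
  have hh0 : 0 < hf0 ((n:ℝ)/2) 0 := hf0_pos (ahalf n)
  have hk : (0:ℝ) < (16:ℝ) ^ (-((n:ℝ)/2)) := by positivity
  set κ := (16:ℝ) ^ (-((n:ℝ)/2)) / 2 with hκ
  have hκ0 : 0 < κ := by positivity
  set B : ℝ := max 1 (hf0 ((n:ℝ)/2) 0 / κ) with hB
  have hB1 : 1 ≤ B := le_max_left _ _
  have hB0 : 0 < B := by linarith
  have hB2 : (B ^ (2 * n))⁻¹ * hf0 (n/2) 0 ≤ κ := by
    have h1 : B ≤ B ^ (2 * n) := le_self_pow₀ hB1 (by omega)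
    have h2 : hf0 ((n:ℝ)/2) 0 / κ ≤ B := le_max_right _ _
    rw [div_le_iff₀ hκ0] at h2
    rw [inv_mul_le_iff₀ (by positivity)]
    exact h2.trans (by gcongr)
  let S : Set (H n) := {ζ | 1 < rsq ζ ∧ Nn ζ < 16}
  have hSo : IsOpen S := (isOpen_lt continuous_const rsq_cont).inter (isOpen_lt Nn_cont continuous_const)
  let ζ0 : H n := (fun i => if i = ⟨0, hn⟩ then 3 / 2 else 0, 0, 0)
  have hs : rsq ζ0 = 9 / 4 := by
    simp only [rsq, ζ0]
    simp [Finset.sum_ite_eq']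
    norm_num
  have hN : Nn ζ0 = 81 / 16 := by simp only [Nn, hs, ζ0]; norm_num
  have hSne : S.Nonempty := ⟨ζ0, by show 1 < rsq ζ0; rw [hs]; norm_num, by
    show Nn ζ0 < 16; rw [hN]; norm_num⟩
  have hSf : volume S < ⊤ := (measure_mono (t := {η : H n | Nn η ≤ 16}) (fun ζ hζ => le_of_lt hζ.2)).trans_lt
    (isCompact_Nn 16).measure_lt_top
  have hSp : 0 < volume.real S := by
    rw [Measure.real, ENNReal.toReal_pos_iff]
    exact ⟨hSo.measure_pos _ hSne, hSf⟩
  set V := volume.real S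
  have key : ∀ T : ℝ, 0 < T → s0 ≤ T ^ 2 → T ^ 2 * (c * κ * V) ≤ cm n * u 0 := by
    intro T hT hTs
    have h1 := int_D_le hu hu0 hF0 h hT (R := T * B) (by nlinarith) 0
    simp only [Lt_zero_left] at h1
    have h2 := int_dil (n := n) hT (fun η => F η * (hm n T (Nn η) - hm n (T * B) (Nn η)))
    have e : ∀ η : H n, F (dil T η) * (hm n T (Nn (dil T η)) - hm n (T * B) (Nn (dil T η))) =
       (T ^ (2 * n))⁻¹ * (F (dil T η) * (hm n 1 (Nn η) - hm n B (Nn η))) := by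
      intro η
      rw [Nn_dil, hm_scale hT]
      have := hm_scale (n := n) (T := T) (μ := 1) (x := Nn η) hT
      rw [mul_one] at this
      rw [this]; ring
    simp only [e] at h2
    rw [integral_const_mul] at h2
    have hintg : Integrable (fun η => F (dil T η) * (hm n 1 (Nn η) - hm n B (Nn η))) :=
      ((hF.comp (dil_cont T)).mul (D_contDiff 1 B).continuous).integrable_of_hasCompactSupport
        (D_compact one_pos hB1).mul_left
    have h3 : c * κ * V ≤ ∫ η, F (dil T η) * (hm n 1 (Nn η) - hm n B (Nn η)) := by
      refine le_trans ?_ (setIntegral_le_integral (s := S) hintg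
        (Eventually.of_forall fun η => mul_nonneg (hF0 _) (D_nonneg one_pos hB1 _)))
      refine setIntegral_ge_of_const_le_real hSo.measurableSet hSf.ne ?_ hintg.integrableOn
      intro ζ hζ
      have h1N : 1 ≤ Nn ζ := by
        have := hζ.1
        unfold Nn; nlinarith [sq_nonneg ζ.2.2]
      have a1 : hm n 1 (Nn ζ) = Nn ζ ^ (-((n:ℝ)/2)) := hm_of_ge one_pos (by simpa using h1N)
      have a2 : (16:ℝ) ^ (-((n:ℝ)/2)) ≤ Nn ζ ^ (-((n:ℝ)/2)) :=
        Real.rpow_le_rpow_of_nonpos (by linarith) hζ.2.le (by linarith [ahalf n])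
      have a3 := (hm_le (n := n) hB0 (Nn_nonneg ζ)).trans hB2
      have a4 : c ≤ F (dil T ζ) := by
        apply hb
        rw [rsq_dil]
        have := hζ.1
        nlinarith [sq_nonneg T]
      apply mul_le_mul a4 _ hκ0.le (hc.le.trans a4)
      rw [a1]
      have : (16:ℝ) ^ (-((n:ℝ)/2)) = 2 * κ := by rw [hκ]; ring
      linarith
    have h4 : ∫ η, F η * (hm n T (Nn η) - hm n (T * B) (Nn η)) =
       T ^ 2 * ∫ η, F (dil T η) * (hm n 1 (Nn η) - hm n B (Nn η)) := by
      have h0 : (T ^ (2 * n + 2)) ≠ 0 := by positivity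
      have := congrArg (fun x => T ^ (2 * n + 2) * x) h2
      rw [mul_inv_cancel_left₀ h0] at this
      rw [← this, ← mul_assoc]; congr 1
      rw [pow_add]; field_simp
    rw [h4] at h1
    refine le_trans ?_ h1
    gcongr
  have hP : 0 < c * κ * V := by positivity
  set P := c * κ * V
  set T := max 1 (max s0 ((cm n * u 0 + 1) / P)) with hT
  have hT1 : 1 ≤ T := le_max_left _ _
  have hTT : T ≤ T ^ 2 := le_self_pow₀ hT1 (by norm_num)
  have hk := key T (by linarith) (((le_max_left _ _).trans (le_max_right _ _)).trans hTT)
  have : (cm n * u 0 + 1) / P ≤ T ^ 2 := ((le_max_right _ _).trans (le_max_right _ _)).trans hTT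
  rw [div_le_iff₀ hP] at this
  linarith

lemma rsq_Lt_le (a b : H n) : rsq (Lt a b) ≤ 2 * rsq a + 2 * rsq b := by
  simp only [rsq, Lt, Pi.add_apply, mul_add, Finset.mul_sum, ← Finset.sum_add_distrib]
  apply Finset.sum_le_sum; intro i _
  nlinarith [sq_nonneg (a.1 i - b.1 i), sq_nonneg (a.2.1 i - b.2.1 i)]

lemma Ssum_le (a b : H n) :
    |2 * ∑ i, (a.2.1 i * b.1 i - a.1 i * b.2.1 i)| ≤ rsq a + rsq b := by
  rw [abs_le]
  simp only [rsq, Finset.mul_sum]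
  rw [show ∀ A B C D : ℝ, A + B + (C + D) = (A + B + C + D) by intros; ring,
    ← Finset.sum_add_distrib, ← Finset.sum_add_distrib, ← Finset.sum_add_distrib,
    ← Finset.sum_neg_distrib]
  constructor <;> apply Finset.sum_le_sum <;> intro i _
  · nlinarith [sq_nonneg (a.2.1 i + b.1 i), sq_nonneg (a.1 i - b.2.1 i)]
  · nlinarith [sq_nonneg (a.2.1 i - b.1 i), sq_nonneg (a.1 i + b.2.1 i)]

lemma rho_Lt (a b : H n) : rho (Lt a b) ≤ 3 * (rho a + rho b) := by
  have ha := rho_nonneg a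
  have hb := rho_nonneg b
  rw [rho_le_iff (by positivity)]
  have h1 := rsq_Lt_le a b
  have h2 := Ssum_le a b
  have h3 := rsq_le_rho a
  have h4 := rsq_le_rho b
  have h5 := abs_t_le_rho a
  have h6 := abs_t_le_rho b
  have h7 : |(Lt a b).2.2| ≤ 2 * (rho a + rho b) := by
    show |a.2.2 + b.2.2 + 2 * ∑ i, (a.2.1 i * b.1 i - a.1 i * b.2.1 i)| ≤ _
    refine (abs_add_le _ _).trans ?_
    have := abs_add_le a.2.2 b.2.2
    linarith
  have h8 := rsq_nonneg (Lt a b)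
  have h9 : (Lt a b).2.2 ^ 2 ≤ (2 * (rho a + rho b)) ^ 2 := sq_le_sq' (by linarith [(abs_le.1 h7).1]) (abs_le.1 h7).2
  have h10 : rsq (Lt a b) ^ 2 ≤ (2 * (rho a + rho b)) ^ 2 := by
    apply pow_le_pow_left₀ h8; linarith
  unfold Nn
  nlinarith [sq_nonneg (rho a + rho b)]

lemma rsq_neg (a : H n) : rsq (-a) = rsq a := by simp [rsq]

lemma rho_neg (a : H n) : rho (-a) = rho a := by
  unfold rho Nn; rw [rsq_neg]; simp

lemma cross_rsq (ξ ξ' η : H n) (h : rsq ξ ≤ rsq ξ') :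
    rsq (Lt (-ξ) η) ≤ rsq (Lt (-ξ') η) + rsq (Lt (-(-ξ'.1, -ξ'.2.1, ξ'.2.2)) η) := by
  have h1 := rsq_Lt_le (-ξ) η
  rw [rsq_neg] at h1
  have h2 : rsq (Lt (-ξ') η) + rsq (Lt (-(-ξ'.1, -ξ'.2.1, ξ'.2.2)) η) = 2 * rsq ξ' + 2 * rsq η := by
    simp only [rsq, Lt, Pi.add_apply, mul_add, Finset.mul_sum, Prod.fst_neg, Prod.snd_neg,
      Pi.neg_apply, neg_neg, ← Finset.sum_add_distrib]
    apply Finset.sum_congr rfl; intro i _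
    ring
  linarith

lemma mm_cross {ξ ξ' η : H n} (h : rsq ξ ≤ rsq ξ') {R : ℝ} (hR : 0 < R)
    (hR2 : 9 * rho ξ + 3 * rho ξ' ≤ R ^ 2) :
    mm R (Lt (-ξ) η) ≤ 2 * 4 ^ (2 * n + 4) *
      (mm (4 * R) (Lt (-ξ') η) + mm (4 * R) (Lt (-(-ξ'.1, -ξ'.2.1, ξ'.2.2)) η)) := by
  have hR4 : 0 < 4 * R := by linarith
  by_cases hc : R ^ 4 ≤ Nn (Lt (-ξ) η)
  · rw [mm_zero hR hc]
    have := mm_nonneg hR4 (Lt (-ξ') η)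
    have := mm_nonneg hR4 (Lt (-(-ξ'.1, -ξ'.2.1, ξ'.2.2)) η)
    positivity
  push Not at hc
  have hr : rho (Lt (-ξ) η) ≤ R ^ 2 := by
    rw [rho_le_iff (by positivity)]; nlinarith
  have hη : rho η ≤ 3 * (rho ξ + R ^ 2) := by
    have := rho_Lt ξ (Lt (-ξ) η)
    rw [Lt_cancel_neg] at this
    linarith
  have gen : ∀ ζ : H n, rho ζ = rho ξ' →
      psi (n/2) 0 / 2 ≤ psi (n/2) (Nn (Lt (-ζ) η) / (4 * R) ^ 4) := by
    intro ζ hζ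
    have h1 := rho_Lt (-ζ) η
    rw [rho_neg, hζ] at h1
    have h2 : rho (Lt (-ζ) η) ≤ 10 * R ^ 2 := by linarith
    rw [rho_le_iff (by positivity)] at h2
    have h3 : Nn (Lt (-ζ) η) / (4 * R) ^ 4 ≤ 1 / 2 := by
      rw [div_le_iff₀ (by positivity)]; nlinarith [pow_pos hR 4]
    unfold psi
    have h4 : (1:ℝ)/2 ≤ max (1 - Nn (Lt (-ζ) η) / (4 * R) ^ 4) 0 := le_max_of_le_left (by linarith)
    rw [max_eq_left (by norm_num), mul_div_assoc]
    have := ahalf n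
    gcongr
    linarith
  have g1 := gen ξ' rfl
  have g2 := gen (-ξ'.1, -ξ'.2.1, ξ'.2.2) (by
    simp [rho, Nn, rsq])
  have hp : psi (n/2) (Nn (Lt (-ξ) η) / R ^ 4) ≤ psi (n/2) 0 := by
    unfold psi
    have := ahalf n
    have h0 := Nn_nonneg (Lt (-ξ) η)
    gcongr
    positivity
  rw [mm_eq hR, mm_eq hR4, mm_eq hR4]
  have hx := cross_rsq ξ ξ' η h
  have n1 := rsq_nonneg (Lt (-ξ') η)
  have n2 := rsq_nonneg (Lt (-(-ξ'.1, -ξ'.2.1, ξ'.2.2)) η)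
  have n0 := psi_nonneg n 0
  have nn := psi_nonneg n (Nn (Lt (-ξ) η) / R ^ 4)
  calc rsq (Lt (-ξ) η) * ((R ^ (2 * n + 4))⁻¹ * psi (n/2) (Nn (Lt (-ξ) η) / R ^ 4))
      ≤ (rsq (Lt (-ξ') η) + rsq (Lt (-(-ξ'.1, -ξ'.2.1, ξ'.2.2)) η)) *
        ((R ^ (2 * n + 4))⁻¹ * psi (n/2) 0) := by gcongr
    _ = 2 * 4 ^ (2 * n + 4) * (rsq (Lt (-ξ') η) * (((4 * R) ^ (2 * n + 4))⁻¹ * (psi (n/2) 0 / 2))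
        + rsq (Lt (-(-ξ'.1, -ξ'.2.1, ξ'.2.2)) η) * (((4 * R) ^ (2 * n + 4))⁻¹ * (psi (n/2) 0 / 2))) := by
        rw [mul_pow]
        field_simp
    _ ≤ _ := by gcongr

lemma Im_small (hn : 1 ≤ n) {u F : H n → ℝ} (hu : Continuous u) (hu0 : ∀ ξ, 0 ≤ u ξ)
    (hcyl : IsCylindrical u) (hF0 : ∀ ξ, 0 ≤ F ξ) (h : VW u F)
    (hnb : ∀ s0 c : ℝ, 0 < c → ¬ ∀ η, s0 ≤ rsq η → c ≤ u η) (ξ : H n) {α : ℝ} (hα : 0 < α) :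
    ∃ R, 0 < R ∧ Im u R ξ < α := by
  by_contra hcon
  push Not at hcon
  have hcm := cm_pos hn
  refine hnb (rsq ξ) (α / (2 * (2 * 4 ^ (2 * n + 4) * cm n))) (by positivity) ?_
  intro ξ' hξ'
  set R := 1 + (9 * rho ξ + 3 * rho ξ') with hRd
  have n1 := rho_nonneg ξ
  have n2 := rho_nonneg ξ'
  have hR : 0 < R := by positivity
  have hR2 : 9 * rho ξ + 3 * rho ξ' ≤ R ^ 2 := by nlinarith
  have h1 := hcon R hR
  rw [← Im_eq u hR] at h1
  set ξ'' : H n := (-ξ'.1, -ξ'.2.1, ξ'.2.2) with hx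
  have hR4 : 0 < 4 * R := by linarith
  have e : u ξ'' = u ξ' := hcyl _ _ (by simp [rsq, hx]) rfl
  have h2 : ∫ η, u η * mm R (Lt (-ξ) η) ≤
      ∫ η, 2 * 4 ^ (2 * n + 4) * (u η * mm (4 * R) (Lt (-ξ') η) + u η * mm (4 * R) (Lt (-ξ'') η)) := by
    apply integral_mono (mm_int hu hR _)
    · exact ((mm_int hu hR4 _).add (mm_int hu hR4 _)).const_mul _
    · intro η
      have := mm_cross (η := η) hξ' hR hR2
      have h3 := mul_le_mul_of_nonneg_left this (hu0 η)
      refine h3.trans (le_of_eq ?_)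
      simp only [hx]; ring
  rw [integral_const_mul, integral_add (mm_int hu hR4 _) (mm_int hu hR4 _), Im_eq u hR4, Im_eq u hR4] at h2
  have h3 := Im_le hu hF0 h hR4 ξ'
  have h4 := Im_le hu hF0 h hR4 ξ''
  rw [e] at h4
  rw [div_le_iff₀ (by positivity)]
  calc α ≤ _ := h1
    _ ≤ _ := h2
    _ ≤ 2 * 4 ^ (2 * n + 4) * (cm n * u ξ' + cm n * u ξ') := by gcongr
    _ = _ := by ring

lemma Im_lim (hn : 1 ≤ n) {u F : H n → ℝ} (hu : Continuous u) (hu0 : ∀ ξ, 0 ≤ u ξ)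
    (hcyl : IsCylindrical u) (hF0 : ∀ ξ, 0 ≤ F ξ) (h : VW u F)
    (hnb : ∀ s0 c : ℝ, 0 < c → ¬ ∀ η, s0 ≤ rsq η → c ≤ u η) (ξ : H n) :
    Tendsto (fun k : ℕ => Im u ((k:ℝ) + 1) ξ) atTop (𝓝 0) := by
  rw [Metric.tendsto_atTop]
  intro α hα
  obtain ⟨R, hR, hlt⟩ := Im_small hn hu hu0 hcyl hF0 h hnb ξ hα
  obtain ⟨N, hN⟩ := exists_nat_ge R
  refine ⟨N, fun k hk => ?_⟩
  have h1 : R ≤ (k:ℝ) + 1 := by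
    have : (N:ℝ) ≤ k := by exact_mod_cast hk
    linarith
  have := Im_anti hu hF0 h hR h1 ξ
  rw [Real.dist_eq, sub_zero, abs_of_nonneg (Im_nonneg hu0 _ _)]
  linarith

/-- The fundamental solution kernel. -/
def Gam (ξ η : H n) : ENNReal := ENNReal.ofReal (Nn (Lt (-ξ) η) ^ (-((n:ℝ)/2)))

lemma Gam_meas (ξ : H n) : Measurable (Gam ξ) := by
  unfold Gam
  exact ENNReal.measurable_ofReal.comp ((Nn_cont.comp (Lt_cont _)).measurable.pow_const _)

lemma ae_Lt_ne (ξ : H n) : ∀ᵐ η : H n, Lt (-ξ) η ≠ 0 :=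
  (Lt_mp (-ξ)).quasiMeasurePreserving.ae ae_ne_zero

lemma rep (hn : 1 ≤ n) {u F : H n → ℝ} (hu : Continuous u) (hu0 : ∀ ξ, 0 ≤ u ξ)
    (hcyl : IsCylindrical u) (hF : Continuous F) (hF0 : ∀ ξ, 0 ≤ F ξ) (h : VW u F)
    (hnb : ∀ s0 c : ℝ, 0 < c → ¬ ∀ η, s0 ≤ rsq η → c ≤ u η) (ξ : H n) :
    ENNReal.ofReal (cm n * u ξ) = ∫⁻ η, Gam ξ η * ENNReal.ofReal (F η) := by
  have hε : ∀ k : ℕ, (0:ℝ) < 1 / ((k:ℝ) + 1) := fun k => by positivity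
  have hεR : ∀ k : ℕ, (1:ℝ) / ((k:ℝ) + 1) ≤ (k:ℝ) + 1 := fun k => by
    rw [div_le_iff₀ (by positivity)]
    have : (0:ℝ) ≤ k := by positivity
    nlinarith
  set D : ℕ → H n → ℝ := fun k η =>
    hm n (1 / ((k:ℝ) + 1)) (Nn (Lt (-ξ) η)) - hm n ((k:ℝ) + 1) (Nn (Lt (-ξ) η)) with hD
  have hD0 : ∀ k η, 0 ≤ D k η := fun k η => D_nonneg (hε k) (hεR k) _
  have l1 : Tendsto (fun k : ℕ => ∫⁻ η, ENNReal.ofReal (D k η) * ENNReal.ofReal (F η)) atTop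
      (𝓝 (∫⁻ η, Gam ξ η * ENNReal.ofReal (F η))) := by
    apply lintegral_tendsto_of_tendsto_of_monotone
    · intro k
      apply Measurable.aemeasurable
      exact (ENNReal.measurable_ofReal.comp
        ((D_contDiff _ _).continuous.comp (Lt_cont _)).measurable).mul
        (ENNReal.measurable_ofReal.comp hF.measurable)
    · refine Eventually.of_forall fun η k l hkl => ?_
      have hkl' : (k:ℝ) ≤ l := by exact_mod_cast hkl
      have a1 := hm_anti (n := n) (hε l) (R := 1 / ((k:ℝ) + 1)) (by gcongr) (Nn_nonneg (Lt (-ξ) η))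
      have a2 := hm_anti (n := n) (ε := (k:ℝ) + 1) (R := (l:ℝ) + 1) (by positivity) (by gcongr)
        (Nn_nonneg (Lt (-ξ) η))
      have : D k η ≤ D l η := by simp only [hD]; linarith
      simp only
      gcongr
    · filter_upwards [ae_Lt_ne ξ] with η hη
      have hN : 0 < Nn (Lt (-ξ) η) :=
        lt_of_le_of_ne (Nn_nonneg _) fun h => hη (Nn_eq_zero h.symm)
      apply ENNReal.Tendsto.mul_const _ (Or.inr ENNReal.ofReal_ne_top)
      apply ENNReal.tendsto_ofReal
      have t1 : Tendsto (fun k : ℕ => hm n (1 / ((k:ℝ) + 1)) (Nn (Lt (-ξ) η))) atTop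
          (𝓝 (Nn (Lt (-ξ) η) ^ (-((n:ℝ)/2)))) := by
        apply tendsto_const_nhds.congr'
        have t := (tendsto_one_div_add_atTop_nhds_zero_nat (𝕜 := ℝ)).pow 4
        rw [zero_pow (by norm_num)] at t
        filter_upwards [t.eventually (Iio_mem_nhds hN)] with k hk
        exact (hm_of_ge (hε k) (le_of_lt hk)).symm
      have t2 : Tendsto (fun k : ℕ => hm n ((k:ℝ) + 1) (Nn (Lt (-ξ) η))) atTop (𝓝 0) := by
        have t := (((tendsto_one_div_add_atTop_nhds_zero_nat (𝕜 := ℝ)).pow (2 * n))).mul_const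
          (hf0 ((n:ℝ)/2) 0)
        rw [zero_pow (by omega), zero_mul] at t
        refine squeeze_zero (fun k => (hm_pos (by positivity)).le) (fun k => ?_) t
        have := hm_le (n := n) (μ := (k:ℝ) + 1) (by positivity) (Nn_nonneg (Lt (-ξ) η))
        rwa [one_div, inv_pow]
      have t3 := t1.sub t2
      rw [sub_zero] at t3
      exact t3
  have l2 : Tendsto (fun k : ℕ => ENNReal.ofReal
      (Im u (1 / ((k:ℝ) + 1)) ξ - Im u ((k:ℝ) + 1) ξ)) atTop (𝓝 (ENNReal.ofReal (cm n * u ξ))) := by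
    apply ENNReal.tendsto_ofReal
    simpa using (Im_tendsto hu ξ).sub (Im_lim hn hu hu0 hcyl hF0 h hnb ξ)
  refine tendsto_nhds_unique l2 (l1.congr fun k => ?_)
  rw [mean_formula hu h (hε k) (hεR k), ofReal_integral_eq_lintegral_ofReal
    (D_int hF (hε k) (hεR k) _) (Eventually.of_forall fun η => mul_nonneg (hF0 _) (hD0 k η))]
  apply lintegral_congr
  intro η
  rw [mul_comm, ENNReal.ofReal_mul (hF0 η)]

end Heisenberg

namespace Heisenberg

variable {n : ℕ}

/-! ### The averaged kernel -/

/-- The circular average. -/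
def GG (a x : ℝ) : ℝ := ∫ θ in (-π)..π, (1 + x ^ 2 - 2 * x * cos θ) ^ (-a)

lemma DD_ge (x θ : ℝ) (hx : |x| ≤ 1) : (1 - |x|) ^ 2 ≤ 1 + x ^ 2 - 2 * x * cos θ := by
  have h1 : x * cos θ ≤ |x| := by
    calc x * cos θ ≤ |x * cos θ| := le_abs_self _
      _ = |x| * |cos θ| := abs_mul _ _
      _ ≤ |x| * 1 := by gcongr; exact abs_cos_le_one θ
      _ = |x| := mul_one _
  nlinarith [sq_abs x]

lemma DD_pos (x θ : ℝ) (hx : |x| < 1) : 0 < 1 + x ^ 2 - 2 * x * cos θ :=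
  lt_of_lt_of_le (pow_pos (by linarith) 2) (DD_ge x θ hx.le)

lemma DD_rpow_cont (x b : ℝ) (hx : |x| < 1) :
    Continuous (fun θ => (1 + x ^ 2 - 2 * x * cos θ) ^ b) := by
  apply Continuous.rpow_const (by fun_prop)
  intro θ; exact Or.inl (DD_pos x θ hx).ne'

lemma GG_deriv {a : ℝ} (ha : 0 ≤ a) {x : ℝ} (hx : |x| < 1) :
    HasDerivAt (GG a) (∫ θ in (-π)..π,
      2 * a * ((cos θ - x) * (1 + x ^ 2 - 2 * x * cos θ) ^ (-a - 1))) x := by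
  set s : Set ℝ := {y | |y| < (1 + |x|) / 2} with hs
  have hso : IsOpen s := isOpen_lt continuous_abs continuous_const
  have hxs : x ∈ s := by show |x| < _; linarith
  have hs1 : ∀ y ∈ s, |y| < 1 := fun y hy => by
    have : |y| < (1 + |x|) / 2 := hy
    linarith
  refine (intervalIntegral.hasDerivAt_integral_of_dominated_loc_of_deriv_le
    (F := fun y θ => (1 + y ^ 2 - 2 * y * cos θ) ^ (-a))
    (F' := fun y θ => 2 * a * ((cos θ - y) * (1 + y ^ 2 - 2 * y * cos θ) ^ (-a - 1)))
    (bound := fun _ => 2 * a * (2 * (((1 - |x|) / 2) ^ 2) ^ (-a - 1)))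
    (hso.mem_nhds hxs) ?_ ?_ ?_ ?_ ?_ ?_).2
  · filter_upwards [hso.mem_nhds hxs] with y hy
    exact (DD_rpow_cont y _ (hs1 y hy)).aestronglyMeasurable
  · exact (DD_rpow_cont x _ hx).intervalIntegrable _ _
  · have := DD_rpow_cont x (-a - 1) hx
    exact (Continuous.aestronglyMeasurable (by fun_prop))
  · refine Eventually.of_forall fun θ _ y hy => ?_
    have hy1 := hs1 y hy
    have hy' : |y| < (1 + |x|) / 2 := hy
    have hp := DD_pos y θ hy1
    have h1 : (1 + y ^ 2 - 2 * y * cos θ) ^ (-a - 1) ≤ (((1 - |x|) / 2) ^ 2) ^ (-a - 1) := by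
      apply Real.rpow_le_rpow_of_nonpos (pow_pos (by linarith) 2)
      · refine le_trans ?_ (DD_ge y θ hy1.le)
        apply pow_le_pow_left₀ <;> linarith
      · linarith
    have h2 : |cos θ - y| ≤ 2 := by
      have := abs_sub (cos θ) y
      have := abs_cos_le_one θ
      linarith
    have hp2 : 0 ≤ (1 + y ^ 2 - 2 * y * cos θ) ^ (-a - 1) := Real.rpow_nonneg hp.le _
    rw [Real.norm_eq_abs, abs_mul, abs_mul (cos θ - y), abs_of_nonneg hp2, abs_of_nonneg (by positivity : 0 ≤ 2 * a)]
    gcongr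
  · simp
  · refine Eventually.of_forall fun θ _ y hy => ?_
    have hp := DD_pos y θ (hs1 y hy)
    have d : HasDerivAt (fun y : ℝ => 1 + y ^ 2 - 2 * y * cos θ) (2 * y - 2 * cos θ) y := by
      have d1 : HasDerivAt (fun y : ℝ => y ^ 2) (2 * y) y := by simpa using hasDerivAt_pow 2 y
      have d2 : HasDerivAt (fun y : ℝ => 2 * y * cos θ) (2 * cos θ) y := by
        simpa using ((hasDerivAt_id y).const_mul 2).mul_const (cos θ)
      exact (d1.const_add 1).sub d2
    refine (d.rpow_const (p := -a) (Or.inl hp.ne')).congr_deriv ?_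
    ring

lemma int_zero {x : ℝ} (hx0 : 0 < x) (hx : x < 1) :
    ∫ θ in (-π)..π, (cos θ - x) / (1 + x ^ 2 - 2 * x * cos θ) = 0 := by
  have habs : |x| < 1 := by rwa [abs_of_pos hx0]
  have hne : ∀ θ : ℝ, 0 < 1 - x * cos θ := fun θ => by
    nlinarith [Real.cos_le_one θ]
  have hd : ∀ θ ∈ uIcc (-π) π, HasDerivAt (fun θ => x⁻¹ * arctan (x * sin θ / (1 - x * cos θ)))
      ((cos θ - x) / (1 + x ^ 2 - 2 * x * cos θ)) θ := by
    intro θ _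
    have d1 : HasDerivAt (fun θ => x * sin θ) (x * cos θ) θ := (hasDerivAt_sin θ).const_mul x
    have d2 : HasDerivAt (fun θ => 1 - x * cos θ) (-(x * (-sin θ))) θ :=
      ((hasDerivAt_cos θ).const_mul x).const_sub 1
    have d3 := ((d1.div d2 (hne θ).ne').arctan).const_mul x⁻¹
    refine d3.congr_deriv ?_
    have hp := DD_pos x θ habs
    have h1 := (hne θ).ne'
    have e : 1 + (x * sin θ / (1 - x * cos θ)) ^ 2 = (1 + x ^ 2 - 2 * x * cos θ) / (1 - x * cos θ) ^ 2 := by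
      rw [div_pow, eq_div_iff (by positivity)]
      field_simp
      nlinarith [sin_sq_add_cos_sq θ]
    simp only [Pi.div_apply]
    rw [e]
    have hp' := hp.ne'
    have hx' := hx0.ne'
    field_simp
    have := sin_sq_add_cos_sq θ
    rw [sin_sq]; ring
  have hc : Continuous (fun θ => (cos θ - x) / (1 + x ^ 2 - 2 * x * cos θ)) := by
    apply Continuous.div (by fun_prop) (by fun_prop)
    intro θ; exact (DD_pos x θ habs).ne'
  rw [intervalIntegral.integral_eq_sub_of_hasDerivAt hd (hc.intervalIntegrable _ _)]
  simp

lemma GG_mono {a : ℝ} (ha : 0 ≤ a) : MonotoneOn (GG a) (Ico 0 1) := by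
  have hab : ∀ x ∈ Ico (0:ℝ) 1, |x| < 1 := fun x hx => by rw [abs_of_nonneg hx.1]; exact hx.2
  apply monotoneOn_of_deriv_nonneg (convex_Ico 0 1)
  · intro x hx; exact (GG_deriv ha (hab x hx)).continuousAt.continuousWithinAt
  · rw [interior_Ico]; intro x hx
    exact (GG_deriv ha (hab x ⟨hx.1.le, hx.2⟩)).differentiableAt.differentiableWithinAt
  · rw [interior_Ico]; intro x hx
    have hx1 := hab x ⟨hx.1.le, hx.2⟩
    rw [(GG_deriv ha hx1).deriv]
    rw [intervalIntegral.integral_const_mul]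
    refine mul_nonneg (by positivity) ?_
    have h0 : ∫ θ in (-π)..π, (1 - x ^ 2) ^ (-a) * ((cos θ - x) / (1 + x ^ 2 - 2 * x * cos θ)) = 0 := by
      rw [intervalIntegral.integral_const_mul, int_zero hx.1 hx.2, mul_zero]
    rw [← h0]
    have hq : 0 < 1 - x ^ 2 := by nlinarith [hx.1, hx.2]
    apply intervalIntegral.integral_mono_on (by linarith [pi_pos])
    · apply Continuous.intervalIntegrable
      apply continuous_const.mul
      apply Continuous.div (by fun_prop) (by fun_prop)
      intro θ; exact (DD_pos x θ hx1).ne'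
    · have := DD_rpow_cont x (-a - 1) hx1
      exact Continuous.intervalIntegrable (by fun_prop) _ _
    · intro θ _
      have hp := DD_pos x θ hx1
      rw [Real.rpow_sub hp, Real.rpow_one]
      rw [show (1 - x ^ 2) ^ (-a) * ((cos θ - x) / (1 + x ^ 2 - 2 * x * cos θ)) =
        ((cos θ - x) * (1 - x ^ 2) ^ (-a)) / (1 + x ^ 2 - 2 * x * cos θ) by ring, ← mul_div_assoc]
      apply div_le_div_of_nonneg_right _ hp.le
      rcases le_total x (cos θ) with h | h
      · apply mul_le_mul_of_nonneg_left _ (by linarith)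
        apply Real.rpow_le_rpow_of_nonpos hp _ (by linarith)
        nlinarith [hx.1]
      · apply mul_le_mul_of_nonpos_left _ (by linarith)
        apply Real.rpow_le_rpow_of_nonpos hq _ (by linarith)
        nlinarith [hx.1]

lemma GG_zero (a : ℝ) : GG a 0 = 2 * π := by
  simp [GG]; ring

lemma GG_nonneg {a x : ℝ} (hx : |x| ≤ 1) : 0 ≤ GG a x := by
  apply intervalIntegral.integral_nonneg (by linarith [pi_pos])
  intro θ _
  exact Real.rpow_nonneg ((sq_nonneg _).trans (DD_ge x θ hx)) _

lemma GG_meas (a : ℝ) : Measurable (GG a) := by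
  have : ∀ x, GG a x = ∫ θ in Ioc (-π) π, (1 + x ^ 2 - 2 * x * cos θ) ^ (-a) := fun x =>
    intervalIntegral.integral_of_le (by linarith [pi_pos])
  have e : GG a = fun x => ∫ θ in Ioc (-π) π, (1 + x ^ 2 - 2 * x * cos θ) ^ (-a) := funext this
  rw [e]
  apply StronglyMeasurable.measurable
  apply StronglyMeasurable.integral_prod_right (f := fun x θ => (1 + x ^ 2 - 2 * x * cos θ) ^ (-a))
  apply Measurable.stronglyMeasurable
  apply Measurable.pow_const
  apply Continuous.measurable
  fun_prop

/-- The averaged kernel as a function of the two invariants. -/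
def kap (n : ℕ) (A B : ℝ) : ℝ := A ^ (-((n:ℝ)/2)) * GG (n/2) (2 * √(B / A))

lemma kap_arg {A B : ℝ} (hB : 0 ≤ B) (h : 4 * B < A) : 2 * √(B / A) ∈ Ico (0:ℝ) 1 := by
  have hA : 0 < A := by linarith
  refine ⟨by positivity, ?_⟩
  have : √(B / A) < 1 / 2 := by
    rw [Real.sqrt_lt' (by norm_num), div_lt_iff₀ hA]; linarith
  linarith

lemma kap_anti {A A' B : ℝ} (hB : 0 ≤ B) (h : 4 * B < A) (hA : A ≤ A') :
    kap n A' B ≤ (A / A') ^ ((n:ℝ)/2) * kap n A B := by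
  have hA0 : 0 < A := by linarith
  have hA0' : 0 < A' := by linarith
  have h1 : GG (n/2) (2 * √(B / A')) ≤ GG (n/2) (2 * √(B / A)) := by
    apply GG_mono (ahalf n) (kap_arg hB (by linarith)) (kap_arg hB h)
    gcongr
  unfold kap
  rw [Real.div_rpow hA0.le hA0'.le, Real.rpow_neg hA0.le, Real.rpow_neg hA0'.le]
  have e : A ^ ((n:ℝ)/2) / A' ^ ((n:ℝ)/2) * ((A ^ ((n:ℝ)/2))⁻¹ * GG (n/2) (2 * √(B / A))) =
    (A' ^ ((n:ℝ)/2))⁻¹ * GG (n/2) (2 * √(B / A)) := by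
    have : A ^ ((n:ℝ)/2) ≠ 0 := by positivity
    field_simp
  rw [e]
  gcongr

lemma kap_nonneg {A B : ℝ} (hB : 0 ≤ B) (h : 4 * B < A) : 0 ≤ kap n A B := by
  have h1 := kap_arg hB h
  have hA0 : 0 < A := by linarith
  exact mul_nonneg (by positivity) (GG_nonneg (by rw [abs_of_nonneg h1.1]; exact h1.2.le))

lemma kap_anti' {A A' B : ℝ} (hB : 0 ≤ B) (h : 4 * B < A) (hA : A ≤ A') :
    kap n A' B ≤ kap n A B := by
  have hA0 : 0 < A := by linarith
  refine (kap_anti hB h hA).trans ?_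
  refine mul_le_of_le_one_left (kap_nonneg hB h) ?_
  apply Real.rpow_le_one (div_nonneg hA0.le (hA0.le.trans hA)) _ (ahalf n)
  rw [div_le_one (by linarith)]; exact hA

lemma kap_ge {A B : ℝ} (hB : 0 ≤ B) (h : 4 * B < A) :
    2 * π * A ^ (-((n:ℝ)/2)) ≤ kap n A B := by
  have hA0 : 0 < A := by linarith
  have h1 := GG_mono (ahalf n) ⟨le_rfl, one_pos⟩ (kap_arg hB h) (kap_arg hB h).1
  rw [GG_zero] at h1
  unfold kap
  rw [mul_comm]
  gcongr

lemma kap_scale {A B r : ℝ} (hA : 0 < A) (hr : 0 < r) :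
    r ^ n * kap n (r ^ 2 * A) (r ^ 2 * B) = kap n A B := by
  unfold kap
  rw [mul_div_mul_left _ _ (by positivity : r ^ 2 ≠ 0), Real.mul_rpow (by positivity) hA.le]
  have : r ^ n * (r ^ 2) ^ (-((n:ℝ)/2)) = 1 := by
    rw [Real.rpow_neg (by positivity), ← Real.rpow_natCast r 2, ← Real.rpow_mul hr.le,
      show ((2:ℕ):ℝ) * ((n:ℝ)/2) = n by push_cast; ring, Real.rpow_natCast]
    exact mul_inv_cancel₀ (by positivity)
  rw [← mul_assoc, ← mul_assoc, this, one_mul]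

/-- First invariant. -/
def al (ξ η : H n) : ℝ := (rsq ξ + rsq η) ^ 2 + (ξ.2.2 - η.2.2) ^ 2

/-- Real part. -/
def PP (ξ η : H n) : ℝ := ∑ i, (ξ.1 i * η.1 i + ξ.2.1 i * η.2.1 i)

/-- Imaginary part. -/
def SS (ξ η : H n) : ℝ := ∑ i, (ξ.2.1 i * η.1 i - ξ.1 i * η.2.1 i)

/-- Second invariant. -/
def be (ξ η : H n) : ℝ := PP ξ η ^ 2 + SS ξ η ^ 2

/-- The averaged kernel. -/
def Kb (ξ η : H n) : ENNReal := ENNReal.ofReal (kap n (al ξ η) (be ξ η))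

lemma be_nonneg (ξ η : H n) : 0 ≤ be ξ η := by unfold be; positivity

lemma al_cont : Continuous (fun p : H n × H n => al p.1 p.2) := by
  have := rsq_cont (n := n)
  unfold al; fun_prop

lemma be_cont : Continuous (fun p : H n × H n => be p.1 p.2) := by
  unfold be PP SS; fun_prop

lemma kap_meas {X : Type*} [MeasurableSpace X] {f g : X → ℝ} (hf : Measurable f)
    (hg : Measurable g) : Measurable (fun x => kap n (f x) (g x)) := by
  unfold kap
  refine (hf.pow_const _).mul ((GG_meas _).comp ?_)
  exact (Real.continuous_sqrt.measurable.comp (hg.div hf)).const_mul _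

lemma al_meas (ξ : H n) : Measurable (al ξ) :=
  (al_cont.comp (by fun_prop : Continuous (fun η : H n => (ξ, η)))).measurable

lemma be_meas (ξ : H n) : Measurable (be ξ) :=
  (be_cont.comp (by fun_prop : Continuous (fun η : H n => (ξ, η)))).measurable

lemma Kb_meas (ξ : H n) : Measurable (Kb ξ) :=
  ENNReal.measurable_ofReal.comp (kap_meas (al_meas ξ) (be_meas ξ))

lemma four_be_le (ξ η : H n) : 4 * be ξ η ≤ (rsq ξ + rsq η) ^ 2 := by
  have hs := add_nonneg (rsq_nonneg ξ) (rsq_nonneg η)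
  have key : ∀ c d : ℝ, c ^ 2 + d ^ 2 = 1 → 2 * (c * PP ξ η + d * SS ξ η) ≤ rsq ξ + rsq η := by
    intro c d h
    simp only [PP, SS, rsq, Finset.mul_sum, ← Finset.sum_add_distrib]
    apply Finset.sum_le_sum
    intro i _
    have e : (η.1 i - c * ξ.1 i - d * ξ.2.1 i) ^ 2 + (η.2.1 i - c * ξ.2.1 i + d * ξ.1 i) ^ 2 =
      η.1 i ^ 2 + η.2.1 i ^ 2 + (c ^ 2 + d ^ 2) * (ξ.1 i ^ 2 + ξ.2.1 i ^ 2) -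
      2 * (c * (ξ.1 i * η.1 i + ξ.2.1 i * η.2.1 i) + d * (ξ.2.1 i * η.1 i - ξ.1 i * η.2.1 i)) := by ring
    rw [h] at e
    nlinarith [sq_nonneg (η.1 i - c * ξ.1 i - d * ξ.2.1 i), sq_nonneg (η.2.1 i - c * ξ.2.1 i + d * ξ.1 i)]
  set r := √(be ξ η) with hr
  have hr2 : r ^ 2 = be ξ η := Real.sq_sqrt (be_nonneg _ _)
  rcases (Real.sqrt_nonneg (be ξ η)).eq_or_lt with h0 | h0
  · rw [← hr2, hr, ← h0]; simp; positivity
  · have h1 := key (PP ξ η / r) (SS ξ η / r) (by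
      rw [div_pow, div_pow, ← add_div, hr2, be]
      apply div_self
      have : be ξ η ≠ 0 := by rw [← hr2]; exact (pow_pos h0 2).ne'
      exact this)
    have h2 : PP ξ η / r * PP ξ η + SS ξ η / r * SS ξ η = r := by
      rw [div_mul_eq_mul_div, div_mul_eq_mul_div, ← add_div, div_eq_iff h0.ne', ← pow_two, ← pow_two,
        ← pow_two, hr2, be]
    rw [h2] at h1
    rw [← hr2]
    have : 0 < r := h0
    nlinarith

lemma lt_al {ξ η : H n} (h : ξ.2.2 ≠ η.2.2) : 4 * be ξ η < al ξ η := by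
  have := four_be_le ξ η
  have h2 : 0 < (ξ.2.2 - η.2.2) ^ 2 := by
    have : ξ.2.2 - η.2.2 ≠ 0 := sub_ne_zero.2 h
    positivity
  unfold al; linarith

lemma ae_t (ξ : H n) : ∀ᵐ η : H n, ξ.2.2 ≠ η.2.2 := by
  have := t_null (n := n) ξ.2.2
  rw [ae_iff]
  convert this using 2
  ext η; simp [eq_comm]

lemma Nn_Lt_neg (ξ η : H n) : Nn (Lt (-ξ) η) = al ξ η + 4 * be ξ η -
    4 * ((rsq ξ + rsq η) * PP ξ η + (η.2.2 - ξ.2.2) * SS ξ η) := by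
  have h1 : rsq (Lt (-ξ) η) = rsq ξ + rsq η - 2 * PP ξ η := by
    simp only [rsq, Lt, PP, Finset.mul_sum, ← Finset.sum_add_distrib, ← Finset.sum_sub_distrib]
    apply Finset.sum_congr rfl; intro i _
    simp; ring
  have h2 : (Lt (-ξ) η).2.2 = η.2.2 - ξ.2.2 - 2 * SS ξ η := by
    have : ∑ i, ((-ξ).2.1 i * η.1 i - (-ξ).1 i * η.2.1 i) = - SS ξ η := by
      simp only [SS, ← Finset.sum_neg_distrib]
      apply Finset.sum_congr rfl; intro i _
      simp; ring
    show -ξ.2.2 + η.2.2 + 2 * ∑ i, ((-ξ).2.1 i * η.1 i - (-ξ).1 i * η.2.1 i) = _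
    rw [this]; ring
  rw [Nn, h1, h2, al, be]; ring

lemma PP_rot (ξ η : H n) (θ : ℝ) : PP ξ (rot θ η) = cos θ * PP ξ η + sin θ * SS ξ η := by
  simp only [PP, SS, rot_def, Finset.mul_sum, ← Finset.sum_add_distrib]
  apply Finset.sum_congr rfl; intro i _
  simp; ring

lemma SS_rot (ξ η : H n) (θ : ℝ) : SS ξ (rot θ η) = cos θ * SS ξ η - sin θ * PP ξ η := by
  simp only [PP, SS, rot_def, Finset.mul_sum, ← Finset.sum_sub_distrib]
  apply Finset.sum_congr rfl; intro i _
  simp; ring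

lemma exists_phase (X Y r : ℝ) (hr : 0 ≤ r) (h : X ^ 2 + Y ^ 2 = r ^ 2) :
    ∃ φ, X = r * cos φ ∧ Y = r * sin φ := by
  refine ⟨Complex.arg ⟨X, Y⟩, ?_, ?_⟩
  all_goals
    have hn : ‖(⟨X, Y⟩ : ℂ)‖ = r := by
      rw [Complex.norm_eq_sqrt_sq_add_sq]; simp only; rw [h, Real.sqrt_sq hr]
    rw [← hn]
  · exact (Complex.norm_mul_cos_arg ⟨X, Y⟩).symm
  · exact (Complex.norm_mul_sin_arg ⟨X, Y⟩).symm

lemma Nn_rot_avg (ξ η : H n) : ∃ φ, ∀ θ, Nn (Lt (-ξ) (rot θ η)) =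
    al ξ η + 4 * be ξ η - 4 * √(al ξ η * be ξ η) * cos (θ - φ) := by
  have hal : 0 ≤ al ξ η := by unfold al; positivity
  obtain ⟨φ, h1, h2⟩ := exists_phase
    ((rsq ξ + rsq η) * PP ξ η + (η.2.2 - ξ.2.2) * SS ξ η)
    ((rsq ξ + rsq η) * SS ξ η - (η.2.2 - ξ.2.2) * PP ξ η) (√(al ξ η * be ξ η)) (Real.sqrt_nonneg _)
    (by rw [Real.sq_sqrt (mul_nonneg hal (be_nonneg _ _)), al, be]; ring)
  refine ⟨φ, fun θ => ?_⟩
  have hbe : be ξ (rot θ η) = be ξ η := by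
    rw [be, PP_rot, SS_rot, be]
    have := sin_sq_add_cos_sq θ
    linear_combination (PP ξ η ^ 2 + SS ξ η ^ 2) * this
  have hal2 : al ξ (rot θ η) = al ξ η := by rw [al, rsq_rot, rot_t, al]
  rw [Nn_Lt_neg, hbe, hal2, PP_rot, SS_rot, rsq_rot, rot_t, cos_sub]
  linear_combination (-4 * cos θ) * h1 + (-4 * sin θ) * h2

lemma avg_Gam {ξ η : H n} (h : 4 * be ξ η < al ξ η) :
    ∫⁻ θ in Ioc (-π) π, Gam ξ (rot θ η) = Kb ξ η := by
  obtain ⟨φ, hφ⟩ := Nn_rot_avg ξ η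
  have hb := be_nonneg ξ η
  have hA : 0 < al ξ η := by linarith
  set A := al ξ η
  set B := be ξ η
  set x := 2 * √(B / A) with hx
  have hxm := kap_arg hb h
  have hx1 : |x| < 1 := by rw [abs_of_nonneg hxm.1]; exact hxm.2
  have e : ∀ θ, A + 4 * B - 4 * √(A * B) * cos (θ - φ) =
      A * (1 + x ^ 2 - 2 * x * cos (θ - φ)) := by
    intro θ
    have e1 : A * x ^ 2 = 4 * B := by
      rw [hx, mul_pow, Real.sq_sqrt (by positivity)]; field_simp; ring
    have e2 : A * √(B / A) = √(A * B) := by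
      rw [Real.sqrt_div' _ hA.le, Real.sqrt_mul hA.le, ← mul_div_assoc, div_eq_iff (Real.sqrt_pos.2 hA).ne']
      linear_combination (-√B) * Real.mul_self_sqrt hA.le
    rw [← e2, ← e1, hx]; ring
  have hG : ∀ θ, Gam ξ (rot θ η) = ENNReal.ofReal (A ^ (-((n:ℝ)/2)) *
      (1 + x ^ 2 - 2 * x * cos (θ - φ)) ^ (-((n:ℝ)/2))) := by
    intro θ
    rw [Gam, hφ, e, Real.mul_rpow hA.le (DD_pos x _ hx1).le]
  simp only [hG]
  have hc : Continuous (fun θ => A ^ (-((n:ℝ)/2)) * (1 + x ^ 2 - 2 * x * cos (θ - φ)) ^ (-((n:ℝ)/2))) :=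
    continuous_const.mul ((DD_rpow_cont x _ hx1).comp (by fun_prop : Continuous (fun θ : ℝ => θ - φ)))
  rw [← ofReal_integral_eq_lintegral_ofReal]
  · rw [Kb, kap]
    congr 1
    rw [integral_const_mul, ← intervalIntegral.integral_of_le (by linarith [pi_pos])]
    congr 1
    rw [intervalIntegral.integral_comp_sub_right (fun θ => (1 + x ^ 2 - 2 * x * cos θ) ^ (-((n:ℝ)/2)))]
    have hper : Function.Periodic (fun θ => (1 + x ^ 2 - 2 * x * cos θ) ^ (-((n:ℝ)/2))) (2 * π) := by
      intro θ; simp only [cos_add_two_pi]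
    have := hper.intervalIntegral_add_eq (-π - φ) (-π)
    rw [show -π - φ + 2 * π = π - φ by ring, show -π + 2 * π = π by ring] at this
    rw [this, GG]
  · exact (hc.integrableOn_Icc (a := -π) (b := π)).mono_set Ioc_subset_Icc_self
  · refine Eventually.of_forall fun θ => ?_
    have := DD_pos x (θ - φ) hx1
    simp only [Pi.zero_apply]
    positivity

lemma avg {f : H n → ENNReal} (hf : Measurable f) (hrot : ∀ θ η, f (rot θ η) = f η) (ξ : H n) :
    ∫⁻ η, Kb ξ η * f η = ENNReal.ofReal (2 * π) * ∫⁻ η, Gam ξ η * f η := by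
  have h1 : ∫⁻ _ in Ioc (-π) π, (∫⁻ η, Gam ξ η * f η) = ENNReal.ofReal (2 * π) * ∫⁻ η, Gam ξ η * f η := by
    rw [setLIntegral_const, Real.volume_Ioc, mul_comm]; congr 2; ring
  rw [← h1]
  have h2 : ∀ θ, ∫⁻ η, Gam ξ η * f η = ∫⁻ η, Gam ξ (rot θ η) * f η := by
    intro θ
    rw [← lint_rot θ]; simp only [hrot]
  rw [lintegral_congr h2]
  rw [lintegral_lintegral_swap]
  · apply lintegral_congr_ae
    filter_upwards [ae_t ξ] with η hη
    have hm : Measurable (fun θ => Gam ξ (rot θ η)) :=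
      (Gam_meas ξ).comp (rot_cont2.comp (by fun_prop : Continuous (fun θ : ℝ => (θ, η)))).measurable
    rw [lintegral_mul_const _ hm, avg_Gam (lt_al hη)]
  · apply Measurable.aemeasurable
    exact ((Gam_meas ξ).comp rot_cont2.measurable).mul (hf.comp measurable_snd)

lemma al_expand (ξ η : H n) : al ξ η = rho ξ ^ 2 + rho η ^ 2 + 2 * rsq ξ * rsq η - 2 * ξ.2.2 * η.2.2 := by
  rw [rho_sq, rho_sq, al, Nn, Nn]; ring

lemma al_le (ξ η : H n) : al ξ η ≤ 2 * (rho ξ + rho η) ^ 2 := by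
  have h1 := rsq_le_rho ξ
  have h2 := rsq_le_rho η
  have h3 := abs_t_le_rho ξ
  have h4 := abs_t_le_rho η
  have h5 : (rsq ξ + rsq η) ^ 2 ≤ (rho ξ + rho η) ^ 2 := by
    apply pow_le_pow_left₀ (add_nonneg (rsq_nonneg _) (rsq_nonneg _)); linarith
  have h6 : (ξ.2.2 - η.2.2) ^ 2 ≤ (rho ξ + rho η) ^ 2 := by
    rw [abs_le] at h3 h4
    apply sq_le_sq' <;> linarith
  unfold al; linarith

lemma al_symm (ξ η : H n) : al ξ η = al η ξ := by unfold al; ring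

lemma be_symm (ξ η : H n) : be ξ η = be η ξ := by
  have h1 : PP ξ η = PP η ξ := by unfold PP; congr 1; ext i; ring
  have h2 : SS ξ η = - SS η ξ := by
    unfold SS; rw [← Finset.sum_neg_distrib]; congr 1; ext i; ring
  rw [be, h1, h2, be]; ring

lemma Kb_symm (ξ η : H n) : Kb ξ η = Kb η ξ := by rw [Kb, al_symm, be_symm, Kb]

/-- Reflected first invariant. -/
def als (l : ℝ) (ξ η : H n) : ℝ := al ξ η + (rho ξ ^ 2 - l ^ 2) * (rho η ^ 2 - l ^ 2) / l ^ 2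

/-- Reflected kernel. -/
def Ks (l : ℝ) (ξ η : H n) : ENNReal := ENNReal.ofReal (kap n (als l ξ η) (be ξ η))

lemma Ks_symm (l : ℝ) (ξ η : H n) : Ks l ξ η = Ks l η ξ := by
  unfold Ks als; rw [al_symm, be_symm, mul_comm (rho ξ ^ 2 - l ^ 2)]

lemma Ks_meas (l : ℝ) (ξ : H n) : Measurable (Ks l ξ) := by
  refine ENNReal.measurable_ofReal.comp (kap_meas ?_ (be_meas ξ))
  unfold als
  exact (al_meas ξ).add (((((rho_cont (n := n)).measurable.pow_const 2).sub_const _).const_mul _).div_const _)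

lemma be_dil (ξ η : H n) (μ : ℝ) : be ξ (dil μ η) = μ ^ 2 * be ξ η := by
  have h1 : PP ξ (dil μ η) = μ * PP ξ η := by
    simp only [PP, dil, Finset.mul_sum]; congr 1; ext i; simp; ring
  have h2 : SS ξ (dil μ η) = μ * SS ξ η := by
    simp only [SS, dil, Finset.mul_sum]; congr 1; ext i; simp; ring
  rw [be, h1, h2, be]; ring

lemma al_J {l : ℝ} (hl : 0 < l) (ξ : H n) {η : H n} (h : 0 < rho η) :
    al ξ (J l η) = (l / rho η) ^ 2 * als l ξ η := by
  rw [als, al_expand, al_expand, rho_J h, J, rsq_dil]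
  simp only [dil]
  field_simp
  ring

lemma be_J (l : ℝ) (ξ η : H n) : be ξ (J l η) = (l / rho η) ^ 2 * be ξ η := be_dil _ _ _

lemma als_J {l : ℝ} (hl : 0 < l) (ξ : H n) {η : H n} (h : 0 < rho η) :
    als l ξ (J l η) = (l / rho η) ^ 2 * al ξ η := by
  rw [als, al_J hl ξ h, als, rho_J h]
  field_simp
  ring

lemma als_ge {l : ℝ} {ξ η : H n} (hl : 0 < l) (h1 : l ≤ rho ξ) (h2 : l ≤ rho η) : al ξ η ≤ als l ξ η := by
  unfold als
  have a1 : 0 ≤ rho ξ ^ 2 - l ^ 2 := by nlinarith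
  have a2 : 0 ≤ rho η ^ 2 - l ^ 2 := by nlinarith
  have := div_nonneg (mul_nonneg a1 a2) (sq_nonneg l)
  linarith

lemma Kb_J {l : ℝ} (hl : 0 < l) {ξ η : H n} (h : 0 < rho η) (hp : 0 < als l ξ η) :
    ENNReal.ofReal ((l / rho η) ^ n) * Kb ξ (J l η) = Ks l ξ η := by
  rw [Kb, Ks, al_J hl ξ h, be_J, ← ENNReal.ofReal_mul (by positivity), kap_scale hp (by positivity)]

lemma Ks_J {l : ℝ} (hl : 0 < l) {ξ η : H n} (h : 0 < rho η) (hp : 0 < al ξ η) :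
    ENNReal.ofReal ((l / rho η) ^ n) * Ks l ξ (J l η) = Kb ξ η := by
  rw [Kb, Ks, als_J hl ξ h, be_J, ← ENNReal.ofReal_mul (by positivity), kap_scale hp (by positivity)]

end Heisenberg

namespace Heisenberg

variable {n : ℕ}

/-! ### Reflection formulas -/

/-- Exterior region. -/
def Om (l : ℝ) : Set (H n) := {η | l < rho η}

lemma Om_meas (l : ℝ) : MeasurableSet (Om l : Set (H n)) :=
  measurableSet_lt measurable_const rho_cont.measurable

lemma lint_split {l : ℝ} (hl : 0 < l) {g : H n → ENNReal} (hg : Measurable g) :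
    ∫⁻ η, g η = ∫⁻ η in Om l, (g η + g (J l η) * ENNReal.ofReal ((l / rho η) ^ (2 * n + 2))) := by
  rw [lintegral_add_left hg, ← lintegral_add_compl g (Om_meas l)]
  congr 1
  unfold Om
  rw [← lint_J hl hg]
  apply setLIntegral_congr
  have h0 := sphere_null (n := n) l
  have : ∀ᵐ η : H n, rho η ≠ l := by
    rw [ae_iff]; simpa using h0
  filter_upwards [this] with η hη
  apply propext
  show (¬ (l < rho η)) ↔ rho η < l
  constructor
  · intro h; exact lt_of_le_of_ne (not_lt.1 h) hη
  · intro h; exact not_lt.2 h.le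

/-- Reflected density. -/
def fr (l : ℝ) (f : H n → ENNReal) (η : H n) : ENNReal :=
  ENNReal.ofReal ((l / rho η) ^ (n + 2)) * f (J l η)

lemma fr_meas (l : ℝ) {f : H n → ENNReal} (hf : Measurable f) : Measurable (fr l f) := by
  unfold fr
  exact ((measurable_const.div rho_cont.measurable).pow_const _).ennreal_ofReal.mul
    (hf.comp (J_meas l))

lemma pow_split {x : ℝ} (hx : 0 ≤ x) : ENNReal.ofReal (x ^ (2 * n + 2)) =
    ENNReal.ofReal (x ^ n) * ENNReal.ofReal (x ^ (n + 2)) := by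
  rw [← ENNReal.ofReal_mul (by positivity), ← pow_add]; congr 2; omega

lemma E1 {l : ℝ} (hl : 0 < l) {f : H n → ENNReal} (hf : Measurable f) {ξ : H n} (hξ : l < rho ξ) :
    ∫⁻ η, Kb ξ η * f η = ∫⁻ η in Om l, (Kb ξ η * f η + Ks l ξ η * fr l f η) := by
  rw [lint_split (g := fun η => Kb ξ η * f η) hl ((Kb_meas ξ).mul hf)]
  apply setLIntegral_congr_fun_ae (Om_meas l)
  filter_upwards [ae_t ξ] with η ht hη
  have hη' : l < rho η := hη
  have hr : 0 < rho η := hl.trans hη'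
  have hal : 0 < al ξ η := lt_of_le_of_lt (by linarith [be_nonneg ξ η]) (lt_al ht)
  have hals : 0 < als l ξ η := hal.trans_le (als_ge hl hξ.le hη'.le)
  rw [← Kb_J hl hr hals, pow_split (by positivity), fr]
  ring

lemma E2 {l : ℝ} (hl : 0 < l) {f : H n → ENNReal} (hf : Measurable f) {ξ : H n} (hξ : l < rho ξ) :
    ENNReal.ofReal ((l / rho ξ) ^ n) * ∫⁻ η, Kb (J l ξ) η * f η =
      ∫⁻ η in Om l, (Ks l ξ η * f η + Kb ξ η * fr l f η) := by
  have hrξ : 0 < rho ξ := hl.trans hξ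
  rw [← lintegral_const_mul (f := fun η => Kb (J l ξ) η * f η) _ ((Kb_meas _).mul hf)]
  have : ∫⁻ η, ENNReal.ofReal ((l / rho ξ) ^ n) * (Kb (J l ξ) η * f η) = ∫⁻ η, Ks l ξ η * f η := by
    apply lintegral_congr_ae
    filter_upwards [ae_t (J l ξ)] with η ht
    have hal : 0 < al (J l ξ) η := lt_of_le_of_lt (by linarith [be_nonneg (J l ξ) η]) (lt_al ht)
    rw [al_symm, al_J hl η hrξ] at hal
    have hals : 0 < als l η ξ := by
      by_contra h
      have : (l / rho ξ) ^ 2 * als l η ξ ≤ 0 := mul_nonpos_of_nonneg_of_nonpos (by positivity) (not_lt.1 h)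
      linarith
    rw [Ks_symm, ← Kb_J hl hrξ hals, Kb_symm (J l ξ)]
    ring
  rw [this, lint_split (g := fun η => Ks l ξ η * f η) hl ((Ks_meas l ξ).mul hf)]
  apply setLIntegral_congr_fun_ae (Om_meas l)
  filter_upwards [ae_t ξ] with η ht hη
  have hη' : l < rho η := hη
  have hr : 0 < rho η := hl.trans hη'
  have hal : 0 < al ξ η := lt_of_le_of_lt (by linarith [be_nonneg ξ η]) (lt_al ht)
  rw [← Ks_J hl hr hal, pow_split (by positivity), fr]
  ring

lemma Ks_le {l : ℝ} (hl : 0 < l) {ξ η : H n} (hξ : l < rho ξ) (hη : l < rho η)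
    (ht : ξ.2.2 ≠ η.2.2) : Ks l ξ η ≤ Kb ξ η :=
  ENNReal.ofReal_le_ofReal (kap_anti' (be_nonneg _ _) (lt_al ht) (als_ge hl hξ.le hη.le))

lemma contraction {l : ℝ} (hl : 0 < l) {f : H n → ENNReal} (hf : Measurable f) {ξ : H n}
    (hξ : l < rho ξ) :
    ENNReal.ofReal ((l / rho ξ) ^ n) * ∫⁻ η, Kb (J l ξ) η * f η ≤
      (∫⁻ η, Kb ξ η * f η) + ∫⁻ η in Om l, Kb ξ η * (fr l f η - f η) := by
  rw [E1 hl hf hξ, E2 hl hf hξ, ← lintegral_add_right (g := fun η => Kb ξ η * (fr l f η - f η)) _ ((Kb_meas ξ).mul ((fr_meas l hf).sub hf))]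
  apply setLIntegral_mono_ae'  (Om_meas l)
  filter_upwards [ae_t ξ] with η ht hη
  have hk := Ks_le hl hξ hη ht
  obtain ⟨d, hd⟩ := exists_add_of_le hk
  rw [hd]
  rcases le_total (f η) (fr l f η) with h | h
  · obtain ⟨e, he⟩ := exists_add_of_le h
    have h1 : (Ks l ξ η + d) * fr l f η ≤ (Ks l ξ η + d) * f η + (Ks l ξ η + d) * (fr l f η - f η) := by
      rw [← mul_add]; gcongr; exact le_add_tsub
    have h2 : Ks l ξ η * f η ≤ Ks l ξ η * fr l f η := by gcongr
    calc _ ≤ Ks l ξ η * fr l f η + ((Ks l ξ η + d) * f η + (Ks l ξ η + d) * (fr l f η - f η)) :=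
          add_le_add h2 h1
      _ = _ := by ring
  · refine le_trans ?_ (le_add_of_nonneg_right (zero_le))
    have h1 : d * fr l f η ≤ d * f η := by gcongr
    calc Ks l ξ η * f η + (Ks l ξ η + d) * fr l f η =
        Ks l ξ η * f η + Ks l ξ η * fr l f η + d * fr l f η := by ring
      _ ≤ Ks l ξ η * f η + Ks l ξ η * fr l f η + d * f η := by gcongr
      _ = _ := by ring

lemma strict_ineq {l : ℝ} (hl : 0 < l) {f : H n → ENNReal} (hf : Measurable f) {ξ : H n}
    (hξ : l < rho ξ) (hle : ∀ η, l < rho η → fr l f η ≤ f η) :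
    ENNReal.ofReal ((l / rho ξ) ^ n) * (∫⁻ η, Kb (J l ξ) η * f η) +
      ∫⁻ η in Om l, (Kb ξ η - Ks l ξ η) * (f η - fr l f η) ≤ ∫⁻ η, Kb ξ η * f η := by
  rw [E1 hl hf hξ, E2 hl hf hξ, ← lintegral_add_right (g := fun η => (Kb ξ η - Ks l ξ η) * (f η - fr l f η)) _ (((Kb_meas ξ).sub (Ks_meas l ξ)).mul (hf.sub (fr_meas l hf)))]
  apply setLIntegral_mono_ae'  (Om_meas l)
  filter_upwards [ae_t ξ] with η ht hη
  have hk := Ks_le hl hξ hη ht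
  have e1 := tsub_add_cancel_of_le hk
  have e2 := tsub_add_cancel_of_le (hle η hη)
  generalize Kb ξ η - Ks l ξ η = d at *
  generalize f η - fr l f η = e at *
  rw [← e1, ← e2]
  apply le_of_eq
  ring

end Heisenberg

namespace Heisenberg

variable {n : ℕ}

/-! ### Moving spheres -/

/-- The representation constant. -/
def c0 (n : ℕ) : ℝ := 2 * π * cm n

lemma c0_pos (hn : 1 ≤ n) : 0 < c0 n := by
  have := cm_pos hn
  unfold c0; positivity

/-- Solutions of the integral system. -/
structure Sol (p q : ℝ) (u v : H n → ℝ) : Prop where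
  hn : 1 ≤ n
  hp0 : 0 < p
  hp1 : p < tau n
  hq0 : 0 < q
  hq1 : q < tau n
  hu : Continuous u
  hv : Continuous v
  up : ∀ ξ, 0 < u ξ
  vp : ∀ ξ, 0 < v ξ
  urot : ∀ θ ξ, u (rot θ ξ) = u ξ
  vrot : ∀ θ ξ, v (rot θ ξ) = v ξ
  repu : ∀ ξ, ENNReal.ofReal (c0 n * u ξ) = ∫⁻ η, Kb ξ η * ENNReal.ofReal (v η ^ p)
  repv : ∀ ξ, ENNReal.ofReal (c0 n * v ξ) = ∫⁻ η, Kb ξ η * ENNReal.ofReal (u η ^ q)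

lemma Sol.symm {p q : ℝ} {u v : H n → ℝ} (S : Sol p q u v) : Sol q p v u :=
  ⟨S.hn, S.hq0, S.hq1, S.hp0, S.hp1, S.hv, S.hu, S.vp, S.up, S.vrot, S.urot, S.repv, S.repu⟩

/-- The Kelvin type transform. -/
def kel (l : ℝ) (u : H n → ℝ) (ξ : H n) : ℝ := (l / rho ξ) ^ n * u (J l ξ)

lemma tau_ineq (hn : 1 ≤ n) {p : ℝ} (h : p < tau n) : (n:ℝ) * p < n + 2 := by
  have : (0:ℝ) < n := by exact_mod_cast hn
  unfold tau at h
  rw [lt_div_iff₀ (by positivity)] at h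
  linarith

variable {p q : ℝ} {u v : H n → ℝ}

lemma fmeas (hv : Continuous v) (p : ℝ) : Measurable (fun η => ENNReal.ofReal (v η ^ p)) :=
  (hv.measurable.pow_const p).ennreal_ofReal

lemma kel_rep (S : Sol p q u v) {l : ℝ} (hl : 0 < l) (ξ : H n) :
    ENNReal.ofReal (c0 n * kel l u ξ) =
      ENNReal.ofReal ((l / rho ξ) ^ n) * ∫⁻ η, Kb (J l ξ) η * ENNReal.ofReal (v η ^ p) := by
  have := rho_nonneg ξ
  rw [← S.repu, ← ENNReal.ofReal_mul (by positivity), kel]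
  congr 1; ring

lemma fr_eq (S : Sol p q u v) {l : ℝ} (hl : 0 < l) {η : H n} (hη : l < rho η) :
    fr l (fun η => ENNReal.ofReal (v η ^ p)) η =
      ENNReal.ofReal ((l / rho η) ^ ((n:ℝ) + 2 - n * p) * kel l v η ^ p) := by
  have hr : 0 < rho η := hl.trans hη
  have hx : 0 < l / rho η := by positivity
  rw [fr, ← ENNReal.ofReal_mul (by positivity), kel, Real.mul_rpow (by positivity) (S.vp _).le,
    ← mul_assoc, ← Real.rpow_natCast (l / rho η) n, ← Real.rpow_mul hx.le, ← Real.rpow_add hx,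
    ← Real.rpow_natCast (l / rho η) (n + 2)]
  congr 3; push_cast; ring

lemma kel_pos (hv : ∀ ξ, 0 < v ξ) {l : ℝ} (hl : 0 < l) {η : H n} (hη : 0 < rho η) : 0 < kel l v η :=
  mul_pos (by positivity) (hv _)

lemma fr_le (S : Sol p q u v) {l : ℝ} (hl : 0 < l) {η : H n} (hη : l < rho η) :
    fr l (fun η => ENNReal.ofReal (v η ^ p)) η ≤ ENNReal.ofReal (kel l v η ^ p) := by
  have hr : 0 < rho η := hl.trans hη
  rw [fr_eq S hl hη]
  apply ENNReal.ofReal_le_ofReal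
  apply mul_le_of_le_one_left (Real.rpow_nonneg (kel_pos S.vp hl hr).le _)
  apply Real.rpow_le_one (by positivity)
  · rw [div_le_one hr]; exact hη.le
  · linarith [tau_ineq S.hn S.hp1]

lemma bnds (hu : Continuous u) (hup : ∀ ξ, 0 < u ξ) (R : ℝ) :
    ∃ m M : ℝ, 0 < m ∧ 0 < M ∧ ∀ η, rho η ≤ R → m ≤ u η ∧ u η ≤ M := by
  rcases le_or_gt 0 R with hR | hR
  · have hne : ({η : H n | rho η ≤ R}).Nonempty := ⟨0, by
      show rho (0 : H n) ≤ R; simp [rho, Nn_zero, hR]⟩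
    obtain ⟨a, _, ha⟩ := (isCompact_rho R).exists_isMinOn hne hu.continuousOn
    obtain ⟨b, _, hb⟩ := (isCompact_rho R).exists_isMaxOn hne hu.continuousOn
    exact ⟨u a, u b, hup a, hup b, fun η hη => ⟨ha hη, hb hη⟩⟩
  · exact ⟨1, 1, one_pos, one_pos, fun η hη => absurd hη (by linarith [rho_nonneg η])⟩

lemma I1_fin (S : Sol p q u v) : ∫⁻ η in {η : H n | Nn η < 1}, Gam 0 η < ⊤ := by
  obtain ⟨m, M, hm, _, h⟩ := bnds S.hv S.vp 1
  have h1 := avg (n := n) (fmeas S.hv p) (fun θ η => by simp only [S.vrot]) 0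
  rw [← S.repu] at h1
  have h2 : ∫⁻ η, Gam 0 η * ENNReal.ofReal (v η ^ p) ≠ ⊤ := by
    intro h
    rw [h, ENNReal.mul_top] at h1
    · exact ENNReal.ofReal_ne_top h1
    · have := pi_pos
      simp; positivity
  have hmp : 0 < m ^ p := by positivity
  have h3 : (∫⁻ η in {η : H n | Nn η < 1}, Gam 0 η) * ENNReal.ofReal (m ^ p) ≤
      ∫⁻ η, Gam 0 η * ENNReal.ofReal (v η ^ p) := by
    rw [← lintegral_mul_const _ (Gam_meas 0)]
    refine le_trans (setLIntegral_mono' (measurableSet_lt Nn_cont.measurable measurable_const) ?_)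
      (setLIntegral_le_lintegral {η : H n | Nn η < 1} _)
    intro η hη
    have hη' : Nn η < 1 := hη
    gcongr
    · exact S.hp0.le
    · exact (h η (by rw [rho_le_iff zero_le_one]; linarith)).1
  by_contra hc
  rw [not_lt, top_le_iff] at hc
  rw [hc, ENNReal.top_mul (by simp; exact hmp)] at h3
  exact h2 (top_le_iff.1 h3)

lemma I_scale {μ : ℝ} (hμ : 0 < μ) : ∫⁻ η in {η : H n | Nn η < μ ^ 4}, Gam 0 η =
    ENNReal.ofReal (μ ^ 2) * ∫⁻ η in {η : H n | Nn η < 1}, Gam 0 η := by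
  have m1 : MeasurableSet {η : H n | Nn η < μ ^ 4} := measurableSet_lt Nn_cont.measurable measurable_const
  have m2 : MeasurableSet {η : H n | Nn η < 1} := measurableSet_lt Nn_cont.measurable measurable_const
  have h1 := lint_dil (n := n) hμ ({η : H n | Nn η < μ ^ 4}.indicator (Gam 0))
  have e : ∀ η : H n, {η : H n | Nn η < μ ^ 4}.indicator (Gam 0) (dil μ η) =
      ENNReal.ofReal ((μ ^ (2 * n))⁻¹) * {η : H n | Nn η < 1}.indicator (Gam 0) η := by
    intro η
    by_cases h : Nn η < 1
    · rw [indicator_of_mem (s := {η : H n | Nn η < 1}) h, indicator_of_mem]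
      · rw [Gam, Gam, Lt_zero_left, Lt_zero_left, Nn_dil, ← ENNReal.ofReal_mul (by positivity),
          Real.mul_rpow (by positivity) (Nn_nonneg _)]
        congr 2
        rw [Real.rpow_neg (by positivity), ← Real.rpow_natCast μ 4, ← Real.rpow_mul hμ.le,
          ← Real.rpow_natCast μ (2 * n)]
        congr 2; push_cast; ring
      · show Nn (dil μ η) < μ ^ 4
        rw [Nn_dil]
        have : 0 < μ ^ 4 := by positivity
        nlinarith
    · rw [indicator_of_notMem (s := {η : H n | Nn η < 1}) h, indicator_of_notMem, mul_zero]
      show ¬ Nn (dil μ η) < μ ^ 4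
      rw [Nn_dil]
      have : 0 < μ ^ 4 := by positivity
      push Not at h ⊢
      nlinarith
  simp only [e] at h1
  rw [lintegral_const_mul _ ((Gam_meas 0).indicator m2), lintegral_indicator m2, lintegral_indicator m1] at h1
  have h2 := congrArg (fun x => ENNReal.ofReal (μ ^ (2 * n + 2)) * x) h1
  simp only [← mul_assoc] at h2
  rw [← ENNReal.ofReal_mul (by positivity), ← ENNReal.ofReal_mul (by positivity),
    mul_inv_cancel₀ (by positivity), ENNReal.ofReal_one, one_mul] at h2
  rw [← h2]
  congr 2
  rw [pow_add]; field_simp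

lemma small (S : Sol p q u v) {ε : ℝ} (hε : 0 < ε) : ∃ δ : ℝ, 0 < δ ∧ ∀ A : Set (H n), MeasurableSet A →
    (∀ θ η, rot θ η ∈ A ↔ η ∈ A) → volume A ≤ ENNReal.ofReal δ → ∀ ξ, ∫⁻ η in A, Kb ξ η ≤ ENNReal.ofReal ε := by
  set I := (∫⁻ η in {η : H n | Nn η < 1}, Gam 0 η).toReal with hI
  have hI0 : 0 ≤ I := ENNReal.toReal_nonneg
  have hIe : ∫⁻ η in {η : H n | Nn η < 1}, Gam 0 η = ENNReal.ofReal I :=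
    (ENNReal.ofReal_toReal (I1_fin S).ne).symm
  have hπ := pi_pos
  obtain ⟨μ, hμ, hμI⟩ : ∃ μ : ℝ, 0 < μ ∧ 2 * π * (μ ^ 2 * I) ≤ ε / 2 := by
    refine ⟨√(ε / (4 * π * (I + 1))), Real.sqrt_pos.2 (by positivity), ?_⟩
    rw [Real.sq_sqrt (by positivity)]
    rw [show 2 * π * (ε / (4 * π * (I + 1)) * I) = ε / 2 * (I / (I + 1)) by field_simp; ring]
    apply mul_le_of_le_one_right (by positivity)
    rw [div_le_one (by positivity)]; linarith
  set k := (μ ^ 4) ^ (-((n:ℝ)/2)) with hk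
  have hk0 : 0 < k := by positivity
  refine ⟨ε / (4 * π * k), by positivity, fun A hA hrot hvol ξ => ?_⟩
  have h1 := avg (n := n) (f := A.indicator 1) (measurable_one.indicator hA) (fun θ η => by
    by_cases h : η ∈ A
    · rw [indicator_of_mem h, indicator_of_mem ((hrot θ η).2 h)]; rfl
    · rw [indicator_of_notMem h, indicator_of_notMem (fun h' => h ((hrot θ η).1 h'))]) ξ
  have e : ∀ g : H n → ENNReal, ∫⁻ η, g η * A.indicator 1 η = ∫⁻ η in A, g η := by
    intro g
    rw [← lintegral_indicator hA]
    congr 1; ext η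
    by_cases h : η ∈ A <;> simp [h]
  rw [e, e] at h1
  rw [h1]
  have m1 : MeasurableSet {η : H n | Nn η < μ ^ 4} := measurableSet_lt Nn_cont.measurable measurable_const
  have h2 : ∫⁻ η in A, Gam ξ η ≤ ENNReal.ofReal (μ ^ 2 * I) + ENNReal.ofReal (k * (ε / (4 * π * k))) := by
    calc ∫⁻ η in A, Gam ξ η ≤ ∫⁻ η in A, ({η : H n | Nn η < μ ^ 4}.indicator (Gam 0) (Lt (-ξ) η) + ENNReal.ofReal k) := by
          apply lintegral_mono
          intro η
          show Gam ξ η ≤ {η : H n | Nn η < μ ^ 4}.indicator (Gam 0) (Lt (-ξ) η) + ENNReal.ofReal k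
          by_cases h : Nn (Lt (-ξ) η) < μ ^ 4
          · rw [indicator_of_mem (s := {η : H n | Nn η < μ ^ 4}) (a := Lt (-ξ) η) h, Gam, Gam, Lt_zero_left]
            exact le_self_add
          · rw [indicator_of_notMem (s := {η : H n | Nn η < μ ^ 4}) (a := Lt (-ξ) η) h, zero_add, Gam]
            apply ENNReal.ofReal_le_ofReal
            exact Real.rpow_le_rpow_of_nonpos (by positivity) (not_lt.1 h) (by linarith [ahalf n])
      _ = (∫⁻ η in A, {η : H n | Nn η < μ ^ 4}.indicator (Gam 0) (Lt (-ξ) η)) + ENNReal.ofReal k * volume A := by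
          rw [lintegral_add_right _ measurable_const, setLIntegral_const]
      _ ≤ (∫⁻ η, {η : H n | Nn η < μ ^ 4}.indicator (Gam 0) (Lt (-ξ) η)) + ENNReal.ofReal k * ENNReal.ofReal (ε / (4 * π * k)) := by
          gcongr
          exact Measure.restrict_le_self
      _ = _ := by
          rw [lint_Lt (-ξ) ({η : H n | Nn η < μ ^ 4}.indicator (Gam 0)), lintegral_indicator m1,
            I_scale hμ, hIe, ← ENNReal.ofReal_mul (by positivity), ← ENNReal.ofReal_mul hk0.le]
  calc ENNReal.ofReal (2 * π) * ∫⁻ η in A, Gam ξ η ≤ ENNReal.ofReal (2 * π) *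
        (ENNReal.ofReal (μ ^ 2 * I) + ENNReal.ofReal (k * (ε / (4 * π * k)))) := by gcongr
    _ = ENNReal.ofReal (2 * π * (μ ^ 2 * I + k * (ε / (4 * π * k)))) := by
        rw [← ENNReal.ofReal_add (by positivity) (by positivity), ← ENNReal.ofReal_mul (by positivity)]
    _ ≤ ENNReal.ofReal ε := by
        apply ENNReal.ofReal_le_ofReal
        have : 2 * π * (k * (ε / (4 * π * k))) = ε / 2 := by field_simp; ring
        rw [mul_add, this]; linarith

lemma lip {m M p : ℝ} (hm : 0 < m) (hp : 0 < p) : ∃ L : ℝ, 0 < L ∧ ∀ x y : ℝ, m ≤ x → x ≤ y → y ≤ M →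
    y ^ p - x ^ p ≤ L * (y - x) := by
  refine ⟨p * (m ^ (p - 1) + |M| ^ (p - 1)) , by positivity, fun x y hx hxy hy => ?_⟩
  have hd : ∀ z ∈ Icc m M, HasDerivAt (fun z : ℝ => z ^ p) (p * z ^ (p - 1)) z := fun z hz =>
    Real.hasDerivAt_rpow_const (Or.inl (hm.trans_le hz.1).ne')
  have := (convex_Icc m M).image_sub_le_mul_sub_of_deriv_le (f := fun z : ℝ => z ^ p)
    (C := p * (m ^ (p - 1) + |M| ^ (p - 1)))
    (fun z hz => (hd z hz).continuousAt.continuousWithinAt)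
    (fun z hz => (hd z (interior_subset hz)).differentiableAt.differentiableWithinAt)
    (fun z hz => by
      have hz' := interior_subset hz
      have hz0 := hm.trans_le hz'.1
      rw [(hd z hz').deriv]
      gcongr
      rcases le_total 0 (p - 1) with h | h
      · have : z ^ (p - 1) ≤ |M| ^ (p - 1) :=
          Real.rpow_le_rpow hz0.le (hz'.2.trans (le_abs_self M)) h
        have : 0 < m ^ (p - 1) := by positivity
        linarith
      · have : z ^ (p - 1) ≤ m ^ (p - 1) := Real.rpow_le_rpow_of_nonpos hm hz'.1 h
        have : 0 ≤ |M| ^ (p - 1) := by positivity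
        linarith) x ⟨hx, hxy.trans hy⟩ y ⟨hx.trans hxy, hy⟩ hxy
  exact this

lemma kel_le {l R0 M : ℝ} (hup : ∀ ξ, 0 < u ξ) (hl : 0 < l) (hR : l ≤ R0) (h : ∀ η, rho η ≤ R0 → u η ≤ M)
    {η : H n} (hη : l < rho η) : kel l u η ≤ M := by
  have hr : 0 < rho η := hl.trans hη
  have h1 : rho (J l η) ≤ R0 := by
    rw [rho_J hr, div_le_iff₀ hr]; nlinarith
  refine le_trans (mul_le_of_le_one_left (hup _).le ?_) (h _ h1)
  apply pow_le_one₀ (by positivity)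
  rw [div_le_one hr]; exact hη.le

lemma step1 (S : Sol p q u v) {l R0 R' m M L ε κ : ℝ} (hl : 0 < l) (hlR : l ≤ R0) (hR' : R' ≤ R0)
    (hb : ∀ η, rho η ≤ R0 → m ≤ v η ∧ v η ≤ M) (hL0 : 0 ≤ L)
    (hL : ∀ x y : ℝ, m ≤ x → x ≤ y → y ≤ M → y ^ p - x ^ p ≤ L * (y - x))
    (hs : ∀ ξ, ∫⁻ η in {η : H n | l < rho η ∧ rho η < R'}, Kb ξ η ≤ ENNReal.ofReal κ)
    (hκ0 : 0 ≤ κ) (hκ : L * κ ≤ c0 n / 2) (hε : 0 ≤ ε)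
    (hA : ∀ η, l < rho η → rho η < R' → kel l v η ≤ v η + ε)
    (hB : ∀ η, l < rho η → R' ≤ rho η → kel l v η ≤ v η) {ξ : H n} (hξ : l < rho ξ) :
    kel l u ξ ≤ u ξ + ε / 2 := by
  have hc := c0_pos S.hn
  set f : H n → ENNReal := fun η => ENNReal.ofReal (v η ^ p) with hf
  have hfm : Measurable f := fmeas S.hv p
  set A : Set (H n) := {η : H n | l < rho η ∧ rho η < R'} with hAd
  have hAm : MeasurableSet A := (measurableSet_lt measurable_const rho_cont.measurable).inter
    (measurableSet_lt rho_cont.measurable measurable_const)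
  have h1 := contraction hl hfm hξ
  rw [← kel_rep S hl, ← S.repu] at h1
  have h2 : ∫⁻ η in Om l, Kb ξ η * (fr l f η - f η) ≤ ENNReal.ofReal κ * ENNReal.ofReal (L * ε) := by
    calc ∫⁻ η in Om l, Kb ξ η * (fr l f η - f η) ≤
        ∫⁻ η in Om l, A.indicator (fun η => Kb ξ η * ENNReal.ofReal (L * ε)) η := by
          apply setLIntegral_mono' (Om_meas l)
          intro η hη
          have hη' : l < rho η := hη
          have hfr := fr_le S hl hη'
          have hkp := kel_pos S.vp hl (hl.trans hη')
          by_cases hR : rho η < R'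
          · rw [indicator_of_mem (show η ∈ A from ⟨hη', hR⟩)]
            gcongr
            refine (tsub_le_tsub_right hfr _).trans ?_
            rw [hf]
            simp only
            rw [← ENNReal.ofReal_sub _ (Real.rpow_nonneg (S.vp η).le _)]
            apply ENNReal.ofReal_le_ofReal
            rcases le_total (kel l v η) (v η) with h | h
            · have : kel l v η ^ p ≤ v η ^ p := Real.rpow_le_rpow hkp.le h S.hp0.le
              have : 0 ≤ L * ε := by positivity
              linarith
            · have a1 := hL (v η) (kel l v η) (hb η (hR.le.trans hR')).1 h
                (kel_le S.vp hl hlR (fun η hη => (hb η hη).2) hη')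
              have a2 := hA η hη' hR
              have a3 : L * (kel l v η - v η) ≤ L * ε := by gcongr; linarith
              linarith
          · rw [indicator_of_notMem (fun h : η ∈ A => hR h.2)]
            have : fr l f η ≤ f η := hfr.trans (ENNReal.ofReal_le_ofReal
              (Real.rpow_le_rpow hkp.le (hB η hη' (not_lt.1 hR)) S.hp0.le))
            rw [tsub_eq_zero_of_le this, mul_zero]
      _ ≤ ∫⁻ η, A.indicator (fun η => Kb ξ η * ENNReal.ofReal (L * ε)) η := setLIntegral_le_lintegral _ _
      _ = (∫⁻ η in A, Kb ξ η) * ENNReal.ofReal (L * ε) := by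
          rw [lintegral_indicator hAm, lintegral_mul_const _ (Kb_meas ξ)]
      _ ≤ _ := by gcongr; exact hs ξ
  have h3 := h1.trans (add_le_add_right h2 _)
  have hu := (S.up ξ).le
  rw [← ENNReal.ofReal_mul hκ0, ← ENNReal.ofReal_add (by positivity) (by positivity),
    ENNReal.ofReal_le_ofReal_iff (by positivity)] at h3
  have h4 : κ * (L * ε) ≤ c0 n * (ε / 2) := by nlinarith
  have h5 : c0 n * kel l u ξ ≤ c0 n * (u ξ + ε / 2) := by rw [mul_add]; linarith
  exact le_of_mul_le_mul_left h5 hc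

/-- The moving sphere property. -/
def TT (u v : H n → ℝ) (l : ℝ) : Prop := ∀ ξ, l < rho ξ → kel l u ξ ≤ u ξ ∧ kel l v ξ ≤ v ξ

lemma step (S : Sol p q u v) (R0 : ℝ) : ∃ δ : ℝ, 0 < δ ∧ ∀ l R' : ℝ, 0 < l → l ≤ R0 → R' ≤ R0 →
    volume {η : H n | l < rho η ∧ rho η < R'} ≤ ENNReal.ofReal δ →
    (∀ ξ, l < rho ξ → R' ≤ rho ξ → kel l u ξ ≤ u ξ ∧ kel l v ξ ≤ v ξ) → TT u v l := by
  obtain ⟨m1, M1, hm1, hM1, hb1⟩ := bnds S.hu S.up R0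
  obtain ⟨m2, M2, hm2, hM2, hb2⟩ := bnds S.hv S.vp R0
  obtain ⟨L1, hL1, hl1⟩ := lip (M := M1) hm1 S.hq0
  obtain ⟨L2, hL2, hl2⟩ := lip (M := M2) hm2 S.hp0
  have hc := c0_pos S.hn
  set κ := c0 n / (2 * (L1 + L2)) with hκ
  have hκ0 : 0 < κ := by positivity
  have hκe : (L1 + L2) * κ = c0 n / 2 := by rw [hκ]; field_simp
  obtain ⟨δ, hδ, hsm⟩ := small S hκ0
  refine ⟨δ, hδ, fun l R' hl hlR hR' hvol hout => ?_⟩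
  have hAm : MeasurableSet {η : H n | l < rho η ∧ rho η < R'} :=
    (measurableSet_lt measurable_const rho_cont.measurable).inter
    (measurableSet_lt rho_cont.measurable measurable_const)
  have hs := hsm _ hAm (fun θ η => by
    show (l < rho (rot θ η) ∧ rho (rot θ η) < R') ↔ (l < rho η ∧ rho η < R')
    rw [rho_rot]) hvol
  set M := M1 + M2
  have key : ∀ k : ℕ, ∀ ξ, l < rho ξ → kel l u ξ ≤ u ξ + M / 2 ^ k ∧ kel l v ξ ≤ v ξ + M / 2 ^ k := by
    intro k
    induction k with
    | zero =>
      intro ξ hξ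
      have a1 := kel_le S.up hl hlR (fun η hη => (hb1 η hη).2) hξ
      have a2 := kel_le S.vp hl hlR (fun η hη => (hb2 η hη).2) hξ
      have := S.up ξ
      have := S.vp ξ
      rw [pow_zero, div_one]
      constructor <;> linarith
    | succ k ih =>
      intro ξ hξ
      have e : M / 2 ^ (k + 1) = M / 2 ^ k / 2 := by rw [pow_succ, div_div]
      rw [e]
      constructor
      · exact step1 S hl hlR hR' hb2 hL2.le hl2 hs hκ0.le (by nlinarith) (by positivity)
          (fun η h _ => (ih η h).2) (fun η h h' => (hout η h h').2) hξ
      · exact step1 S.symm hl hlR hR' hb1 hL1.le hl1 hs hκ0.le (by nlinarith) (by positivity)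
          (fun η h _ => (ih η h).1) (fun η h h' => (hout η h h').1) hξ
  have hlim : Tendsto (fun k : ℕ => M / 2 ^ k) atTop (𝓝 0) := by
    have := (tendsto_pow_atTop_nhds_zero_of_lt_one (r := (1/2:ℝ)) (by norm_num) (by norm_num)).const_mul M
    rw [mul_zero] at this
    refine this.congr fun k => ?_
    rw [one_div, inv_pow, div_eq_mul_inv]
  intro ξ hξ
  constructor
  · have := ge_of_tendsto' (tendsto_const_nhds.add hlim) (fun k => (key k ξ hξ).1)
    rwa [add_zero] at this
  · have := ge_of_tendsto' (tendsto_const_nhds.add hlim) (fun k => (key k ξ hξ).2)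
    rwa [add_zero] at this

end Heisenberg

namespace Heisenberg

variable {n : ℕ} {p q : ℝ} {u v : H n → ℝ}

lemma vol_small (l : ℝ) {δ : ℝ} (hδ : 0 < δ) :
    ∃ d : ℝ, 0 < d ∧ d ≤ 1 ∧ volume {η : H n | l < rho η ∧ rho η < l + d} ≤ ENNReal.ofReal δ := by
  set s : ℕ → Set (H n) := fun k => {η : H n | l < rho η ∧ rho η < l + 1 / ((k:ℝ) + 1)} with hs
  have hm : ∀ k, MeasurableSet (s k) := fun k =>
    (measurableSet_lt measurable_const rho_cont.measurable).inter
    (measurableSet_lt rho_cont.measurable measurable_const)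
  have hanti : Antitone s := by
    intro a b hab η hη
    refine ⟨hη.1, hη.2.trans_le ?_⟩
    have := Nat.one_div_le_one_div (α := ℝ) hab
    linarith
  have ht := tendsto_measure_iInter_atTop (μ := (volume : Measure (H n))) (s := s)
    (fun k => (hm k).nullMeasurableSet) hanti ⟨0, ne_of_lt (lt_of_le_of_lt
      (measure_mono (t := {η : H n | rho η < l + 1}) (fun η hη => by
        have := hη.2
        simpa using this)) (vol_ball_fin (l + 1)))⟩
  have he : ⋂ k, s k = ∅ := by
    ext η
    simp only [mem_iInter, mem_empty_iff_false, iff_false]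
    intro h
    have h0 : 0 < rho η - l := by linarith [(h 0).1]
    obtain ⟨k, hk⟩ := exists_nat_one_div_lt h0
    have := (h k).2
    linarith
  rw [he, measure_empty] at ht
  have := (ht.eventually (gt_mem_nhds (ENNReal.ofReal_pos.2 hδ))).exists
  obtain ⟨k, hk⟩ := this
  refine ⟨1 / ((k:ℝ) + 1), by positivity, ?_, hk.le⟩
  rw [div_le_one (by positivity)]
  have : (0:ℝ) ≤ k := by positivity
  linarith

/-- Kernel constant. -/
def kc (n : ℕ) : ℝ := 2 * π * 2 ^ (-((n:ℝ)/2))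

lemma kc_pos : 0 < kc n := by have := pi_pos; unfold kc; positivity

lemma kap_low {ξ η : H n} {s : ℝ} (hs : 0 < s) (h : rho ξ + rho η ≤ s) (ht : ξ.2.2 ≠ η.2.2) :
    kc n * (s ^ n)⁻¹ ≤ kap n (al ξ η) (be ξ η) := by
  have hb := be_nonneg ξ η
  have ha := lt_al ht
  refine le_trans ?_ (kap_ge hb ha)
  have h1 : al ξ η ≤ 2 * s ^ 2 := (al_le ξ η).trans (by
    have := rho_nonneg ξ
    have := rho_nonneg η
    gcongr)
  have h2 : (2 * s ^ 2) ^ (-((n:ℝ)/2)) ≤ al ξ η ^ (-((n:ℝ)/2)) :=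
    Real.rpow_le_rpow_of_nonpos (by linarith) h1 (by linarith [ahalf n])
  have h3 : (2 * s ^ 2) ^ (-((n:ℝ)/2)) = 2 ^ (-((n:ℝ)/2)) * (s ^ n)⁻¹ := by
    rw [Real.mul_rpow (by norm_num) (by positivity)]
    congr 1
    rw [← Real.rpow_natCast s 2, ← Real.rpow_mul hs.le, ← Real.rpow_natCast s n, ← Real.rpow_neg hs.le]
    congr 1; push_cast; ring
  have := pi_pos
  calc kc n * (s ^ n)⁻¹ = 2 * π * (2 * s ^ 2) ^ (-((n:ℝ)/2)) := by rw [h3, kc]; ring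
    _ ≤ _ := by gcongr

lemma int_low {ξ : H n} {s c : ℝ} (hs : 0 < s) {B : Set (H n)} (hB : MeasurableSet B)
    {f : H n → ENNReal} (h : ∀ η ∈ B, rho ξ + rho η ≤ s) (hf : ∀ η ∈ B, ENNReal.ofReal c ≤ f η) :
    ENNReal.ofReal (kc n * (s ^ n)⁻¹) * ENNReal.ofReal c * volume B ≤ ∫⁻ η, Kb ξ η * f η := by
  rw [← setLIntegral_const]
  refine le_trans ?_ (setLIntegral_le_lintegral B _)
  apply setLIntegral_mono_ae' hB
  filter_upwards [ae_t ξ] with η ht hη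
  apply mul_le_mul' _ (hf η hη)
  exact ENNReal.ofReal_le_ofReal (kap_low hs (h η hη) ht)

lemma vol_eq {B : Set (H n)} (h0 : 0 < volume B) {R : ℝ} (hR : ∀ η ∈ B, rho η < R) :
    ∃ V : ℝ, 0 < V ∧ volume B = ENNReal.ofReal V := by
  have h1 : volume B ≠ ⊤ := ne_of_lt ((measure_mono (t := {η : H n | rho η < R}) hR).trans_lt (vol_ball_fin R))
  exact ⟨(volume B).toReal, ENNReal.toReal_pos h0.ne' h1, (ENNReal.ofReal_toReal h1).symm⟩

lemma low0 (S : Sol p q u v) : ∃ c : ℝ, 0 < c ∧ ∀ ξ, c * ((1 + rho ξ) ^ n)⁻¹ ≤ u ξ := by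
  obtain ⟨m, M, hm, _, hb⟩ := bnds S.hv S.vp 1
  obtain ⟨V, hV, hVe⟩ := vol_eq (vol_ball_pos (n := n) one_pos) (R := 1) (fun η h => h)
  have hc := c0_pos S.hn
  have hk := kc_pos (n := n)
  refine ⟨kc n * m ^ p * V / c0 n, by positivity, fun ξ => ?_⟩
  have hr := rho_nonneg ξ
  have h1 := int_low (ξ := ξ) (s := 1 + rho ξ) (c := m ^ p) (by positivity)
    (measurableSet_lt rho_cont.measurable measurable_const)
    (B := {η : H n | rho η < 1}) (f := fun η => ENNReal.ofReal (v η ^ p))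
    (fun η (h : rho η < 1) => by linarith)
    (fun η (h : rho η < 1) => ENNReal.ofReal_le_ofReal (Real.rpow_le_rpow hm.le (hb η h.le).1 S.hp0.le))
  rw [← S.repu, hVe, ← ENNReal.ofReal_mul (by positivity), ← ENNReal.ofReal_mul (by positivity),
    ENNReal.ofReal_le_ofReal_iff (mul_nonneg hc.le (S.up ξ).le)] at h1
  rw [div_mul_eq_mul_div, div_le_iff₀ hc]
  linarith

lemma low_both (S : Sol p q u v) : ∃ c : ℝ, 0 < c ∧ ∀ ξ, c * ((1 + rho ξ) ^ n)⁻¹ ≤ u ξ ∧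
    c * ((1 + rho ξ) ^ n)⁻¹ ≤ v ξ := by
  obtain ⟨c1, h1, H1⟩ := low0 S
  obtain ⟨c2, h2, H2⟩ := low0 S.symm
  refine ⟨min c1 c2, lt_min h1 h2, fun ξ => ?_⟩
  have hr := rho_nonneg ξ
  exact ⟨le_trans (by gcongr; exact min_le_left _ _) (H1 ξ), le_trans (by gcongr; exact min_le_right _ _) (H2 ξ)⟩

lemma kel_start {M c r0 l : ℝ} (hM : ∀ η, rho η ≤ 1 → u η ≤ M) (hr0 : 0 < r0)
    (hl : 0 < l) (hl1 : l ≤ 1) (hc : l ^ n * M ≤ c * ((1 + 1 / r0) ^ n)⁻¹) (hc0 : 0 ≤ c)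
    (hlow : ∀ ξ, c * ((1 + rho ξ) ^ n)⁻¹ ≤ u ξ) {ξ : H n} (h1 : l < rho ξ) (h2 : r0 ≤ rho ξ) :
    kel l u ξ ≤ u ξ := by
  have hr : 0 < rho ξ := hl.trans h1
  refine le_trans ?_ (hlow ξ)
  have e1 : rho (J l ξ) ≤ 1 := by
    rw [rho_J hr, div_le_iff₀ hr]; nlinarith
  have e2 : 1 + rho ξ ≤ (1 + 1 / r0) * rho ξ := by
    have : 1 ≤ 1 / r0 * rho ξ := by rw [one_div, inv_mul_eq_div, le_div_iff₀ hr0]; linarith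
    linarith
  calc kel l u ξ ≤ (l / rho ξ) ^ n * M := by unfold kel; gcongr; exact hM _ e1
    _ = (l ^ n * M) * (rho ξ ^ n)⁻¹ := by rw [div_pow]; ring
    _ ≤ c * ((1 + 1 / r0) ^ n)⁻¹ * (rho ξ ^ n)⁻¹ := by gcongr
    _ = c * (((1 + 1 / r0) * rho ξ) ^ n)⁻¹ := by rw [mul_pow, mul_inv]; ring
    _ ≤ _ := by gcongr

lemma start (S : Sol p q u v) : ∃ l0 : ℝ, 0 < l0 ∧ ∀ l, 0 < l → l ≤ l0 → TT u v l := by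
  obtain ⟨δ, hδ, hst⟩ := step S 1
  obtain ⟨r0, hr0, hr1, hvol⟩ := vol_small (n := n) 0 hδ
  obtain ⟨c, hc, hlow⟩ := low_both S
  obtain ⟨_, M1, _, hM1, hb1⟩ := bnds S.hu S.up 1
  obtain ⟨_, M2, _, hM2, hb2⟩ := bnds S.hv S.vp 1
  set M := M1 + M2
  set c' := c * ((1 + 1 / r0) ^ n)⁻¹ with hc'
  have hc'0 : 0 < c' := by positivity
  refine ⟨min 1 (c' / M), by positivity, fun l hl hl0 => ?_⟩
  have hl1 : l ≤ 1 := hl0.trans (min_le_left _ _)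
  have hlc : l ^ n * M ≤ c' := by
    have a : l ^ n ≤ l := pow_le_of_le_one hl.le hl1 (by have := S.hn; omega)
    have b : l ≤ c' / M := hl0.trans (min_le_right _ _)
    rw [le_div_iff₀ (by positivity)] at b
    exact le_trans (by gcongr) b
  rw [zero_add] at hvol
  apply hst l r0 hl hl1 hr1
  · refine le_trans (measure_mono (t := {η : H n | 0 < rho η ∧ rho η < r0}) ?_) hvol
    intro η hη
    exact ⟨hl.trans hη.1, hη.2⟩
  · intro ξ h1 h2
    exact ⟨kel_start (fun η h => (hb1 η h).2.trans (by linarith : M1 ≤ M)) hr0 hl hl1 hlc hc.le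
      (fun ξ => (hlow ξ).1) h1 h2,
      kel_start (fun η h => (hb2 η h).2.trans (by linarith : M2 ≤ M)) hr0 hl hl1 hlc hc.le
      (fun ξ => (hlow ξ).2) h1 h2⟩

lemma kel_eq {l : ℝ} {ξ : H n} (hr : 0 < rho ξ) :
    kel l u ξ = (rho ξ ^ n)⁻¹ * (l ^ n * u (dil l (dil (1 / rho ξ) ξ))) := by
  rw [kel, J, dil_dil, mul_one_div, div_pow]
  ring

lemma kel_cont_l (hu : Continuous u) (ξ : H n) : Continuous (fun l => kel l u ξ) := by
  unfold kel J
  have h1 : Continuous (fun l : ℝ => dil (l / rho ξ) ξ) := dil_cont2.comp (by fun_prop : Continuous fun l : ℝ => (l / rho ξ, ξ))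
  exact ((continuous_id.div_const _).pow _).mul (hu.comp h1)

lemma TT_closed (hu : Continuous u) (hv : Continuous v) : IsClosed {l | TT u v l} := by
  have : {l | TT u v l} = ⋂ ξ, ({l | rho ξ ≤ l} ∪ {l | kel l u ξ ≤ u ξ ∧ kel l v ξ ≤ v ξ}) := by
    ext l
    simp only [TT, mem_setOf_eq, mem_iInter, mem_union]
    refine forall_congr' fun ξ => ?_
    rcases lt_or_ge l (rho ξ) with h | h
    · constructor
      · intro H; exact Or.inr (H h)
      · rintro (H | H) _
        · exact absurd h (not_lt.2 H)
        · exact H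
    · exact ⟨fun _ => Or.inl h, fun _ h' => absurd h' (not_lt.2 h)⟩
  rw [this]
  refine isClosed_iInter fun ξ => IsClosed.union (isClosed_le continuous_const continuous_id) ?_
  exact (isClosed_le (kel_cont_l hu ξ) continuous_const).inter (isClosed_le (kel_cont_l hv ξ) continuous_const)

lemma kel_unif (hu : Continuous u) {l c : ℝ} (hl : 0 < l) (hc : 0 < c) : ∃ ε : ℝ, 0 < ε ∧ ε ≤ 1 ∧
    ∀ l', l ≤ l' → l' < l + ε → ∀ ξ : H n, l < rho ξ → kel l' u ξ ≤ kel l u ξ + c * (rho ξ ^ n)⁻¹ := by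
  set g : ℝ × H n → ℝ := fun x => x.1 ^ n * u (dil x.1 x.2) with hg
  have hgc : Continuous g := (continuous_fst.pow n).mul (hu.comp dil_cont2)
  have hK : IsCompact (Icc l (l + 1) ×ˢ {η : H n | rho η ≤ 1 / l}) := isCompact_Icc.prod (isCompact_rho _)
  have huc := hK.uniformContinuousOn_of_continuous hgc.continuousOn
  rw [Metric.uniformContinuousOn_iff] at huc
  obtain ⟨ε, hε, H⟩ := huc c hc
  refine ⟨min ε 1, by positivity, min_le_right _ _, fun l' h1 h2 ξ hξ => ?_⟩
  have hr : 0 < rho ξ := hl.trans hξ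
  have hζ : rho (dil (1 / rho ξ) ξ) ≤ 1 / l := by
    rw [rho_dil]
    have : (1 / rho ξ) ^ 2 * rho ξ = 1 / rho ξ := by field_simp
    rw [this]
    exact one_div_le_one_div_of_le hl hξ.le
  have h3 : l' < l + ε := h2.trans_le (by linarith [min_le_left ε 1])
  have h4 : l' ≤ l + 1 := h2.le.trans (by linarith [min_le_right ε 1])
  have := H (l', dil (1 / rho ξ) ξ) ⟨⟨h1, h4⟩, hζ⟩ (l, dil (1 / rho ξ) ξ) ⟨⟨le_rfl, by linarith⟩, hζ⟩ (by
    rw [Prod.dist_eq, dist_self, max_eq_left dist_nonneg, Real.dist_eq, abs_of_nonneg (by linarith)]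
    linarith)
  rw [Real.dist_eq, abs_lt] at this
  have h5 : g (l', dil (1 / rho ξ) ξ) ≤ g (l, dil (1 / rho ξ) ξ) + c := by linarith
  rw [kel_eq hr, kel_eq hr]
  calc (rho ξ ^ n)⁻¹ * (l' ^ n * u (dil l' (dil (1 / rho ξ) ξ))) ≤ (rho ξ ^ n)⁻¹ * (g (l, dil (1 / rho ξ) ξ) + c) := by
        gcongr
    _ = _ := by rw [hg]; ring

lemma strict1 (S : Sol p q u v) {l d : ℝ} (hl : 0 < l) (hd : 0 < d) (hT : TT u v l) :
    ∃ c : ℝ, 0 < c ∧ ∀ ξ, l + d ≤ rho ξ → kel l u ξ + c * (rho ξ ^ n)⁻¹ ≤ u ξ := by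
  obtain ⟨m, M, hm, _, hb⟩ := bnds S.hv S.vp (l + 2)
  have hc := c0_pos S.hn
  have hk := kc_pos (n := n)
  have hn0 : (0:ℝ) < n := by exact_mod_cast S.hn
  set γ : ℝ := (n:ℝ) + 2 - n * p with hγ
  have hγ0 : 0 < γ := by have := tau_ineq S.hn S.hp1; linarith
  set B : Set (H n) := {η : H n | l + 1 < rho η ∧ rho η < l + 2} with hB
  have hBm : MeasurableSet B := (measurableSet_lt measurable_const rho_cont.measurable).inter
    (measurableSet_lt rho_cont.measurable measurable_const)
  obtain ⟨V, hV, hVe⟩ : ∃ V : ℝ, 0 < V ∧ volume B = ENNReal.ofReal V := by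
    apply vol_eq (R := l + 2) _ (fun η h => h.2)
    apply IsOpen.measure_pos
    · exact (isOpen_lt continuous_const rho_cont).inter (isOpen_lt rho_cont continuous_const)
    · refine ⟨(0, 0, l + 3 / 2), ?_⟩
      have : rho ((0, 0, l + 3 / 2) : H n) = l + 3 / 2 := by
        simp only [rho, Nn, rsq]
        simp only [Pi.zero_apply, ne_eq, OfNat.ofNat_ne_zero, not_false_eq_true, zero_pow,
          Finset.sum_const_zero, add_zero, zero_add]
        exact Real.sqrt_sq (by linarith)
      constructor <;> rw [this] <;> linarith
  set C : ℝ := 1 + (l + 2) / l with hC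
  have hC0 : 0 < C := by positivity
  set a1 : ℝ := 1 - (l / (l + d)) ^ 2 with ha1
  have ha1p : 0 < a1 := by
    have : l / (l + d) < 1 := by rw [div_lt_one (by positivity)]; linarith
    have h0 : 0 ≤ l / (l + d) := by positivity
    have := pow_lt_one₀ h0 this two_ne_zero
    linarith
  set c1 : ℝ := a1 / (2 * l ^ 2 * C ^ 2) with hc1
  have hc1p : 0 < c1 := by positivity
  set k1 : ℝ := 1 - (1 / (1 + c1)) ^ ((n:ℝ)/2) with hk1
  have hk1p : 0 < k1 := by
    have : (1 / (1 + c1)) ^ ((n:ℝ)/2) < 1 := Real.rpow_lt_one (by positivity)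
      (by rw [div_lt_one (by positivity)]; linarith) (by positivity)
    linarith
  set k2 : ℝ := 1 - (l / (l + 1)) ^ γ with hk2
  have hk2p : 0 < k2 := by
    have : (l / (l + 1)) ^ γ < 1 := Real.rpow_lt_one (by positivity)
      (by rw [div_lt_one (by positivity)]; linarith) hγ0
    linarith
  refine ⟨k1 * (kc n * (C ^ n)⁻¹) * (k2 * m ^ p) * V / c0 n, by positivity, fun ξ hξ => ?_⟩
  have hξl : l < rho ξ := by linarith
  have hr : 0 < rho ξ := hl.trans hξl
  have h1 := strict_ineq hl (fmeas S.hv p) hξl (fun η hη => (fr_le S hl hη).trans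
    (ENNReal.ofReal_le_ofReal (Real.rpow_le_rpow (kel_pos S.vp hl (hl.trans hη)).le (hT η hη).2 S.hp0.le)))
  rw [← kel_rep S hl, ← S.repu] at h1
  set D : ℝ := k1 * (kc n * ((C * rho ξ) ^ n)⁻¹) * (k2 * m ^ p) with hD
  have hD0 : 0 < D := by positivity
  have h2 : ENNReal.ofReal D * volume B ≤ ∫⁻ η in Om l, (Kb ξ η - Ks l ξ η) *
      (ENNReal.ofReal (v η ^ p) - fr l (fun η => ENNReal.ofReal (v η ^ p)) η) := by
    rw [← setLIntegral_const]
    refine le_trans ?_ (lintegral_mono_set (s := B) (fun η hη => by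
      have := hη.1
      show l < rho η
      linarith))
    apply setLIntegral_mono_ae' hBm
    filter_upwards [ae_t ξ] with η ht hη
    have hη1 : l + 1 < rho η := hη.1
    have hη2 : rho η < l + 2 := hη.2
    have hηl : l < rho η := by linarith
    have hrη : 0 < rho η := by linarith
    have hbe := be_nonneg ξ η
    have hal := lt_al ht
    have hal0 : 0 < al ξ η := by linarith
    have hs : rho ξ + rho η ≤ C * rho ξ := by
      have : l + 2 ≤ (l + 2) / l * rho ξ := by
        rw [div_mul_eq_mul_div, le_div_iff₀ hl]; gcongr
      rw [hC]; linarith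
    have hals : (1 + c1) * al ξ η ≤ als l ξ η := by
      have e1 : al ξ η ≤ 2 * (C * rho ξ) ^ 2 := (al_le ξ η).trans (by gcongr)
      have e2 : a1 * rho ξ ^ 2 ≤ rho ξ ^ 2 - l ^ 2 := by
        have : l ≤ l / (l + d) * rho ξ := by
          rw [div_mul_eq_mul_div, le_div_iff₀ (by positivity)]; gcongr
        have : l ^ 2 ≤ (l / (l + d) * rho ξ) ^ 2 := by gcongr
        rw [mul_pow] at this
        rw [ha1]; linarith
      have e3 : 1 ≤ rho η ^ 2 - l ^ 2 := by nlinarith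
      have e4 : c1 * al ξ η ≤ (rho ξ ^ 2 - l ^ 2) * (rho η ^ 2 - l ^ 2) / l ^ 2 := by
        calc c1 * al ξ η ≤ c1 * (2 * (C * rho ξ) ^ 2) := by gcongr
          _ = a1 * rho ξ ^ 2 / l ^ 2 := by rw [hc1]; field_simp
          _ ≤ (rho ξ ^ 2 - l ^ 2) / l ^ 2 := by gcongr
          _ ≤ _ := by
              apply div_le_div_of_nonneg_right _ (by positivity)
              have : 0 ≤ a1 * rho ξ ^ 2 := by positivity
              exact le_mul_of_one_le_right (by linarith) e3
      unfold als; linarith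
    have e5 : kap n (als l ξ η) (be ξ η) ≤ (1 / (1 + c1)) ^ ((n:ℝ)/2) * kap n (al ξ η) (be ξ η) := by
      refine (kap_anti hbe hal (als_ge hl hξl.le hηl.le)).trans ?_
      have := kap_nonneg (n := n) hbe hal
      have hp' : 0 < als l ξ η := lt_of_lt_of_le (by positivity) hals
      apply mul_le_mul_of_nonneg_right _ this
      apply Real.rpow_le_rpow (by positivity) _ (ahalf n)
      rw [div_le_div_iff₀ hp' (by positivity)]
      linarith
    have e6 : k1 * (kc n * ((C * rho ξ) ^ n)⁻¹) ≤ kap n (al ξ η) (be ξ η) - kap n (als l ξ η) (be ξ η) := by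
      have := kap_low (by positivity) hs ht
      have h' : k1 * (kc n * ((C * rho ξ) ^ n)⁻¹) ≤ k1 * kap n (al ξ η) (be ξ η) := by gcongr
      have h'' : k1 * kap n (al ξ η) (be ξ η) = kap n (al ξ η) (be ξ η) - (1 / (1 + c1)) ^ ((n:ℝ)/2) * kap n (al ξ η) (be ξ η) := by
        rw [hk1]; ring
      linarith
    have e7 : k2 * m ^ p ≤ v η ^ p - (l / rho η) ^ γ * kel l v η ^ p := by
      have f1 : (l / rho η) ^ γ ≤ (l / (l + 1)) ^ γ := by
        apply Real.rpow_le_rpow (by positivity) _ hγ0.le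
        gcongr
      have f2 : kel l v η ^ p ≤ v η ^ p :=
        Real.rpow_le_rpow (kel_pos S.vp hl hrη).le (hT η hηl).2 S.hp0.le
      have f3 : m ^ p ≤ v η ^ p := Real.rpow_le_rpow hm.le (hb η hη2.le).1 S.hp0.le
      have f4 : (l / rho η) ^ γ * kel l v η ^ p ≤ (l / (l + 1)) ^ γ * v η ^ p := by
        have := Real.rpow_nonneg (kel_pos S.vp hl hrη).le p
        gcongr
      have f5 : k2 * m ^ p ≤ k2 * v η ^ p := by gcongr
      have f6 : k2 * v η ^ p = v η ^ p - (l / (l + 1)) ^ γ * v η ^ p := by rw [hk2]; ring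
      linarith
    have hkn : 0 ≤ kap n (als l ξ η) (be ξ η) := kap_nonneg hbe (by
      have := als_ge hl hξl.le hηl.le; linarith)
    have hkl := kel_pos S.vp hl hrη
    rw [hD, ENNReal.ofReal_mul (by positivity), fr_eq S hl hηl, Kb, Ks,
      ← ENNReal.ofReal_sub _ hkn, ← ENNReal.ofReal_sub _ (by positivity)]
    exact mul_le_mul' (ENNReal.ofReal_le_ofReal e6) (ENNReal.ofReal_le_ofReal e7)
  have h3 := (add_le_add_right h2 _).trans h1
  have hkl := kel_pos S.up hl hr
  rw [hVe, ← ENNReal.ofReal_mul hD0.le, ← ENNReal.ofReal_add (by positivity) (by positivity),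
    ENNReal.ofReal_le_ofReal_iff (mul_nonneg hc.le (S.up ξ).le)] at h3
  have h4 : c0 n * (k1 * (kc n * (C ^ n)⁻¹) * (k2 * m ^ p) * V / c0 n * (rho ξ ^ n)⁻¹) = D * V := by
    rw [hD, mul_pow, mul_inv]; field_simp
  apply le_of_mul_le_mul_left _ hc
  rw [mul_add, h4]; linarith

lemma cont_step (S : Sol p q u v) {l y : ℝ} (hl : 0 < l) (hT : TT u v l) (hy : l < y) :
    ∃ l', l < l' ∧ l' ≤ y ∧ TT u v l' := by
  obtain ⟨δ, hδ, hst⟩ := step S (l + 1)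
  obtain ⟨d, hd, hd1, hvol⟩ := vol_small (n := n) l hδ
  obtain ⟨c1, hc1, H1⟩ := strict1 S hl hd hT
  obtain ⟨c2, hc2, H2⟩ := strict1 S.symm hl hd (fun ξ h => (hT ξ h).symm)
  obtain ⟨ε1, hε1, hε1', G1⟩ := kel_unif S.hu hl hc1
  obtain ⟨ε2, hε2, hε2', G2⟩ := kel_unif S.hv hl hc2
  set ε := min (min ε1 ε2) (y - l) with hε
  have hε0 : 0 < ε := lt_min (lt_min hε1 hε2) (by linarith)
  have i1 : ε ≤ ε1 := (min_le_left _ _).trans (min_le_left _ _)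
  have i2 : ε ≤ ε2 := (min_le_left _ _).trans (min_le_right _ _)
  have i3 : ε ≤ y - l := min_le_right _ _
  refine ⟨l + ε / 2, by linarith, by linarith, ?_⟩
  apply hst (l + ε / 2) (l + d) (by linarith) (by linarith) (by linarith)
  · refine le_trans (measure_mono (t := {η : H n | l < rho η ∧ rho η < l + d}) ?_) hvol
    intro η hη
    have := hη.1
    exact ⟨by linarith, hη.2⟩
  · intro ξ h1 h2
    exact ⟨(G1 (l + ε / 2) (by linarith) (by linarith) ξ (by linarith)).trans (H1 ξ h2),
      (G2 (l + ε / 2) (by linarith) (by linarith) ξ (by linarith)).trans (H2 ξ h2)⟩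

lemma TT_all (S : Sol p q u v) {l : ℝ} (hl : 0 < l) : TT u v l := by
  obtain ⟨l0, hl0, h0⟩ := start S
  rcases le_total l l0 with h | h
  · exact h0 l hl h
  have := IsClosed.Icc_subset_of_forall_exists_gt (a := l0) (b := l) (s := {l | TT u v l})
    ((TT_closed S.hu S.hv).inter isClosed_Icc) (h0 l0 hl0 le_rfl) (fun x hx y hy => by
      obtain ⟨l', a, b, c⟩ := cont_step S (hl0.trans_le hx.2.1) hx.1 hy
      exact ⟨l', c, a, b⟩)
  exact this ⟨h, le_rfl⟩

lemma low1 (S : Sol p q u v) : ∃ c : ℝ, 0 < c ∧ ∀ ξ, 1 ≤ rho ξ →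
    c * rho ξ ^ (-((n:ℝ)/2)) ≤ u ξ ∧ c * rho ξ ^ (-((n:ℝ)/2)) ≤ v ξ := by
  obtain ⟨m1, _, hm1, _, hb1⟩ := bnds S.hu S.up 1
  obtain ⟨m2, _, hm2, _, hb2⟩ := bnds S.hv S.vp 1
  refine ⟨min m1 m2, lt_min hm1 hm2, fun ξ hξ => ?_⟩
  have hr : 0 < rho ξ := by linarith
  rcases hξ.eq_or_lt with h | h
  · rw [← h, Real.one_rpow, mul_one]
    exact ⟨(min_le_left _ _).trans (hb1 ξ h.symm.le).1, (min_le_right _ _).trans (hb2 ξ h.symm.le).1⟩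
  · have hs : √(rho ξ) < rho ξ := by
      rw [Real.sqrt_lt' hr]; nlinarith
    have hT := TT_all S (Real.sqrt_pos.2 hr) ξ hs
    have hJ : rho (J (√(rho ξ)) ξ) ≤ 1 := by
      rw [rho_J hr, Real.sq_sqrt hr.le, div_self hr.ne']
    have he : (√(rho ξ) / rho ξ) ^ n = rho ξ ^ (-((n:ℝ)/2)) := by
      rw [Real.sqrt_div_self', ← Real.rpow_natCast, one_div, Real.sqrt_eq_rpow, ← Real.rpow_neg hr.le,
        ← Real.rpow_mul hr.le]
      congr 1; ring
    have hp : 0 < rho ξ ^ (-((n:ℝ)/2)) := by positivity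
    unfold kel at hT
    rw [he] at hT
    constructor
    · refine le_trans ?_ hT.1
      rw [mul_comm]; gcongr; exact (min_le_left _ _).trans (hb1 _ hJ).1
    · refine le_trans ?_ hT.2
      rw [mul_comm]; gcongr; exact (min_le_right _ _).trans (hb2 _ hJ).1

end Heisenberg

namespace Heisenberg

variable {n : ℕ} {p q : ℝ} {u v : H n → ℝ}

lemma shell_meas (r : ℝ) : MeasurableSet {η : H n | r ≤ rho η ∧ rho η < 2 * r} :=
  (measurableSet_le measurable_const rho_cont.measurable).inter
    (measurableSet_lt rho_cont.measurable measurable_const)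

lemma shell_vol {r : ℝ} (hr : 0 < r) : volume {η : H n | r ≤ rho η ∧ rho η < 2 * r} =
    ENNReal.ofReal (r ^ (n + 1)) * volume {η : H n | 1 ≤ rho η ∧ rho η < 2 * 1} := by
  have hs : 0 < √r := Real.sqrt_pos.2 hr
  have h := lint_dil (n := n) hs ({η : H n | r ≤ rho η ∧ rho η < 2 * r}.indicator 1)
  have e : ∀ η : H n, {η : H n | r ≤ rho η ∧ rho η < 2 * r}.indicator (1 : H n → ENNReal) (dil (√r) η) =
      {η : H n | 1 ≤ rho η ∧ rho η < 2 * 1}.indicator 1 η := by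
    intro η
    have : dil (√r) η ∈ {η : H n | r ≤ rho η ∧ rho η < 2 * r} ↔ η ∈ {η : H n | 1 ≤ rho η ∧ rho η < 2 * 1} := by
      simp only [mem_setOf_eq, rho_dil, Real.sq_sqrt hr.le]
      constructor
      · rintro ⟨a, b⟩; constructor <;> nlinarith
      · rintro ⟨a, b⟩; constructor <;> nlinarith
    by_cases h : η ∈ {η : H n | 1 ≤ rho η ∧ rho η < 2 * 1}
    · rw [indicator_of_mem h, indicator_of_mem (this.2 h)]; rfl
    · rw [indicator_of_notMem h, indicator_of_notMem (fun h' => h (this.1 h'))]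
  simp only [e] at h
  rw [lintegral_indicator_one (shell_meas 1), lintegral_indicator_one (shell_meas r)] at h
  have e2 : √r ^ (2 * n + 2) = r ^ (n + 1) := by
    rw [show 2 * n + 2 = 2 * (n + 1) by ring, pow_mul, Real.sq_sqrt hr.le]
  rw [e2] at h
  rw [h, ← mul_assoc, ← ENNReal.ofReal_mul (by positivity), mul_inv_cancel₀ (by positivity), ENNReal.ofReal_one, one_mul]

lemma boot (S : Sol p q u v) {a c : ℝ} (ha : 0 ≤ a) (hc : 0 < c)
    (h : ∀ ξ, 1 ≤ rho ξ → c * rho ξ ^ (-a) ≤ v ξ) :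
    ∃ c' : ℝ, 0 < c' ∧ ∀ ξ, 1 ≤ rho ξ → c' * rho ξ ^ (-(p * a - 1)) ≤ u ξ := by
  have hc0 := c0_pos S.hn
  have hk := kc_pos (n := n)
  obtain ⟨V, hV, hVe⟩ : ∃ V : ℝ, 0 < V ∧ volume {η : H n | 1 ≤ rho η ∧ rho η < 2 * 1} = ENNReal.ofReal V := by
    apply vol_eq (R := 2 * 1) _ (fun η h => h.2)
    refine lt_of_lt_of_le (b := volume {η : H n | 1 < rho η ∧ rho η < 2}) ?_ (measure_mono ?_)
    · apply IsOpen.measure_pos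
      · exact (isOpen_lt continuous_const rho_cont).inter (isOpen_lt rho_cont continuous_const)
      · refine ⟨(0, 0, 3 / 2), ?_⟩
        have : rho ((0, 0, 3 / 2) : H n) = 3 / 2 := by
          simp only [rho, Nn, rsq]
          simp only [Pi.zero_apply, ne_eq, OfNat.ofNat_ne_zero, not_false_eq_true, zero_pow,
            Finset.sum_const_zero, add_zero, zero_add]
          exact Real.sqrt_sq (by norm_num)
        constructor <;> rw [this] <;> norm_num
    · intro η hη
      exact ⟨hη.1.le, by have := hη.2; linarith⟩
  refine ⟨kc n * (3 ^ n)⁻¹ * (c * 2 ^ (-a)) ^ p * V / c0 n, by positivity, fun ξ hξ => ?_⟩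
  have hr : 0 < rho ξ := by linarith
  have h1 := int_low (ξ := ξ) (s := 3 * rho ξ) (c := (c * (2 * rho ξ) ^ (-a)) ^ p) (by positivity)
    (shell_meas (rho ξ)) (f := fun η => ENNReal.ofReal (v η ^ p))
    (fun η h => by linarith [h.2])
    (fun η hη => by
      apply ENNReal.ofReal_le_ofReal
      apply Real.rpow_le_rpow (by positivity) _ S.hp0.le
      have h1 := hη.1
      have h2 := hη.2
      refine le_trans ?_ (h η (hξ.trans h1))
      have := Real.rpow_le_rpow_of_nonpos (hr.trans_le h1) h2.le (by linarith : -a ≤ 0)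
      gcongr)
  rw [← S.repu, shell_vol hr, hVe, ← ENNReal.ofReal_mul (by positivity), ← ENNReal.ofReal_mul (by positivity),
    ← ENNReal.ofReal_mul (by positivity),
    ENNReal.ofReal_le_ofReal_iff (mul_nonneg hc0.le (S.up ξ).le)] at h1
  apply le_of_mul_le_mul_left _ hc0
  refine le_trans (le_of_eq ?_) h1
  have e1 : (c * (2 * rho ξ) ^ (-a)) ^ p = (c * 2 ^ (-a)) ^ p * rho ξ ^ (-(p * a)) := by
    rw [Real.mul_rpow (by norm_num) hr.le, ← mul_assoc, Real.mul_rpow (by positivity) (by positivity),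
      ← Real.rpow_mul hr.le]
    congr 2; ring
  have e2 : rho ξ ^ (-(p * a - 1)) = rho ξ ^ (-(p * a)) * rho ξ := by
    rw [show -(p * a - 1) = -(p * a) + 1 by ring, Real.rpow_add hr, Real.rpow_one]
  rw [e1, e2, mul_pow, pow_succ]
  field_simp

lemma boot2 (S : Sol p q u v) {P a b c : ℝ} (hpP : p ≤ P) (ha : 0 ≤ a) (hc : 0 < c) (hab : P * a - 1 ≤ b)
    (h : ∀ ξ, 1 ≤ rho ξ → c * rho ξ ^ (-a) ≤ v ξ) :
    ∃ c' : ℝ, 0 < c' ∧ ∀ ξ, 1 ≤ rho ξ → c' * rho ξ ^ (-b) ≤ u ξ := by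
  obtain ⟨c', hc', h'⟩ := boot S ha hc h
  refine ⟨c', hc', fun ξ hξ => le_trans ?_ (h' ξ hξ)⟩
  have : p * a ≤ P * a := by gcongr
  gcongr
  linarith

lemma low_const (S : Sol p q u v) : ∃ c : ℝ, 0 < c ∧ ∀ ξ, 1 ≤ rho ξ → c ≤ u ξ ∧ c ≤ v ξ := by
  have hn0 : (0:ℝ) < n := by exact_mod_cast S.hn
  set P : ℝ := max p (max q 1) with hP
  have hpP : p ≤ P := le_max_left _ _
  have hqP : q ≤ P := (le_max_left _ _).trans (le_max_right _ _)
  have h1P : 1 ≤ P := (le_max_right _ _).trans (le_max_right _ _)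
  have hPt : (n:ℝ) * P < n + 2 := by
    have a1 := tau_ineq S.hn S.hp1
    have a2 := tau_ineq S.hn S.hq1
    rw [hP, mul_max_of_nonneg _ _ hn0.le, mul_max_of_nonneg _ _ hn0.le]
    exact max_lt a1 (max_lt a2 (by linarith))
  set δ : ℝ := 1 - (n:ℝ) / 2 * (P - 1) with hδ
  have hδ0 : 0 < δ := by rw [hδ]; nlinarith
  have key : ∀ k : ℕ, ∃ c : ℝ, 0 < c ∧ ∀ ξ, 1 ≤ rho ξ →
      c * rho ξ ^ (-(max ((n:ℝ)/2 - k * δ) 0)) ≤ u ξ ∧ c * rho ξ ^ (-(max ((n:ℝ)/2 - k * δ) 0)) ≤ v ξ := by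
    intro k
    induction k with
    | zero =>
      have := low1 S
      simpa [max_eq_left (ahalf n)] using this
    | succ k ih =>
      obtain ⟨c, hc, h⟩ := ih
      set a := max ((n:ℝ)/2 - k * δ) 0 with ha
      have ha0 : 0 ≤ a := le_max_right _ _
      have han : a ≤ n / 2 := max_le (by have : 0 ≤ k * δ := by positivity
                                         linarith) (ahalf n)
      have hstep : P * a - 1 ≤ max ((n:ℝ)/2 - (k + 1 : ℕ) * δ) 0 := by
        have b1 : (P - 1) * a ≤ (P - 1) * (n / 2) := by
          apply mul_le_mul_of_nonneg_left han; linarith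
        have b2 : P * a - 1 ≤ a - δ := by rw [hδ]; linarith
        refine b2.trans ?_
        rcases le_total ((n:ℝ)/2 - k * δ) 0 with h | h
        · rw [ha, max_eq_right h]
          exact le_trans (by linarith) (le_max_right _ _)
        · rw [ha, max_eq_left h]
          refine le_trans (le_of_eq ?_) (le_max_left _ _)
          push_cast; ring
      obtain ⟨c1, hc1, h1⟩ := boot2 S hpP ha0 hc hstep (fun ξ hξ => (h ξ hξ).2)
      obtain ⟨c2, hc2, h2⟩ := boot2 S.symm hqP ha0 hc hstep (fun ξ hξ => (h ξ hξ).1)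
      refine ⟨min c1 c2, lt_min hc1 hc2, fun ξ hξ => ⟨le_trans ?_ (h1 ξ hξ), le_trans ?_ (h2 ξ hξ)⟩⟩
      · have := rho_nonneg ξ
        gcongr; exact min_le_left _ _
      · have := rho_nonneg ξ
        gcongr; exact min_le_right _ _
  obtain ⟨k, hk⟩ := exists_nat_gt ((n:ℝ) / 2 / δ)
  rw [div_lt_iff₀ hδ0] at hk
  obtain ⟨c, hc, h⟩ := key k
  rw [max_eq_right (by linarith)] at h
  simp only [neg_zero, Real.rpow_zero, mul_one] at h
  exact ⟨c, hc, h⟩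

theorem main (n : ℕ) (hn : 1 ≤ n) (p q : ℝ)
    (hp0 : 0 < p) (hp1 : p < tau n) (hq0 : 0 < q) (hq1 : q < tau n) (u v : H n → ℝ)
    (hu : Continuous u) (hv : Continuous v) (up : ∀ ξ, 0 < u ξ) (vp : ∀ ξ, 0 < v ξ)
    (hcu : IsCylindrical u) (hcv : IsCylindrical v)
    (h1 : IsWeakSol Set.univ u (fun ξ => v ξ ^ p)) (h2 : IsWeakSol Set.univ v (fun ξ => u ξ ^ q)) : False := by
  have hF : Continuous (fun ξ => v ξ ^ p) := hv.rpow_const (fun ξ => Or.inl (vp ξ).ne')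
  have hG : Continuous (fun ξ => u ξ ^ q) := hu.rpow_const (fun ξ => Or.inl (up ξ).ne')
  have hFp : ∀ ξ, 0 < v ξ ^ p := fun ξ => Real.rpow_pos_of_pos (vp ξ) p
  have hGp : ∀ ξ, 0 < u ξ ^ q := fun ξ => Real.rpow_pos_of_pos (up ξ) q
  have V1 : VW u (fun ξ => v ξ ^ p) := VW_of_weak hu hF hFp h1
  have V2 : VW v (fun ξ => u ξ ^ q) := VW_of_weak hv hG hGp h2
  have nb1 : ∀ s0 c : ℝ, 0 < c → ¬ ∀ η, s0 ≤ rsq η → c ≤ u η := fun s0 c hc h =>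
    blowup hn hv (fun ξ => (vp ξ).le) hG (fun ξ => (hGp ξ).le) V2 (s0 := s0) (c := c ^ q)
      (Real.rpow_pos_of_pos hc q) (fun η hη => Real.rpow_le_rpow hc.le (h η hη) hq0.le)
  have nb2 : ∀ s0 c : ℝ, 0 < c → ¬ ∀ η, s0 ≤ rsq η → c ≤ v η := fun s0 c hc h =>
    blowup hn hu (fun ξ => (up ξ).le) hF (fun ξ => (hFp ξ).le) V1 (s0 := s0) (c := c ^ p)
      (Real.rpow_pos_of_pos hc p) (fun η hη => Real.rpow_le_rpow hc.le (h η hη) hp0.le)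
  have ru : ∀ θ ξ, u (rot θ ξ) = u ξ := fun θ ξ => hcu _ _ (rsq_rot θ ξ) (rot_t θ ξ)
  have rv : ∀ θ ξ, v (rot θ ξ) = v ξ := fun θ ξ => hcv _ _ (rsq_rot θ ξ) (rot_t θ ξ)
  have hπ := pi_pos
  have S : Sol p q u v := by
    refine ⟨hn, hp0, hp1, hq0, hq1, hu, hv, up, vp, ru, rv, fun ξ => ?_, fun ξ => ?_⟩
    · rw [avg (fmeas hv p) (fun θ η => by simp only [rv]),
        ← rep hn hu (fun ξ => (up ξ).le) hcu hF (fun ξ => (hFp ξ).le) V1 nb1 ξ,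
        ← ENNReal.ofReal_mul (by positivity), c0, mul_assoc]
    · rw [avg (fmeas hu q) (fun θ η => by simp only [ru]),
        ← rep hn hv (fun ξ => (vp ξ).le) hcv hG (fun ξ => (hGp ξ).le) V2 nb2 ξ,
        ← ENNReal.ofReal_mul (by positivity), c0, mul_assoc]
  obtain ⟨c, hc, h⟩ := low_const S
  exact nb1 1 c hc (fun η hη => (h η (hη.trans (rsq_le_rho η))).1)

end Heisenberg

namespace Heisenberg

/-- **Corollary 1.2.** For `n ≥ 1` and `0 < p, q < (Q+2)/(Q−2)` with `Q = 2n+2`,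
the Lane–Emden system `−Δ_ℍ u = v^p`, `−Δ_ℍ v = u^q` on `ℍⁿ` has no positive
cylindrical weak solution `(u, v) ∈ (H¹_loc(ℍⁿ) ∩ C⁰(ℍⁿ))²`. -/
theorem no_positive_solution_laneEmden_heisenberg (n : ℕ) (hn : 1 ≤ n) (p q : ℝ)
    (hp0 : 0 < p) (hp1 : p < tau n) (hq0 : 0 < q) (hq1 : q < tau n) :
    ¬ ∃ u v : H n → ℝ,
      Continuous u ∧ Continuous v ∧
      (∀ ξ, 0 < u ξ) ∧ (∀ ξ, 0 < v ξ) ∧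
      IsCylindrical u ∧ IsCylindrical v ∧
      IsWeakSol Set.univ u (fun ξ => v ξ ^ p) ∧
      IsWeakSol Set.univ v (fun ξ => u ξ ^ q) := by
  rintro ⟨u, v, hu, hv, up, vp, hcu, hcv, h1, h2⟩
  exact main n hn p q hp0 hp1 hq0 hq1 u v hu hv up vp hcu hcv h1 h2

end Heisenberg
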